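/- Let m ≥ 2 and L = sl(m|1) over 𝕂. Let U(L) be the enveloping algebra of L, constructed as the quotient of the tensor algebra T(L) by the two-sided ideal generated by the elements A⊗B − (−1)^{|A||B|} B⊗A − ⟨A,B⟩ for homogeneous A,B ∈ L, with the ℤ₂-grading induced from the tensor algebra, and with L acting on U(L) by the adjoint action A·u = π(A)u − (−1)^{|A||u|} u π(A) for homogeneous A ∈ L and homogeneous u ∈ U(L), where π : L → U(L) is the canonical map. Then H²(L, U(L)) = 0: every 2-cocycle of L with coefficients in U(L) is a 2-coboundary. -/

import Mathlib

open Matrix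

variable (K : Type) [Field K]

/-- The space of matrices underlying `gl(m|n)`. -/
abbrev gl (m n : ℕ) : Type := Matrix (Fin (m + n)) (Fin (m + n)) K

/-- The parity of an index: indices `< m` are even, the rest odd. -/
def par (m n : ℕ) (i : Fin (m + n)) : ZMod 2 := if (i : ℕ) < m then 0 else 1

/-- `A` is homogeneous of parity `p`. -/
def IsHom {m n : ℕ} (p : ZMod 2) (A : gl K m n) : Prop :=
  ∀ i j, A i j ≠ 0 → par m n i + par m n j = p

/-- The sign `(-1)^p` for `p : ZMod 2`. -/
def sg (p : ZMod 2) : K := if p = 0 then 1 else -1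

/-- The even (block-diagonal) part of a matrix. -/
def evenP {m n : ℕ} (A : gl K m n) : gl K m n :=
  Matrix.of fun i j => if par m n i = par m n j then A i j else 0

/-- The odd (block-off-diagonal) part of a matrix. -/
def oddP {m n : ℕ} (A : gl K m n) : gl K m n :=
  Matrix.of fun i j => if par m n i = par m n j then 0 else A i j

/-- The super bracket `⟨A,B⟩ = AB - (-1)^{|A||B|} BA` on homogeneous elements,
extended bilinearly to all of `gl(m|n)`. -/
def sbr {m n : ℕ} (A B : gl K m n) : gl K m n :=
  A * B - evenP K B * A - oddP K B * evenP K A + oddP K B * oddP K A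

/-- The supertrace `Str(A) = Tr(a) - Tr(d)`. -/
def str {m n : ℕ} (A : gl K m n) : K := ∑ i, sg K (par m n i) * A i i

/-- `sl(m|n)`, the subspace of supertraceless matrices, as a submodule of `gl(m|n)`. -/
def sl (m n : ℕ) : Submodule K (gl K m n) where
  carrier := {A | str K A = 0}
  add_mem' {A B} hA hB := by
    simp only [Set.mem_setOf_eq, str] at *
    simp [Matrix.add_apply, mul_add, Finset.sum_add_distrib, hA, hB]
  zero_mem' := by simp [str]
  smul_mem' c A hA := by
    simp only [Set.mem_setOf_eq, str] at *
    simp only [Matrix.smul_apply, smul_eq_mul, mul_left_comm, ← Finset.mul_sum, hA, mul_zero]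

/-- The defining relations of the enveloping algebra of `L = sl(m|1)` inside the tensor
algebra `T(L)`: `A ⊗ B - (-1)^{|A||B|} B ⊗ A = ⟨A,B⟩` for homogeneous `A, B ∈ L`. -/
def urel (m : ℕ) :
    TensorAlgebra K ↥(sl K m 1) → TensorAlgebra K ↥(sl K m 1) → Prop := fun u v =>
  ∃ (pA pB : ZMod 2) (A B C : ↥(sl K m 1)),
    IsHom K pA (A : gl K m 1) ∧ IsHom K pB (B : gl K m 1) ∧
    (C : gl K m 1) = sbr K ↑A ↑B ∧
    u = TensorAlgebra.ι K A * TensorAlgebra.ι K B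
        - sg K (pA * pB) • (TensorAlgebra.ι K B * TensorAlgebra.ι K A) ∧
    v = TensorAlgebra.ι K C

/-- The enveloping algebra `U(L)` of `L = sl(m|1)`, the quotient of the tensor algebra by
the two-sided ideal generated by `A ⊗ B - (-1)^{|A||B|} B ⊗ A - ⟨A,B⟩`. -/
abbrev Uenv (m : ℕ) : Type := RingQuot (urel K m)

/-- The canonical map `π : L → U(L)`. -/
def piU (m : ℕ) (A : ↥(sl K m 1)) : Uenv K m :=
  RingQuot.mkAlgHom K (urel K m) (TensorAlgebra.ι K A)

/-- The parity-`p` part of `U(L)` for the `ℤ₂`-grading induced from the tensor algebra: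
the span of the products `π(A₁)⋯π(A_k)` with all `Aᵢ` homogeneous and the sum of their
parities equal to `p` (the empty product `1` having parity `0`). -/
def Upart (m : ℕ) (p : ZMod 2) : Submodule K (Uenv K m) :=
  Submodule.span K {u | ∃ l : List (ZMod 2 × ↥(sl K m 1)),
    (∀ x ∈ l, IsHom K x.1 (x.2 : gl K m 1)) ∧ (l.map Prod.fst).sum = p ∧
    u = (l.map fun x => piU K m x.2).prod}

/-- The adjoint action of a homogeneous `A ∈ L` of parity `pA` on a homogeneous element
`u ∈ U(L)` of parity `pu`: `A·u = π(A)u - (-1)^{|A||u|} u π(A)`. -/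
def adAct (m : ℕ) (pA : ZMod 2) (A : ↥(sl K m 1)) (pu : ZMod 2) (u : Uenv K m) : Uenv K m :=
  piU K m A * u - sg K (pA * pu) • (u * piU K m A)

variable {K}

section Matrices

variable {m : ℕ}

lemma zmod_two_cases (p : ZMod 2) : p = 0 ∨ p = 1 := by
  revert p; decide

@[simp] lemma sg_zero : sg K 0 = 1 := by simp [sg]

@[simp] lemma sg_one : sg K 1 = -1 := by simp [sg]

lemma sg_mul_self (p : ZMod 2) : sg K p * sg K p = 1 := by
  rcases zmod_two_cases p with rfl | rfl <;> simp

lemma sg_add (p q : ZMod 2) : sg K (p + q) = sg K p * sg K q := by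
  rcases zmod_two_cases p with rfl | rfl <;> rcases zmod_two_cases q with rfl | rfl <;>
    simp [show (1 : ZMod 2) + 1 = 0 from rfl]

lemma add_eq_zero_zmod_two (p q : ZMod 2) : p + q = 0 ↔ p = q := by
  revert p q; decide

lemma oddP_of_isHom_zero {A : gl K m 1} (h : IsHom K 0 A) : oddP K A = 0 := by
  ext i j
  simp only [oddP, Matrix.of_apply, ite_eq_left_iff, Matrix.zero_apply]
  intro hij
  by_contra hA
  exact hij ((add_eq_zero_zmod_two _ _).1 (h i j hA))

lemma oddP_of_isHom_one {A : gl K m 1} (h : IsHom K 1 A) : oddP K A = A := by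
  ext i j
  simp only [oddP, Matrix.of_apply, ite_eq_right_iff]
  intro hij
  by_contra hA
  have := h i j (Ne.symm hA)
  rw [(add_eq_zero_zmod_two _ _).2 hij] at this
  exact zero_ne_one this

lemma oddP_of_isHom {p : ZMod 2} {A : gl K m 1} (h : IsHom K p A) :
    oddP K A = if p = 0 then 0 else A := by
  rcases zmod_two_cases p with rfl | rfl
  · simpa using oddP_of_isHom_zero h
  · simpa using oddP_of_isHom_one h

lemma evenP_add_oddP (A : gl K m 1) : evenP K A + oddP K A = A := by
  ext i j
  by_cases h : par m 1 i = par m 1 j <;> simp [evenP, oddP, h]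

lemma isHom_evenP (A : gl K m 1) : IsHom K 0 (evenP K A) := by
  intro i j h
  by_cases hp : par m 1 i = par m 1 j
  · exact (add_eq_zero_zmod_two _ _).2 hp
  · simp [evenP, hp] at h

lemma isHom_oddP (A : gl K m 1) : IsHom K 1 (oddP K A) := by
  intro i j h
  by_cases hp : par m 1 i = par m 1 j
  · simp [oddP, hp] at h
  · revert hp
    generalize par m 1 i = p
    generalize par m 1 j = q
    revert p q; decide

/-- The odd part as a linear map. -/
def oddPL : gl K m 1 →ₗ[K] gl K m 1 where
  toFun := oddP K
  map_add' A B := by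
    ext i j
    by_cases h : par m 1 i = par m 1 j <;> simp [oddP, h]
  map_smul' c A := by
    ext i j
    by_cases h : par m 1 i = par m 1 j <;> simp [oddP, h]

@[simp] lemma oddPL_apply (A : gl K m 1) : oddPL A = oddP K A := rfl

lemma sbr_eq (A B : gl K m 1) :
    sbr K A B = A * B - B * A + (2 : K) • (oddPL B * oddPL A) := by
  have hA := evenP_add_oddP A
  have hB := evenP_add_oddP B
  have h : B * A = evenP K B * A + (oddP K B * evenP K A + oddP K B * oddP K A) := by
    rw [← mul_add, hA, ← add_mul, hB]
  rw [sbr, h, two_smul]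
  simp only [oddPL_apply]
  abel

/-- The super bracket as a bilinear map. -/
def sbrL : gl K m 1 →ₗ[K] gl K m 1 →ₗ[K] gl K m 1 :=
  LinearMap.mk₂ K (sbr K)
    (fun A B C => by simp only [sbr_eq, map_add, add_mul, mul_add, smul_add]; abel)
    (fun c A B => by
      simp only [sbr_eq, map_smul, smul_mul_assoc, mul_smul_comm, smul_sub, smul_add]
      rw [smul_comm (2 : K) c])
    (fun A B C => by simp only [sbr_eq, map_add, add_mul, mul_add, smul_add]; abel)
    (fun c A B => by
      simp only [sbr_eq, map_smul, smul_mul_assoc, mul_smul_comm, smul_sub, smul_add]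
      rw [smul_comm (2 : K) c])

@[simp] lemma sbrL_apply (A B : gl K m 1) : sbrL A B = sbr K A B := rfl

lemma sbr_of_isHom {pA pB : ZMod 2} {A B : gl K m 1} (hA : IsHom K pA A) (hB : IsHom K pB B) :
    sbr K A B = A * B - sg K (pA * pB) • (B * A) := by
  rw [sbr_eq]
  rcases zmod_two_cases pA with rfl | rfl <;> rcases zmod_two_cases pB with rfl | rfl <;>
    simp only [oddPL_apply, oddP_of_isHom hA, oddP_of_isHom hB] <;> simp [two_smul]

lemma IsHom.mul {pA pB : ZMod 2} {A B : gl K m 1} (hA : IsHom K pA A) (hB : IsHom K pB B) :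
    IsHom K (pA + pB) (A * B) := by
  intro i j h
  rw [Matrix.mul_apply] at h
  obtain ⟨k, -, hk⟩ := Finset.exists_ne_zero_of_sum_ne_zero h
  have h1 := hA i k (left_ne_zero_of_mul hk)
  have h2 := hB k j (right_ne_zero_of_mul hk)
  rw [← h1, ← h2]
  generalize par m 1 i = p
  generalize par m 1 j = q
  generalize par m 1 k = t
  revert p q t; decide

lemma IsHom.smul {p : ZMod 2} {A : gl K m 1} (c : K) (hA : IsHom K p A) : IsHom K p (c • A) := by
  intro i j h
  exact hA i j (fun h0 => h (by simp [h0]))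

lemma IsHom.sub {p : ZMod 2} {A B : gl K m 1} (hA : IsHom K p A) (hB : IsHom K p B) :
    IsHom K p (A - B) := by
  intro i j h
  by_cases h0 : A i j = 0
  · exact hB i j (fun h1 => h (by simp [h0, h1]))
  · exact hA i j h0

lemma IsHom.sbr {pA pB : ZMod 2} {A B : gl K m 1} (hA : IsHom K pA A) (hB : IsHom K pB B) :
    IsHom K (pA + pB) (sbr K A B) := by
  rw [sbr_of_isHom hA hB]
  exact (hA.mul hB).sub (IsHom.smul _ (add_comm pB pA ▸ hB.mul hA))

lemma isHom_one : IsHom K 0 (1 : gl K m 1) := by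
  intro i j h
  rw [Matrix.one_apply] at h
  have : i = j := by by_contra hij; simp [hij] at h
  subst this
  exact (add_eq_zero_zmod_two _ _).2 rfl

lemma sbr_one_left (B : gl K m 1) : sbr K 1 B = 0 := by
  rw [sbr_eq]; simp [oddP_of_isHom_zero isHom_one]

lemma sbr_one_right (B : gl K m 1) : sbr K B 1 = 0 := by
  rw [sbr_eq]; simp [oddP_of_isHom_zero isHom_one]

/-- The super Jacobi identity. -/
lemma sbr_jacobi {pA pB pC : ZMod 2} {A B C : gl K m 1} (hA : IsHom K pA A) (hB : IsHom K pB B)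
    (hC : IsHom K pC C) :
    sbr K A (sbr K B C) = sbr K (sbr K A B) C - sg K (pB * pC) • sbr K (sbr K A C) B := by
  rw [sbr_of_isHom hA (hB.sbr hC), sbr_of_isHom (hA.sbr hB) hC, sbr_of_isHom (hA.sbr hC) hB,
    sbr_of_isHom hA hB, sbr_of_isHom hB hC, sbr_of_isHom hA hC]
  rcases zmod_two_cases pA with rfl | rfl <;> rcases zmod_two_cases pB with rfl | rfl <;>
    rcases zmod_two_cases pC with rfl | rfl <;>
    simp [show (1 : ZMod 2) + 1 = 0 from rfl] <;> noncomm_ring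

/-- The parity of the matrix unit at `(a, b)`. -/
def pu (a b : Fin (m + 1)) : ZMod 2 := par m 1 a + par m 1 b

/-- The matrix unit at `(a, b)`. -/
def mu (a b : Fin (m + 1)) : gl K m 1 := Matrix.single a b 1

lemma isHom_mu (a b : Fin (m + 1)) : IsHom K (pu a b) (mu a b : gl K m 1) := by
  intro i j h
  simp only [mu, Matrix.single_apply] at h
  have : a = i ∧ b = j := by by_contra hh; simp [hh] at h
  rw [← this.1, ← this.2, pu]

lemma mu_mul_mu (a b c d : Fin (m + 1)) :
    (mu a b : gl K m 1) * mu c d = if b = c then mu a d else 0 := by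
  split_ifs with h
  · subst h; simp [mu]
  · simp [mu, h]

lemma sbr_mu (a b c d : Fin (m + 1)) :
    sbr K (mu a b : gl K m 1) (mu c d) =
      (if b = c then mu a d else 0) -
        sg K (pu a b * pu c d) • (if d = a then mu c b else 0) := by
  rw [sbr_of_isHom (isHom_mu a b) (isHom_mu c d), mu_mul_mu, mu_mul_mu]

lemma eq_sum_mu (A : gl K m 1) : A = ∑ a, ∑ b, A a b • mu a b := by
  conv_lhs => rw [Matrix.matrix_eq_sum_single A]
  simp [mu, Matrix.smul_single]

lemma ext_mu {V : Type*} [AddCommGroup V] [Module K V] {f g : gl K m 1 →ₗ[K] V}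
    (h : ∀ a b, f (mu a b) = g (mu a b)) : f = g := by
  ext A : 1
  rw [eq_sum_mu A]
  simp [h]

lemma one_eq_sum_mu : (1 : gl K m 1) = ∑ a, mu a a := by
  ext i j
  rw [Matrix.sum_apply]
  simp only [mu, Matrix.single_apply, Matrix.one_apply]
  by_cases h : i = j
  · subst h; simp
  · rw [if_neg h, Finset.sum_eq_zero]
    intro x _
    rw [if_neg]
    rintro ⟨rfl, rfl⟩
    exact h rfl

@[simp] lemma par_castSucc (i : Fin m) : par m 1 i.castSucc = 0 := by simp [par]

@[simp] lemma par_last : par m 1 (Fin.last m) = 1 := by simp [par]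

end Matrices

section Cochains

variable {m : ℕ} {M : Type} [AddCommGroup M] [Module K M]

/-- Bilinear maps on `gl(m|1)` with values in `M`. -/
abbrev Bil (K : Type) [Field K] (m : ℕ) (M : Type) [AddCommGroup M] [Module K M] : Type :=
  gl K m 1 →ₗ[K] gl K m 1 →ₗ[K] M

/-- `r` is a representation of the Lie superalgebra `gl(m|1)`. -/
def IsRep (r : gl K m 1 →ₗ[K] Module.End K M) : Prop :=
  ∀ (pA pB : ZMod 2) (A B : gl K m 1), IsHom K pA A → IsHom K pB B →
    r (sbr K A B) = r A * r B - sg K (pA * pB) • (r B * r A)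

lemma IsRep.apply_comm {r : gl K m 1 →ₗ[K] Module.End K M} (hr : IsRep r) {pA pB : ZMod 2}
    {A B : gl K m 1} (hA : IsHom K pA A) (hB : IsHom K pB B) (x : M) :
    r A (r B x) = r (sbr K A B) x + sg K (pA * pB) • r B (r A x) := by
  rw [hr pA pB A B hA hB]; simp

/-- The super-skew bilinear maps satisfying the 2-cocycle identity. -/
def cocycles (r : gl K m 1 →ₗ[K] Module.End K M) : Submodule K (Bil K m M) where
  carrier := {f | (∀ (pA pB : ZMod 2) (A B : gl K m 1), IsHom K pA A → IsHom K pB B →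
      f B A = -(sg K (pA * pB) • f A B)) ∧
    ∀ (pA pB pC : ZMod 2) (A B C : gl K m 1), IsHom K pA A → IsHom K pB B → IsHom K pC C →
      r A (f B C) - sg K (pA * pB) • r B (f A C) + sg K ((pA + pB) * pC) • r C (f A B)
        - f (sbr K A B) C + sg K (pB * pC) • f (sbr K A C) B + f A (sbr K B C) = 0}
  add_mem' {f g} hf hg := by
    refine ⟨fun pA pB A B hA hB => ?_, fun pA pB pC A B C hA hB hC => ?_⟩
    · simp only [LinearMap.add_apply, hf.1 pA pB A B hA hB, hg.1 pA pB A B hA hB]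
      module
    · rw [← add_zero (0 : M)]
      nth_rw 1 [← hf.2 pA pB pC A B C hA hB hC]
      rw [← hg.2 pA pB pC A B C hA hB hC]
      simp only [LinearMap.add_apply, map_add]
      module
  zero_mem' := by
    refine ⟨fun pA pB A B hA hB => ?_, fun pA pB pC A B C hA hB hC => ?_⟩ <;> simp
  smul_mem' c f hf := by
    refine ⟨fun pA pB A B hA hB => ?_, fun pA pB pC A B C hA hB hC => ?_⟩
    · simp only [LinearMap.smul_apply, hf.1 pA pB A B hA hB]
      module
    · rw [← smul_zero c, ← hf.2 pA pB pC A B C hA hB hC]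
      simp only [LinearMap.smul_apply, map_smul]
      module

/-- The coboundary operator on linear maps. -/
def cobd (r : gl K m 1 →ₗ[K] Module.End K M) : (gl K m 1 →ₗ[K] M) →ₗ[K] Bil K m M where
  toFun φ :=
    LinearMap.mk₂ K (fun A B => r A (φ B) - r B (φ A) + (2 : K) • r (oddPL B) (φ (oddPL A))
        - φ (sbrL A B))
      (fun A B C => by simp only [map_add, LinearMap.add_apply]; module)
      (fun c A B => by simp only [map_smul, LinearMap.smul_apply]; module)
      (fun A B C => by simp only [map_add, LinearMap.add_apply]; module)
      (fun c A B => by simp only [map_smul, LinearMap.smul_apply]; module)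
  map_add' φ ψ := by
    ext A B : 2
    simp only [LinearMap.mk₂_apply, LinearMap.add_apply, map_add]; module
  map_smul' c φ := by
    ext A B : 2
    simp only [LinearMap.mk₂_apply, LinearMap.smul_apply, map_smul, RingHom.id_apply]; module

lemma cobd_apply_of_isHom (r : gl K m 1 →ₗ[K] Module.End K M) (φ : gl K m 1 →ₗ[K] M)
    {pA pB : ZMod 2} {A B : gl K m 1} (hA : IsHom K pA A) (hB : IsHom K pB B) :
    cobd r φ A B = r A (φ B) - sg K (pA * pB) • r B (φ A) - φ (sbr K A B) := by
  simp only [cobd, LinearMap.coe_mk, AddHom.coe_mk, LinearMap.mk₂_apply, oddPL_apply,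
    oddP_of_isHom hA, oddP_of_isHom hB, sbrL_apply]
  rcases zmod_two_cases pA with rfl | rfl <;> rcases zmod_two_cases pB with rfl | rfl <;>
    simp
  module

lemma sbr_skew {pA pB : ZMod 2} {A B : gl K m 1} (hA : IsHom K pA A) (hB : IsHom K pB B) :
    sbr K B A = -(sg K (pA * pB) • sbr K A B) := by
  rw [sbr_of_isHom hA hB, sbr_of_isHom hB hA, mul_comm pB pA, smul_sub, smul_smul, sg_mul_self]
  module

lemma cobd_mem_cocycles {r : gl K m 1 →ₗ[K] Module.End K M} (hr : IsRep r)
    (φ : gl K m 1 →ₗ[K] M) : cobd r φ ∈ cocycles r := by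
  refine ⟨fun pA pB A B hA hB => ?_, fun pA pB pC A B C hA hB hC => ?_⟩
  · rw [cobd_apply_of_isHom r φ hA hB, cobd_apply_of_isHom r φ hB hA, sbr_skew hA hB,
      mul_comm pB pA]
    rcases zmod_two_cases (pA * pB) with h | h <;> simp [h] <;> abel
  · rw [cobd_apply_of_isHom r φ hA hB, cobd_apply_of_isHom r φ hB hC,
      cobd_apply_of_isHom r φ hA hC, cobd_apply_of_isHom r φ (hA.sbr hB) hC,
      cobd_apply_of_isHom r φ (hA.sbr hC) hB, cobd_apply_of_isHom r φ hA (hB.sbr hC),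
      sbr_jacobi hA hB hC, hr _ _ A B hA hB, hr _ _ A C hA hC, hr _ _ B C hB hC]
    simp only [map_sub, map_smul, LinearMap.sub_apply, LinearMap.smul_apply, Module.End.mul_apply]
    rcases zmod_two_cases pA with rfl | rfl <;> rcases zmod_two_cases pB with rfl | rfl <;>
      rcases zmod_two_cases pC with rfl | rfl <;>
      simp [show (1 : ZMod 2) + 1 = 0 from rfl] <;> abel

lemma bil_ext {f g : Bil K m M} (h : ∀ a b c d, f (mu a b) (mu c d) = g (mu a b) (mu c d)) :
    f = g :=
  ext_mu fun a b => ext_mu fun c d => h a b c d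

/-- The action of an even element on bilinear maps. -/
def lieAct (r : gl K m 1 →ₗ[K] Module.End K M) (h : gl K m 1) : Bil K m M →ₗ[K] Bil K m M where
  toFun f :=
    LinearMap.mk₂ K (fun A B => r h (f A B) - f (sbrL h A) B - f A (sbrL h B))
      (fun A B C => by simp only [map_add, LinearMap.add_apply]; module)
      (fun c A B => by simp only [map_smul, LinearMap.smul_apply]; module)
      (fun A B C => by simp only [map_add]; module)
      (fun c A B => by simp only [map_smul]; module)
  map_add' φ ψ := by
    ext A B : 2
    simp only [LinearMap.mk₂_apply, LinearMap.add_apply, map_add]; module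
  map_smul' c φ := by
    ext A B : 2
    simp only [LinearMap.mk₂_apply, LinearMap.smul_apply, map_smul, RingHom.id_apply]; module

lemma lieAct_apply (r : gl K m 1 →ₗ[K] Module.End K M) (h : gl K m 1) (f : Bil K m M)
    (A B : gl K m 1) :
    lieAct r h f A B = r h (f A B) - f (sbr K h A) B - f A (sbr K h B) := rfl

lemma lieAct_eq_cobd (r : gl K m 1 →ₗ[K] Module.End K M) {h : gl K m 1} (hh : IsHom K 0 h)
    {f : Bil K m M} (hf : f ∈ cocycles r) : lieAct r h f = cobd r (f h) := by
  refine bil_ext fun a b c d => ?_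
  have hB := isHom_mu (K := K) a b
  have hC := isHom_mu (K := K) c d
  rw [lieAct_apply, cobd_apply_of_isHom r _ hB hC]
  have h1 := hf.2 0 _ _ h _ _ hh hB hC
  have h2 := hf.1 _ _ _ _ hB (hh.sbr hC)
  rw [h2] at h1
  simp only [zero_mul, zero_add, sg_zero, one_smul] at h1
  rw [← sub_eq_zero, ← h1, smul_neg, smul_smul, sg_mul_self]
  module

/-- The sign of an index. -/
abbrev si (K : Type) [Field K] {m : ℕ} (a : Fin (m + 1)) : K := sg K (par m 1 a)

lemma casimir_invariant {V : Type*} [AddCommGroup V] [Module K V]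
    (β : gl K m 1 →ₗ[K] gl K m 1 →ₗ[K] V) (c d : Fin (m + 1)) :
    ∑ a, ∑ b, si K b • (β (sbr K (mu c d) (mu a b)) (mu b a) +
      sg K (pu c d * pu a b) • β (mu a b) (sbr K (mu c d) (mu b a))) = 0 := by
  have e1 : ∑ a, ∑ b, si K b • β (sbr K (mu c d) (mu a b)) (mu b a) =
      ∑ b, si K b • β (mu c b) (mu b d)
        - ∑ a, (si K c * sg K (pu c d * pu a c)) • β (mu a d) (mu c a) := by
    simp only [sbr_mu, map_sub, LinearMap.sub_apply, smul_sub, Finset.sum_sub_distrib, map_smul,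
      LinearMap.smul_apply, apply_ite β, map_zero]
    congr 1
    · rw [Finset.sum_eq_single d]
      · simp
      · intro x _ hx; simp [Ne.symm hx]
      · simp
    · refine Finset.sum_congr rfl fun a _ => ?_
      rw [Finset.sum_eq_single c]
      · simp [mul_smul]
      · intro x _ hx; simp [hx]
      · simp
  have e2 : ∑ a, ∑ b, si K b • (sg K (pu c d * pu a b) •
        β (mu a b) (sbr K (mu c d) (mu b a))) =
      ∑ a, (si K d * sg K (pu c d * pu a d)) • β (mu a d) (mu c a) -
      ∑ b, si K b • β (mu c b) (mu b d) := by
    simp only [sbr_mu, map_sub, smul_sub, Finset.sum_sub_distrib, map_smul]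
    congr 1
    · refine Finset.sum_congr rfl fun a _ => ?_
      rw [Finset.sum_eq_single d]
      · simp [mul_smul]
      · intro x _ hx; simp [Ne.symm hx]
      · simp
    · rw [Finset.sum_eq_single c]
      · refine Finset.sum_congr rfl fun b _ => ?_
        rw [show pu b c = pu c b from add_comm _ _]
        rw [smul_smul (sg K (pu c d * pu c b)), sg_mul_self]; simp
      · intro x _ hx; simp [hx]
      · simp
  simp only [smul_add, Finset.sum_add_distrib]
  rw [e1, e2]
  have : ∀ a : Fin (m + 1), si K c * sg K (pu c d * pu a c) = si K d * sg K (pu c d * pu a d) := by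
    intro a
    simp only [si, pu, ← sg_add]
    congr 1
    generalize par m 1 a = x
    generalize par m 1 c = y
    generalize par m 1 d = z
    revert x y z; decide
  simp only [this]
  abel

/-- The Casimir operator. -/
def casimir (r : gl K m 1 →ₗ[K] Module.End K M) : Module.End K M :=
  ∑ a, ∑ b, si K b • (r (mu a b) * r (mu b a))

lemma casimir_commute {r : gl K m 1 →ₗ[K] Module.End K M} (hr : IsRep r) (A : gl K m 1) :
    Commute (casimir r) (r A) := by
  suffices h : ∀ c d, r (mu c d) * casimir r = casimir r * r (mu c d) by
    have : (LinearMap.mulLeft K (casimir r)).comp r = (LinearMap.mulRight K (casimir r)).comp r :=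
      ext_mu fun c d => (h c d).symm
    exact LinearMap.congr_fun this A
  intro c d
  have key := casimir_invariant ((LinearMap.mul K (Module.End K M)).compl₁₂ r r) c d
  rw [← sub_eq_zero, ← key, casimir, Finset.mul_sum, Finset.sum_mul, ← Finset.sum_sub_distrib]
  refine Finset.sum_congr rfl fun a _ => ?_
  rw [Finset.mul_sum, Finset.sum_mul, ← Finset.sum_sub_distrib]
  refine Finset.sum_congr rfl fun b _ => ?_
  have hp : pu b a = pu a b := add_comm _ _
  simp only [LinearMap.compl₁₂_apply, LinearMap.mul_apply', hr _ _ _ _ (isHom_mu c d) (isHom_mu a b),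
    hr _ _ _ _ (isHom_mu c d) (isHom_mu b a), hp, smul_mul_assoc, mul_smul_comm, ← smul_sub]
  congr 1
  rw [mul_sub, mul_smul_comm, smul_sub, smul_smul, sg_mul_self, sub_mul, smul_mul_assoc]
  simp only [mul_assoc]
  module

/-- The contraction of a bilinear map with the Casimir tensor. -/
def casimirContract (r : gl K m 1 →ₗ[K] Module.End K M) (f : Bil K m M) : gl K m 1 →ₗ[K] M :=
  ∑ a, ∑ b, si K b • (r (mu a b)).comp (f (mu b a))

lemma casimir_apply (r : gl K m 1 →ₗ[K] Module.End K M) (x : M) :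
    casimir r x = ∑ a, ∑ b, si K b • r (mu a b) (r (mu b a) x) := by
  simp [casimir, LinearMap.sum_apply]

lemma casimirContract_apply (r : gl K m 1 →ₗ[K] Module.End K M) (f : Bil K m M) (A : gl K m 1) :
    casimirContract r f A = ∑ a, ∑ b, si K b • r (mu a b) (f (mu b a) A) := by
  simp [casimirContract, LinearMap.sum_apply]

/-- Postcomposition of a bilinear map with an endomorphism. -/
def postAct (T : Module.End K M) : Bil K m M →ₗ[K] Bil K m M where
  toFun f := f.compr₂ T
  map_add' f g := by ext A B : 2; simp
  map_smul' c f := by ext A B : 2; simp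

@[simp] lemma postAct_apply (T : Module.End K M) (f : Bil K m M) (A B : gl K m 1) :
    postAct T f A B = T (f A B) := rfl

lemma casimir_eq_cobd {r : gl K m 1 →ₗ[K] Module.End K M} (hr : IsRep r) {f : Bil K m M}
    (hf : f ∈ cocycles r) : postAct (casimir r) f = cobd r (casimirContract r f) := by
  refine bil_ext fun c d c' d' => ?_
  have hA := isHom_mu (K := K) c d
  have hB := isHom_mu (K := K) c' d'
  set A : gl K m 1 := mu c d
  set B : gl K m 1 := mu c' d'
  have k1 := casimir_invariant ((LinearMap.lcomp K M (f.flip B)).comp r) c d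
  have k2 := casimir_invariant ((LinearMap.lcomp K M (f.flip A)).comp r) c' d'
  rw [postAct_apply, cobd_apply_of_isHom r _ hA hB, casimir_apply]
  simp only [casimirContract_apply]
  rw [← sub_eq_zero, ← neg_eq_zero.2 k1, ← add_zero (-_),
    ← smul_zero (sg K (pu c d * pu c' d')), ← k2]
  simp only [map_sum, Finset.smul_sum, ← Finset.sum_sub_distrib, ← Finset.sum_neg_distrib,
    ← Finset.sum_add_distrib]
  refine Finset.sum_congr rfl fun a _ => Finset.sum_congr rfl fun b _ => ?_
  have hX := isHom_mu (K := K) a b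
  have hY : IsHom K (pu a b) (mu b a : gl K m 1) := by
    have := isHom_mu (K := K) b a
    rwa [show pu b a = pu a b from add_comm _ _] at this
  set X : gl K m 1 := mu a b
  set Y : gl K m 1 := mu b a
  have h := congrArg (r X) (hf.2 _ _ _ _ _ _ hY hA hB)
  simp only [LinearMap.comp_apply, LinearMap.lcomp_apply, LinearMap.flip_apply, map_smul]
  rw [hr.apply_comm hA hX, hr.apply_comm hB hX]
  rw [sbr_skew hA hY, sbr_skew hB hY] at h
  revert h
  generalize pu a b = p
  generalize pu c d = q
  generalize pu c' d' = t
  intro h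
  simp only [map_add, map_sub, map_smul, map_neg, LinearMap.neg_apply, LinearMap.smul_apply,
    map_zero] at h
  rcases zmod_two_cases p with rfl | rfl <;> rcases zmod_two_cases q with rfl | rfl <;>
    rcases zmod_two_cases t with rfl | rfl <;>
    simp [show (1 : ZMod 2) + 1 = 0 from rfl] at h ⊢ <;> linear_combination (norm := module) (si K b) • h

end Cochains

section Fitting

lemma exists_fitting {V : Type*} [AddCommGroup V] [Module K V] [FiniteDimensional K V]
    (θ : Module.End K V) (Z : Submodule K V) (hZ : ∀ z ∈ Z, θ z ∈ Z) :
    ∀ᶠ n in Filter.atTop, ∀ z ∈ Z, ∃ z₀ ∈ Z, ∃ z₁ ∈ Z, z = z₀ + (θ ^ n) z₁ ∧ (θ ^ n) z₀ = 0 := by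
  have hev := LinearMap.eventually_isCompl_ker_pow_range_pow (θ.restrict hZ)
  filter_upwards [hev] with n hn z hz
  have htop : (⟨z, hz⟩ : Z) ∈ LinearMap.ker (θ.restrict hZ ^ n) ⊔
      LinearMap.range (θ.restrict hZ ^ n) := by
    rw [hn.sup_eq_top]; trivial
  obtain ⟨z₀, h₀, y, ⟨z₁, rfl⟩, hsum⟩ := Submodule.mem_sup.1 htop
  rw [Module.End.pow_restrict n] at hsum
  rw [Module.End.pow_restrict n, LinearMap.mem_ker] at h₀
  exact ⟨z₀, z₀.2, z₁, z₁.2, (congrArg Subtype.val hsum).symm, congrArg Subtype.val h₀⟩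

lemma exists_fitting_range {V : Type*} [AddCommGroup V] [Module K V] [FiniteDimensional K V]
    (θ : Module.End K V) (Z : Submodule K V) (hZ : ∀ z ∈ Z, θ z ∈ Z) {z : V} (hz : z ∈ Z) :
    ∃ z₀ ∈ Z, ∃ z₁ ∈ Z, z = z₀ + θ z₁ ∧ ∃ n, (θ ^ n) z₀ = 0 := by
  obtain ⟨n, h1, hn⟩ := ((exists_fitting θ Z hZ).and (Filter.eventually_ge_atTop 1)).exists
  obtain ⟨z₀, h₀, z₁, hz₁, h, h'⟩ := h1 z hz
  have hst : ∀ k, (θ ^ k) z₁ ∈ Z := by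
    intro k
    induction k with
    | zero => simpa using hz₁
    | succ k ih => rw [pow_succ', Module.End.mul_apply]; exact hZ _ ih
  refine ⟨z₀, h₀, (θ ^ (n - 1)) z₁, hst _, ?_, n, h'⟩
  rw [h, ← Module.End.mul_apply, ← pow_succ', Nat.sub_add_cancel hn]

/-- Preimages can be chosen in the Fitting null component. -/
lemma exists_preimage_nilpotent {V : Type*} [AddCommGroup V] [Module K V] [FiniteDimensional K V]
    {X T T' : Module.End K V} (hX : X * T' = T * X) (Y : Submodule K V) (hY : ∀ z ∈ Y, T' z ∈ Y)
    {u v : V} (hv : v ∈ Y) (huv : X v = u) {k : ℕ} (hu : (T ^ k) u = 0) :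
    ∃ v₀ ∈ Y, X v₀ = u ∧ ∃ n, (T' ^ n) v₀ = 0 := by
  obtain ⟨n, ⟨h1, hd⟩, hn⟩ := (((exists_fitting T' Y hY).and
    (Module.End.eventually_disjoint_ker_pow_range_pow T)).and
      (Filter.eventually_ge_atTop k)).exists
  obtain ⟨v₀, h₀, v₁, -, h, h'⟩ := h1 v hv
  have hXn : ∀ w, X ((T' ^ n) w) = (T ^ n) (X w) := by
    intro w
    have : SemiconjBy X (T' ^ n) (T ^ n) := SemiconjBy.pow_right hX n
    exact LinearMap.congr_fun this.eq w
  refine ⟨v₀, h₀, ?_, n, h'⟩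
  have hr : (T ^ n) (X v₁) ∈ LinearMap.range (T ^ n) := ⟨_, rfl⟩
  have heq : (T ^ n) (X v₁) = u - X v₀ := by rw [← hXn, ← huv, h, map_add]; abel
  have hk : (T ^ n) (X v₁) ∈ LinearMap.ker (T ^ n) := by
    rw [heq, LinearMap.mem_ker, map_sub, ← hXn, h', map_zero, sub_zero]
    rw [← Nat.sub_add_cancel hn, pow_add, Module.End.mul_apply, hu, map_zero]
  have := (Submodule.disjoint_def.1 hd) _ hk hr
  rw [heq, sub_eq_zero] at this
  exact this.symm

end Fitting

section Reduction

variable {m : ℕ} {M : Type} [AddCommGroup M] [Module K M]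

/-- The coefficient of `mu g g` in the weight of `mu a b`. -/
def wt (a b g : Fin (m + 1)) : ℤ := (if g = a then 1 else 0) - (if g = b then 1 else 0)

lemma sbr_mu_diag (g a b : Fin (m + 1)) :
    sbr K (mu g g : gl K m 1) (mu a b) = (wt a b g : K) • mu a b := by
  have : pu g g = 0 := (add_eq_zero_zmod_two _ _).2 rfl
  rw [sbr_mu, this, zero_mul, sg_zero, one_smul, wt]
  by_cases h1 : g = a
  · subst h1
    by_cases h2 : g = b
    · subst h2; simp
    · simp [h2, Ne.symm h2]
  · by_cases h2 : g = b
    · subst h2; simp [h1]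
    · simp [h1, h2, Ne.symm h2]

lemma isHom_mu_diag (g : Fin (m + 1)) : IsHom K 0 (mu g g : gl K m 1) := by
  have h := isHom_mu (K := K) g g
  rwa [show pu g g = 0 from (add_eq_zero_zmod_two _ _).2 rfl] at h

/-- The Fitting null component of the Casimir operator. -/
def casNil (r : gl K m 1 →ₗ[K] Module.End K M) : Submodule K M :=
  (casimir r).maxGenEigenspace 0

lemma mem_casNil {r : gl K m 1 →ₗ[K] Module.End K M} {x : M} :
    x ∈ casNil r ↔ ∃ n, (casimir r ^ n) x = 0 := by
  simp [casNil, Module.End.mem_maxGenEigenspace]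

lemma apply_mem_casNil {r : gl K m 1 →ₗ[K] Module.End K M} (hr : IsRep r) (A : gl K m 1) {x : M}
    (hx : x ∈ casNil r) : r A x ∈ casNil r := by
  rw [mem_casNil] at *
  obtain ⟨n, hn⟩ := hx
  refine ⟨n, ?_⟩
  have := LinearMap.congr_fun (((casimir_commute hr A).pow_left n).eq) x
  simp only [Module.End.mul_apply] at this
  rw [this, hn, map_zero]

/-- The diagonal matrix units act semisimply, at integral eigenvalues. -/
def DiagSemisimple (r : gl K m 1 →ₗ[K] Module.End K M) : Prop :=
  ∀ (a : Fin (m + 1)) (c : ℤ) (x : M),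
    (r (mu a a) - (c : K) • 1) ((r (mu a a) - (c : K) • 1) x) = 0 → r (mu a a) x = (c : K) • x

lemma DiagSemisimple.of_pow {r : gl K m 1 →ₗ[K] Module.End K M} (h : DiagSemisimple r)
    {a : Fin (m + 1)} {c : ℤ} {n : ℕ} {x : M}
    (hx : ((r (mu a a) - (c : K) • 1) ^ n) x = 0) : r (mu a a) x = (c : K) • x := by
  induction n with
  | zero => simp only [pow_zero, Module.End.one_apply] at hx; simp [hx]
  | succ n ih =>
    rcases n with _ | n
    · simpa [sub_eq_zero] using hx
    · apply ih
      have := h a c (((r (mu a a) - (c : K) • 1) ^ n) x) (by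
        rw [← Module.End.mul_apply, ← Module.End.mul_apply, mul_assoc, ← pow_succ', ← pow_succ']
        exact hx)
      rw [pow_succ', Module.End.mul_apply]
      simp [this]

lemma lieAct_mu (r : gl K m 1 →ₗ[K] Module.End K M) (g a b c d : Fin (m + 1)) (f : Bil K m M) :
    lieAct r (mu g g) f (mu a b) (mu c d) =
      (r (mu g g) - ((wt a b g + wt c d g : ℤ) : K) • 1) (f (mu a b) (mu c d)) := by
  rw [lieAct_apply, sbr_mu_diag, sbr_mu_diag]
  simp only [map_smul, LinearMap.smul_apply, LinearMap.sub_apply, Module.End.one_apply,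
    Int.cast_add]
  module

lemma lieAct_pow_mu (r : gl K m 1 →ₗ[K] Module.End K M) (g a b c d : Fin (m + 1)) (f : Bil K m M)
    (n : ℕ) :
    (lieAct r (mu g g) ^ n) f (mu a b) (mu c d) =
      ((r (mu g g) - ((wt a b g + wt c d g : ℤ) : K) • 1) ^ n) (f (mu a b) (mu c d)) := by
  induction n with
  | zero => simp
  | succ n ih => rw [pow_succ', Module.End.mul_apply, lieAct_mu, ih, pow_succ', Module.End.mul_apply]

lemma diag_commute {r : gl K m 1 →ₗ[K] Module.End K M} (hr : IsRep r) (g h : Fin (m + 1)) :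
    Commute (r (mu g g)) (r (mu h h)) := by
  have := hr _ _ _ _ (isHom_mu_diag g) (isHom_mu_diag h)
  rw [sbr_mu_diag] at this
  have hw : wt h h g = 0 := by simp [wt]
  rw [hw] at this
  simp only [Int.cast_zero, zero_smul, map_zero, zero_mul, sg_zero, one_smul] at this
  exact (sub_eq_zero.1 this.symm)

lemma lieAct_commute {r : gl K m 1 →ₗ[K] Module.End K M} (hr : IsRep r) (g h : Fin (m + 1)) :
    Commute (lieAct r (mu g g)) (lieAct r (mu h h)) := by
  refine LinearMap.ext fun f => bil_ext fun a b c d => ?_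
  simp only [Module.End.mul_apply, lieAct_mu]
  simp only [← Module.End.mul_apply]
  congr 1
  have := (diag_commute hr g h).eq
  simp only [sub_mul, mul_sub, this, smul_mul_assoc, mul_smul_comm, one_mul, mul_one]
  module

/-- Cocycles vanishing on the identity matrix. -/
def normCocycles (r : gl K m 1 →ₗ[K] Module.End K M) : Submodule K (Bil K m M) :=
  cocycles r ⊓ LinearMap.ker (LinearMap.applyₗ (1 : gl K m 1) : Bil K m M →ₗ[K] _)

lemma mem_normCocycles {r : gl K m 1 →ₗ[K] Module.End K M} {f : Bil K m M} :
    f ∈ normCocycles r ↔ f ∈ cocycles r ∧ f 1 = 0 := by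
  simp [normCocycles]

variable [FiniteDimensional K M]

/-- Every normalized cocycle is cohomologous to one of weight zero with values in the Fitting
null component of the Casimir operator. -/
lemma exists_reduced {r : gl K m 1 →ₗ[K] Module.End K M} (hr : IsRep r) (hss : DiagSemisimple r)
    {f : Bil K m M} (hf : f ∈ normCocycles r) :
    ∃ f₀ ∈ normCocycles r, ∃ φ, f = f₀ + cobd r φ ∧ (∀ A B, f₀ A B ∈ casNil r) ∧
      ∀ g a b c d, r (mu g g) (f₀ (mu a b) (mu c d)) =
        ((wt a b g + wt c d g : ℤ) : K) • f₀ (mu a b) (mu c d) := by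
  let Z₁ : Submodule K (Bil K m M) :=
    { carrier := {f | f ∈ normCocycles r ∧ ∀ A B, f A B ∈ casNil r}
      add_mem' := fun {x y} hx hy => ⟨add_mem hx.1 hy.1, fun A B => by
        simpa using add_mem (hx.2 A B) (hy.2 A B)⟩
      zero_mem' := ⟨zero_mem _, fun A B => by simp⟩
      smul_mem' := fun c x hx => ⟨Submodule.smul_mem _ c hx.1, fun A B => by
        simpa using Submodule.smul_mem _ c (hx.2 A B)⟩ }
  have step₁ : ∃ f₀ ∈ Z₁, ∃ φ, f = f₀ + cobd r φ := by
    have hZ : ∀ z ∈ normCocycles r, postAct (casimir r) z ∈ normCocycles r := by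
      intro z hz
      rw [mem_normCocycles] at *
      refine ⟨?_, ?_⟩
      · rw [casimir_eq_cobd hr hz.1]; exact cobd_mem_cocycles hr _
      · ext B; simp [hz.2]
    obtain ⟨z₀, h₀, z₁, h₁, h, n, hn⟩ := exists_fitting_range _ _ hZ hf
    refine ⟨z₀, ⟨h₀, fun A B => mem_casNil.2 ⟨n, ?_⟩⟩, casimirContract r z₁, ?_⟩
    · have hpow : ∀ k, (postAct (casimir r) ^ k) z₀ A B = (casimir r ^ k) (z₀ A B) := by
        intro k
        induction k with
        | zero => simp
        | succ k ih => simp [pow_succ', Module.End.mul_apply, ih]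
      rw [← hpow, hn]; simp
    · rw [h, casimir_eq_cobd hr (mem_normCocycles.1 h₁).1]
  suffices step₂ : ∀ s : Finset (Fin (m + 1)), ∃ f₀ ∈ Z₁, (∀ g ∈ s, lieAct r (mu g g) f₀ = 0) ∧
      ∃ φ, f = f₀ + cobd r φ by
    obtain ⟨f₀, h₀, hs, φ, h⟩ := step₂ Finset.univ
    refine ⟨f₀, h₀.1, φ, h, h₀.2, fun g a b c d => ?_⟩
    have := lieAct_mu r g a b c d f₀
    rw [hs g (Finset.mem_univ _)] at this
    rw [LinearMap.sub_apply, LinearMap.zero_apply, LinearMap.zero_apply] at this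
    exact sub_eq_zero.1 this.symm
  intro s
  induction s using Finset.induction_on with
  | empty =>
    obtain ⟨f₀, h₀, hφ⟩ := step₁
    exact ⟨f₀, h₀, by simp, hφ⟩
  | insert g s hgs ih =>
    obtain ⟨f₀, h₀, hs, φ, h⟩ := ih
    let Z : Submodule K (Bil K m M) := Z₁ ⊓ ⨅ g ∈ s, LinearMap.ker (lieAct r (mu g g))
    have hmem : ∀ z, z ∈ Z ↔ z ∈ Z₁ ∧ ∀ g ∈ s, lieAct r (mu g g) z = 0 := by
      intro z; simp [Z]
    have hZ : ∀ z ∈ Z, lieAct r (mu g g) z ∈ Z := by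
      intro z hz
      rw [hmem] at *
      refine ⟨⟨mem_normCocycles.2 ⟨?_, ?_⟩, fun A B => ?_⟩, fun g' hg' => ?_⟩
      · rw [lieAct_eq_cobd r (isHom_mu_diag g) (mem_normCocycles.1 hz.1.1).1]
        exact cobd_mem_cocycles hr _
      · ext B
        simp [lieAct_apply, sbr_one_right, (mem_normCocycles.1 hz.1.1).2]
      · rw [lieAct_apply]
        exact sub_mem (sub_mem (apply_mem_casNil hr _ (hz.1.2 _ _)) (hz.1.2 _ _)) (hz.1.2 _ _)
      · rw [← Module.End.mul_apply, (lieAct_commute hr g' g).eq, Module.End.mul_apply,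
          hz.2 g' hg', map_zero]
    obtain ⟨z₀, hz₀, z₁, hz₁, hz, n, hn⟩ := exists_fitting_range _ _ hZ ((hmem _).2 ⟨h₀, hs⟩)
    rw [hmem] at hz₀ hz₁
    refine ⟨z₀, hz₀.1, fun g' hg' => ?_, z₁ (mu g g) + φ, ?_⟩
    · rcases Finset.mem_insert.1 hg' with rfl | hg'
      · refine bil_ext fun a b c d => ?_
        have := lieAct_pow_mu r g' a b c d z₀ n
        rw [hn] at this
        rw [lieAct_mu, LinearMap.sub_apply, hss.of_pow this.symm]
        simp
      · exact hz₀.2 g' hg'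
    · rw [h, hz, lieAct_eq_cobd r (isHom_mu_diag g) (mem_normCocycles.1 hz₁.1.1).1, map_add,
        add_assoc]

/-- Weight vectors killed by an odd matrix unit are in its image, within weight spaces of the
Fitting null component of the Casimir operator. -/
lemma exists_weight_preimage {r : gl K m 1 →ₗ[K] Module.End K M} (hr : IsRep r)
    (hss : DiagSemisimple r) {p q : Fin (m + 1)} {w : Fin (m + 1) → ℤ} {u v : M}
    (hu : u ∈ casNil r) (huw : ∀ g, r (mu g g) u = (w g : K) • u) (huv : r (mu p q) v = u) :
    ∃ v₀ ∈ casNil r, (∀ g, r (mu g g) v₀ = ((w g - wt p q g : ℤ) : K) • v₀) ∧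
      r (mu p q) v₀ = u := by
  have step₁ : ∃ v₀ ∈ casNil r, r (mu p q) v₀ = u := by
    obtain ⟨n, hn⟩ := mem_casNil.1 hu
    obtain ⟨v₀, -, h, n, hn⟩ := exists_preimage_nilpotent (casimir_commute hr (mu p q)).symm.eq ⊤
      (fun _ _ => trivial) trivial huv hn
    exact ⟨v₀, mem_casNil.2 ⟨n, hn⟩, h⟩
  suffices step₂ : ∀ s : Finset (Fin (m + 1)), ∃ v₀ ∈ casNil r,
      (∀ g ∈ s, r (mu g g) v₀ = ((w g - wt p q g : ℤ) : K) • v₀) ∧ r (mu p q) v₀ = u by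
    obtain ⟨v₀, h₀, hs, h⟩ := step₂ Finset.univ
    exact ⟨v₀, h₀, fun g => hs g (Finset.mem_univ _), h⟩
  intro s
  induction s using Finset.induction_on with
  | empty =>
    obtain ⟨v₀, h₀, h⟩ := step₁
    exact ⟨v₀, h₀, by simp, h⟩
  | insert g s hgs ih =>
    obtain ⟨v₀, h₀, hs, h⟩ := ih
    let T' : Module.End K M := r (mu g g) - ((w g - wt p q g : ℤ) : K) • 1
    let Y : Submodule K M := casNil r ⊓
      ⨅ g ∈ s, LinearMap.ker (r (mu g g) - ((w g - wt p q g : ℤ) : K) • 1)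
    have hmem : ∀ z, z ∈ Y ↔ z ∈ casNil r ∧
        ∀ g ∈ s, r (mu g g) z = ((w g - wt p q g : ℤ) : K) • z := by
      intro z; simp [Y, sub_eq_zero]
    have hY : ∀ z ∈ Y, T' z ∈ Y := by
      intro z hz
      rw [hmem] at *
      refine ⟨?_, fun g' hg' => ?_⟩
      · exact sub_mem (apply_mem_casNil hr _ hz.1) (Submodule.smul_mem _ _ hz.1)
      · have := LinearMap.congr_fun (diag_commute hr g' g).eq z
        simp only [Module.End.mul_apply] at this
        simp only [T', LinearMap.sub_apply, map_sub, this, hz.2 g' hg', LinearMap.smul_apply,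
          Module.End.one_apply, map_smul]
        module
    have hX : r (mu p q) * T' = (r (mu g g) - (w g : K) • 1) * r (mu p q) := by
      have := hr _ _ _ _ (isHom_mu_diag g) (isHom_mu p q)
      rw [sbr_mu_diag, map_smul] at this
      simp only [zero_mul, sg_zero, one_smul] at this
      rw [eq_sub_iff_add_eq] at this
      rw [sub_mul, ← this]
      simp only [T', mul_sub, mul_smul_comm, mul_one, smul_mul_assoc, one_mul, Int.cast_sub]
      module
    obtain ⟨v₁, hv₁, h₁, n, hn⟩ := exists_preimage_nilpotent hX Y hY ((hmem _).2 ⟨h₀, hs⟩) h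
      (k := 1) (by simp [huw])
    rw [hmem] at hv₁
    refine ⟨v₁, hv₁.1, fun g' hg' => ?_, h₁⟩
    rcases Finset.mem_insert.1 hg' with rfl | hg'
    · exact hss.of_pow hn
    · exact hv₁.2 g' hg'

end Reduction

section WeightBound

/-- The operators of a representation of `gl(m|1)` in which the identity matrix acts by zero:
`e` is the action of `gl(m)`, `x` and `y` the two odd parts, `z` the last diagonal matrix unit, and
`Ω` the Casimir operator. -/
structure GlOps (K : Type) [Field K] (m : ℕ) (M : Type) [AddCommGroup M] [Module K M] where
  e : Fin m → Fin m → Module.End K M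
  x : Fin m → Module.End K M
  y : Fin m → Module.End K M
  z : Module.End K M
  Ω : Module.End K M
  ee : ∀ i j k l v, e i j (e k l v) =
    e k l (e i j v) + (if j = k then e i l v else 0) - (if l = i then e k j v else 0)
  ex : ∀ i j k v, e i j (x k v) = x k (e i j v) + if j = k then x i v else 0
  ey : ∀ i j k v, e i j (y k v) = y k (e i j v) - if i = k then y j v else 0
  ze : ∀ i j v, z (e i j v) = e i j (z v)
  zx : ∀ k v, z (x k v) = x k (z v) - x k v
  zy : ∀ k v, z (y k v) = y k (z v) + y k v
  xx : ∀ i j v, x i (x j v) = -x j (x i v)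
  yy : ∀ i j v, y i (y j v) = -y j (y i v)
  xy : ∀ i j v, x i (y j v) = -y j (x i v) + e i j v + if i = j then z v else 0
  tr : ∀ v, ∑ i, e i i v + z v = 0
  Ω_eq : ∀ v, Ω v = ∑ i, ∑ j, e i j (e j i v) - z (z v) + ∑ k, (y k (x k v) - x k (y k v))
  Ω_e : ∀ i j, Commute Ω (e i j)
  Ω_x : ∀ i, Commute Ω (x i)
  Ω_y : ∀ i, Commute Ω (y i)

variable {m : ℕ} {M : Type} [AddCommGroup M] [Module K M]

namespace GlOps

/-- The contragredient family of operators. -/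
def dual (R : GlOps K m M) : GlOps K m M where
  e i j := -R.e j i
  x := R.y
  y i := -R.x i
  z := -R.z
  Ω := R.Ω
  ee i j k l v := by
    have h := R.ee j i l k v
    simp only [LinearMap.neg_apply, map_neg, neg_neg, h]
    simp only [eq_comm (a := i), eq_comm (a := k)]
    split_ifs <;> abel
  ex i j k v := by
    have h := R.ey j i k v
    simp only [LinearMap.neg_apply, map_neg, h]
    split_ifs <;> abel
  ey i j k v := by
    have h := R.ex j i k v
    simp only [LinearMap.neg_apply, map_neg, h]
    split_ifs <;> abel
  ze i j v := by simp [R.ze]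
  zx k v := by
    simp only [LinearMap.neg_apply, map_neg, R.zy]; abel
  zy k v := by
    simp only [LinearMap.neg_apply, map_neg, R.zx]; abel
  xx := R.yy
  yy i j v := by simp only [LinearMap.neg_apply, map_neg, R.xx i j]
  xy i j v := by
    have h := R.xy j i v
    simp only [LinearMap.neg_apply, map_neg, h, eq_comm (a := i)]
    split_ifs <;> abel
  tr v := by
    simp only [LinearMap.neg_apply, Finset.sum_neg_distrib]
    rw [← neg_add, R.tr, neg_zero]
  Ω_eq v := by
    rw [R.Ω_eq, Finset.sum_comm]
    simp only [LinearMap.neg_apply, map_neg, neg_neg]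
    congr 1
    exact Finset.sum_congr rfl fun k _ => by abel
  Ω_e i j := (R.Ω_e j i).neg_right
  Ω_x := R.Ω_y
  Ω_y i := (R.Ω_x i).neg_right

/-- `v` is a weight vector of weight `l` with `z`-eigenvalue `-d`. -/
def IsWt (R : GlOps K m M) (l : Fin m → ℤ) (d : ℤ) (v : M) : Prop :=
  (∀ i, R.e i i v = (l i : K) • v) ∧ R.z v = -(d : K) • v

variable {R : GlOps K m M}

lemma IsWt.e {l : Fin m → ℤ} {d : ℤ} {v : M} (h : R.IsWt l d v) (i j : Fin m) :
    R.IsWt (fun k => l k + (if k = i then 1 else 0) - (if k = j then 1 else 0)) d (R.e i j v) := by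
  refine ⟨fun k => ?_, ?_⟩
  · rw [R.ee, h.1, map_smul]
    push_cast
    by_cases h1 : k = i <;> by_cases h2 : j = k
    · subst h1; subst h2; simp
    · subst h1; simp [h2, Ne.symm h2]; module
    · subst h2; simp [h1]; module
    · simp [h1, h2, Ne.symm h2]
  · rw [R.ze, h.2, map_smul]

lemma IsWt.y {l : Fin m → ℤ} {d : ℤ} {v : M} (h : R.IsWt l d v) (j : Fin m) :
    R.IsWt (fun k => l k - (if k = j then 1 else 0)) (d - 1) (R.y j v) := by
  refine ⟨fun k => ?_, ?_⟩
  · rw [R.ey, h.1, map_smul]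
    push_cast
    split_ifs with h1
    · subst h1; module
    · module
  · rw [R.zy, h.2, map_smul]; push_cast; module

lemma nilpotent_of_commute {Ω T : Module.End K M} (h : Commute Ω T) {v : M}
    (hv : ∃ n, (Ω ^ n) v = 0) : ∃ n, (Ω ^ n) (T v) = 0 := by
  obtain ⟨n, hn⟩ := hv
  refine ⟨n, ?_⟩
  have := LinearMap.congr_fun (h.pow_left n).eq v
  simp only [Module.End.mul_apply] at this
  rw [this, hn, map_zero]

variable [CharZero K]

lemma IsWt.sum_eq {l : Fin m → ℤ} {d : ℤ} {v : M} (h : R.IsWt l d v) (hv : v ≠ 0) :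
    ∑ i, l i = d := by
  have := R.tr v
  rw [h.2] at this
  simp only [h.1] at this
  rw [← Finset.sum_smul, ← add_smul, smul_eq_zero, or_iff_left hv] at this
  have h2 : ((∑ i, l i - d : ℤ) : K) = 0 := by push_cast; rw [← this]; ring
  exact sub_eq_zero.1 (by exact_mod_cast h2)

lemma y_y (R : GlOps K m M) (i : Fin m) (v : M) : R.y i (R.y i v) = 0 := by
  have h := R.yy i i v
  rw [eq_neg_iff_add_eq_zero, ← two_smul K, smul_eq_zero] at h
  simpa using h

/-- The Casimir eigenvalue of a singular weight vector killed by all `y`. -/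
lemma IsWt.casimir {l : Fin m → ℤ} {d : ℤ} {v : M} (h : R.IsWt l d v) (hv : v ≠ 0)
    {ρ : Fin m → ℤ} (hρ : Function.Injective ρ) (hs : ∀ i j, ρ i < ρ j → R.e i j v = 0)
    (hy : ∀ k, R.y k v = 0) :
    R.Ω v = ((∑ i, l i ^ 2 + ∑ i, ∑ j, (if ρ i < ρ j then l i - l j else 0) - d ^ 2
      + (1 - m) * d : ℤ) : K) • v := by
  have e1 : ∀ i j, R.e i j (R.e j i v) =
      (((if i = j then l i ^ 2 else 0) + (if ρ i < ρ j then l i - l j else 0) : ℤ) : K) • v := by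
    intro i j
    by_cases hij : i = j
    · subst hij
      simp only [if_true, lt_irrefl, if_false, add_zero, h.1, map_smul]
      push_cast; rw [smul_smul, sq]
    · rw [if_neg hij]
      rcases lt_or_gt_of_ne (hρ.ne hij) with hlt | hgt
      · rw [if_pos hlt, R.ee, hs i j hlt]
        simp [h.1, sub_smul]
      · rw [if_neg hgt.not_gt, hs j i hgt]; simp
  have e2 : ∀ k, R.y k (R.x k v) = ((l k - d : ℤ) : K) • v := by
    intro k
    have := R.xy k k v
    rw [hy, map_zero, if_pos rfl, h.1, h.2] at this
    push_cast
    rw [← add_zero (R.y k _), this]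
    module
  rw [R.Ω_eq]
  simp only [e1, e2, hy, map_zero, sub_zero, h.2, map_smul, ← Finset.sum_smul]
  rw [smul_smul, ← sub_smul, ← add_smul]
  congr 1
  have hd := h.sum_eq hv
  have e3 : ∑ k, (l k - d) = (1 - m) * d := by
    rw [Finset.sum_sub_distrib, hd]; simp; ring
  rw [← Int.cast_sum (s := Finset.univ) (f := fun k => l k - d), e3]
  simp only [← Int.cast_sum, Finset.sum_add_distrib]
  rw [show ∑ i : Fin m, ∑ j, (if i = j then l i ^ 2 else 0) = ∑ i, l i ^ 2 by simp]
  push_cast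
  ring

/-- Applying the odd lowering operators to a singular vector, in a suitable order. -/
lemma exists_killed {l : Fin m → ℤ} {d : ℤ} {v : M} (h : R.IsWt l d v) (hv : v ≠ 0)
    (hn : ∃ n, (R.Ω ^ n) v = 0)
    {ρ : Fin m → ℤ} (hρ : Function.Injective ρ) (hs : ∀ i j, ρ i < ρ j → R.e i j v = 0) :
    ∃ I : Finset (Fin m), ∃ v', v' ≠ 0 ∧
      R.IsWt (fun k => l k - if k ∈ I then 1 else 0) (d - I.card) v' ∧ (∃ n, (R.Ω ^ n) v' = 0) ∧
      (∀ i j, ρ i < ρ j → R.e i j v' = 0) ∧ ∀ k, R.y k v' = 0 := by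
  suffices H : ∀ s : Finset (Fin m), (∀ i ∈ s, ∀ j, ρ i < ρ j → j ∈ s) →
      ∃ I ⊆ s, ∃ v', v' ≠ 0 ∧
      R.IsWt (fun k => l k - if k ∈ I then 1 else 0) (d - I.card) v' ∧ (∃ n, (R.Ω ^ n) v' = 0) ∧
      (∀ i j, ρ i < ρ j → R.e i j v' = 0) ∧ ∀ k ∈ s, R.y k v' = 0 by
    obtain ⟨I, -, v', h1, h2, h3, h4, h5⟩ := H Finset.univ (by simp)
    exact ⟨I, v', h1, h2, h3, h4, fun k => h5 k (Finset.mem_univ _)⟩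
  intro s
  induction s using Finset.induction_on_min_value ρ with
  | empty => exact fun _ => ⟨∅, le_rfl, v, hv, by simpa using h, hn, hs, by simp⟩
  | insert k s hks hmin ih =>
    intro hup
    have hmin' : ∀ j ∈ s, ρ k < ρ j := fun j hj =>
      lt_of_le_of_ne (hmin j hj) (hρ.ne (by rintro rfl; exact hks hj))
    obtain ⟨I, hIs, v', h1, h2, h3, h4, h5⟩ := ih fun i hi j hij => by
      rcases Finset.mem_insert.1 (hup i (Finset.mem_insert_of_mem hi) j hij) with rfl | hj
      · exact absurd (hmin' i hi) hij.not_gt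
      · exact hj
    by_cases hk : R.y k v' = 0
    · refine ⟨I, hIs.trans (Finset.subset_insert _ _), v', h1, h2, h3, h4, fun j hj => ?_⟩
      rcases Finset.mem_insert.1 hj with rfl | hj
      · exact hk
      · exact h5 j hj
    · have hkI : k ∉ I := fun hk => hks (hIs hk)
      refine ⟨insert k I, Finset.insert_subset_insert _ hIs, R.y k v', hk, ?_,
        nilpotent_of_commute (R.Ω_y k) h3, fun i j hij => ?_, fun j hj => ?_⟩
      · have := h2.y k
        rw [Finset.card_insert_of_notMem hkI]
        convert this using 1
        · funext j
          by_cases hj : j = k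
          · subst hj; simp [hkI]
          · simp [hj]
        · push_cast; ring
      · rw [R.ey, h4 i j hij, map_zero, zero_sub, neg_eq_zero]
        split_ifs with hik
        · subst hik
          refine h5 j ?_
          rcases Finset.mem_insert.1 (hup i (Finset.mem_insert_self _ _) j hij) with rfl | hj
          · exact absurd hij (lt_irrefl _)
          · exact hj
        · rfl
      · rcases Finset.mem_insert.1 hj with rfl | hj
        · exact R.y_y _ _
        · rw [R.yy, h5 j hj, map_zero, neg_zero]

end GlOps

lemma linear_le_quadratic {m k a : ℤ} (hm : 2 ≤ m) (ha : a = 0 ∨ a = 1) :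
    0 ≤ 2 * (k - a) ^ 2 + |m * k - 1| + (4 * 1 - 2) * a - (1 + m * k) ∧
      (2 * (k - a) ^ 2 + |m * k - 1| + (4 * 1 - 2) * a - (1 + m * k) = 0 → k = 0 ∨ k = 1) := by
  rcases le_or_gt k 0 with hk | hk
  · have h : m * k ≤ 0 := mul_nonpos_of_nonneg_of_nonpos (by linarith) hk
    rw [abs_of_nonpos (by linarith)]
    refine ⟨?_, fun h0 => Or.inl ?_⟩
    · rcases ha with rfl | rfl <;> nlinarith
    · rcases ha with rfl | rfl <;> nlinarith
  · have h : m ≤ m * k := le_mul_of_one_le_right (by linarith) hk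
    rw [abs_of_nonneg (by linarith)]
    refine ⟨?_, fun h0 => Or.inr ?_⟩
    · rcases ha with rfl | rfl <;> nlinarith
    · rcases ha with rfl | rfl
      · nlinarith
      · nlinarith

/-- The arithmetic inequality bounding a weight on which the Casimir eigenvalue vanishes. -/
lemma weight_inequality {m : ℕ} (hm : 2 ≤ m) {d : ℤ} (hd : d = 0 ∨ d = 1) (l : Fin m → ℤ)
    (hl : ∑ i, l i = d) (I : Finset (Fin m)) {ρ : Fin m → ℤ} (hρ : Function.Injective ρ)
    (hlρ : ∀ i j, ρ i < ρ j → l j ≤ l i)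
    (hQ : ∑ i, (l i - if i ∈ I then 1 else 0) ^ 2
      + ∑ i, ∑ j, (if ρ i < ρ j then (l i - if i ∈ I then 1 else 0) -
        (l j - if j ∈ I then 1 else 0) else 0) - (d - I.card) ^ 2 + (1 - m) * (d - I.card) = 0) :
    ∑ i, l i ^ 2 ≤ d := by
  set a : Fin m → ℤ := fun i => if i ∈ I then 1 else 0 with ha
  have ha01 : ∀ i, a i = 0 ∨ a i = 1 := fun i => by by_cases h : i ∈ I <;> simp [ha, h]
  have hacard : ∑ i, a i = I.card := by simp [ha]
  have f1 : 2 * ∑ i, ∑ j, (if ρ i < ρ j then l i - l j else 0) = ∑ i, ∑ j, |l i - l j| := by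
    rw [two_mul]
    nth_rw 2 [Finset.sum_comm]
    simp only [← Finset.sum_add_distrib]
    refine Finset.sum_congr rfl fun i _ => Finset.sum_congr rfl fun j _ => ?_
    by_cases hij : i = j
    · subst hij; simp
    · rcases lt_or_gt_of_ne (hρ.ne hij) with h | h
      · rw [if_pos h, if_neg h.not_gt, abs_of_nonneg (by linarith [hlρ _ _ h])]; ring
      · rw [if_pos h, if_neg h.not_gt, abs_of_nonpos (by linarith [hlρ _ _ h])]; ring
  have f1' : ∑ i, |m * l i - d| ≤ ∑ i, ∑ j, |l i - l j| := by
    refine Finset.sum_le_sum fun i _ => ?_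
    have : m * l i - d = ∑ j, (l i - l j) := by
      rw [Finset.sum_sub_distrib, hl]; simp
    rw [this]
    exact Finset.abs_sum_le_sum_abs _ _
  have f2 : ∑ i, ∑ j, (if ρ i < ρ j then a i - a j else 0) ≤ (I.card : ℤ) * (m - I.card) := by
    have : (I.card : ℤ) * (m - I.card) = ∑ i, ∑ j, a i * (1 - a j) := by
      simp only [← Finset.mul_sum, ← Finset.sum_mul, Finset.sum_sub_distrib, hacard]; simp
    rw [this]
    refine Finset.sum_le_sum fun i _ => Finset.sum_le_sum fun j _ => ?_
    rcases ha01 i with hi | hi <;> rcases ha01 j with hj | hj <;> rw [hi, hj] <;> split_ifs <;>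
      norm_num
  have f3 : ∑ i, ∑ j, (if ρ i < ρ j then (l i - a i) - (l j - a j) else 0) =
      ∑ i, ∑ j, (if ρ i < ρ j then l i - l j else 0) -
        ∑ i, ∑ j, (if ρ i < ρ j then a i - a j else 0) := by
    simp only [← Finset.sum_sub_distrib]
    refine Finset.sum_congr rfl fun i _ => Finset.sum_congr rfl fun j _ => ?_
    split_ifs <;> ring
  have hm' : (2 : ℤ) ≤ m := by exact_mod_cast hm
  have hQ' : ∑ i, (l i - a i) ^ 2
      + ∑ i, ∑ j, (if ρ i < ρ j then (l i - a i) - (l j - a j) else 0) - (d - I.card) ^ 2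
      + (1 - m) * (d - I.card) = 0 := hQ
  have key : ∑ i, (2 * (l i - a i) ^ 2 + |m * l i - d| + (4 * d - 2) * a i) ≤
      2 * d ^ 2 + 2 * (m - 1) * d := by
    simp only [Finset.sum_add_distrib, ← Finset.mul_sum, hacard]
    nlinarith
  have hsq : ∑ i, l i ^ 2 = ∑ i, l i := by
    refine Finset.sum_congr rfl fun i _ => ?_
    suffices h : l i = 0 ∨ l i = 1 by rcases h with h | h <;> rw [h] <;> norm_num
    rcases hd with rfl | rfl
    · have hnn : ∀ i ∈ Finset.univ, 0 ≤ (2 * (l i - a i) ^ 2 + |m * l i - 0| + (4 * 0 - 2) * a i)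
          + 2 * l i := by
        intro i _
        rcases ha01 i with h | h <;> rw [h] <;> rcases abs_cases (m * l i - 0) with h' | h' <;>
          nlinarith
      have h0 : ∑ i, ((2 * (l i - a i) ^ 2 + |m * l i - 0| + (4 * 0 - 2) * a i) + 2 * l i) = 0 := by
        refine le_antisymm ?_ (Finset.sum_nonneg hnn)
        rw [Finset.sum_add_distrib, ← Finset.mul_sum, hl]; linarith
      have := (Finset.sum_eq_zero_iff_of_nonneg hnn).1 h0 i (Finset.mem_univ _)
      left
      rcases ha01 i with h | h <;> rw [h] at this <;>
        rcases abs_cases (m * l i - 0) with h' | h' <;> nlinarith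
    · have hnn : ∀ i ∈ Finset.univ, 0 ≤ (2 * (l i - a i) ^ 2 + |m * l i - 1| + (4 * 1 - 2) * a i)
          - (1 + m * l i) := by
        exact fun i _ => (linear_le_quadratic hm' (ha01 i)).1
      have h0 : ∑ i, ((2 * (l i - a i) ^ 2 + |m * l i - 1| + (4 * 1 - 2) * a i)
          - (1 + m * l i)) = 0 := by
        refine le_antisymm ?_ (Finset.sum_nonneg hnn)
        rw [Finset.sum_sub_distrib, Finset.sum_add_distrib (f := fun _ => (1 : ℤ)), ← Finset.mul_sum,
          hl]
        simp only [Finset.sum_const, Finset.card_univ, Fintype.card_fin, nsmul_eq_mul]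
        linarith
      have := (Finset.sum_eq_zero_iff_of_nonneg hnn).1 h0 i (Finset.mem_univ _)
      exact (linear_le_quadratic hm' (ha01 i)).2 this
  rw [hsq, hl]

namespace GlOps

variable [CharZero K] [FiniteDimensional K M] {R : GlOps K m M}

/-- Weights of degree `0` or `1` in the null component of the Casimir operator are small. -/
lemma IsWt.sum_sq_le (hm : 2 ≤ m) {d : ℤ} (hd : d = 0 ∨ d = 1) {l : Fin m → ℤ} {v : M}
    (h : R.IsWt l d v) (hv : v ≠ 0) (hn : ∃ n, (R.Ω ^ n) v = 0) : ∑ i, l i ^ 2 ≤ d := by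
  let S : Set (Fin m → ℤ) := {l | ∃ v, v ≠ 0 ∧ R.IsWt l d v ∧ ∃ n, (R.Ω ^ n) v = 0}
  have hfin : S.Finite := by
    have h1 : ∀ i, {k : ℤ | (R.e i i).HasEigenvalue (k : K)}.Finite := fun i =>
      Set.Finite.preimage (Int.cast_injective.injOn) (Module.End.finite_hasEigenvalue (R.e i i))
    refine (Set.Finite.pi' h1).subset ?_
    rintro l ⟨v, hv, hl, -⟩ i
    exact Module.End.hasEigenvalue_of_hasEigenvector ⟨Module.End.mem_eigenspace_iff.2 (hl.1 i), hv⟩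
  obtain ⟨l', ⟨v', hv', h', hn'⟩, hmax⟩ :=
    Set.exists_max_image S (fun l => ∑ i, l i ^ 2) hfin ⟨l, v, hv, h, hn⟩
  refine (hmax l ⟨v, hv, h, hn⟩).trans ?_
  have hsing : ∀ i j, i ≠ j → l' j ≤ l' i → R.e i j v' = 0 := by
    intro i j hij hle
    by_contra h0
    have := hmax _ ⟨_, h0, h'.e i j, nilpotent_of_commute (R.Ω_e i j) hn'⟩
    have e : ∑ k, (l' k + (if k = i then 1 else 0) - (if k = j then 1 else 0)) ^ 2 =
        ∑ k, l' k ^ 2 + (2 * l' i + 1) - (2 * l' j - 1) := by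
      have : ∀ k, (l' k + (if k = i then 1 else 0) - (if k = j then 1 else 0)) ^ 2 =
          l' k ^ 2 + (if k = i then 2 * l' k + 1 else 0) - (if k = j then 2 * l' k - 1 else 0) := by
        intro k
        by_cases h1 : k = i
        · subst h1; simp [hij]; ring
        · by_cases h2 : k = j
          · subst h2; simp [h1]; ring
          · simp [h1, h2]
      simp only [this, Finset.sum_sub_distrib, Finset.sum_add_distrib]
      simp
    simp only [e] at this
    linarith
  let ρ : Fin m → ℤ := fun i => i - m * l' i
  have hρle : ∀ i j, ρ i ≤ ρ j → l' j ≤ l' i := by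
    intro i j hij
    by_contra hlt
    push Not at hlt
    have h1 : ((i : ℕ) : ℤ) - m * l' i ≤ ((j : ℕ) : ℤ) - m * l' j := hij
    have h2 : ((j : ℕ) : ℤ) < m := by exact_mod_cast j.2
    nlinarith [Int.natCast_nonneg (i : ℕ)]
  have hρ : Function.Injective ρ := by
    intro i j hij
    have h1 := le_antisymm (hρle _ _ hij.ge) (hρle _ _ hij.le)
    simp only [ρ, h1, sub_left_inj, Nat.cast_inj] at hij
    exact Fin.ext hij
  obtain ⟨I, w, hw, hwt, hwn, hws, hwy⟩ := exists_killed h' hv' hn' hρ fun i j hij =>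
    hsing i j (by rintro rfl; exact lt_irrefl _ hij) (hρle i j hij.le)
  refine weight_inequality hm hd l' (h'.sum_eq hv') I hρ (fun i j hij => hρle i j hij.le) ?_
  have hΩ := hwt.casimir hw hρ hws hwy
  obtain ⟨n, hn⟩ := hwn
  set Q : ℤ := ∑ i, (l' i - if i ∈ I then 1 else 0) ^ 2
    + ∑ i, ∑ j, (if ρ i < ρ j then (l' i - if i ∈ I then 1 else 0) -
      (l' j - if j ∈ I then 1 else 0) else 0) - (d - I.card) ^ 2 + (1 - m) * (d - I.card)
  have hpow : ∀ n, (R.Ω ^ n) w = (Q : K) ^ n • w := by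
    intro n
    induction n with
    | zero => simp
    | succ n ih => rw [pow_succ', Module.End.mul_apply, ih, map_smul, hΩ, smul_smul, pow_succ]
  rw [hpow, smul_eq_zero, or_iff_left hw] at hn
  exact_mod_cast eq_zero_of_pow_eq_zero hn

end GlOps

end WeightBound

section Frames

variable {m : ℕ} {M : Type} [AddCommGroup M] [Module K M]

/-- Matrix units of the `gl(m)` block. -/
abbrev mE (i j : Fin m) : gl K m 1 := mu i.castSucc j.castSucc

/-- Matrix units of the upper odd block. -/
abbrev mX (i : Fin m) : gl K m 1 := mu i.castSucc (Fin.last m)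

/-- Matrix units of the lower odd block. -/
abbrev mY (i : Fin m) : gl K m 1 := mu (Fin.last m) i.castSucc

/-- The last diagonal matrix unit. -/
abbrev mZ : gl K m 1 := mu (Fin.last m) (Fin.last m)

@[simp] lemma castSucc_eq_last_iff (i : Fin m) : i.castSucc = Fin.last m ↔ False := by
  simp [Fin.castSucc_ne_last]

@[simp] lemma last_eq_castSucc_iff (i : Fin m) : Fin.last m = i.castSucc ↔ False := by
  simp [(Fin.castSucc_ne_last i).symm]

@[simp] lemma pu_EE (i j : Fin m) : pu i.castSucc j.castSucc = 0 := by simp [pu]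
@[simp] lemma pu_EX (i : Fin m) : pu i.castSucc (Fin.last m) = 1 := by simp [pu]
@[simp] lemma pu_EY (i : Fin m) : pu (Fin.last m) i.castSucc = 1 := by simp [pu]
@[simp] lemma pu_EZ : pu (Fin.last m) (Fin.last m) = 0 := by
  simp [pu, show (1 : ZMod 2) + 1 = 0 from rfl]

lemma isHom_mE (i j : Fin m) : IsHom K 0 (mE i j : gl K m 1) := pu_EE i j ▸ isHom_mu _ _
lemma isHom_mX (i : Fin m) : IsHom K 1 (mX i : gl K m 1) := pu_EX i ▸ isHom_mu _ _
lemma isHom_mY (i : Fin m) : IsHom K 1 (mY i : gl K m 1) := pu_EY i ▸ isHom_mu _ _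
lemma isHom_mZ : IsHom K 0 (mZ : gl K m 1) := pu_EZ (m := m) ▸ isHom_mu _ _

lemma sbr_EE (i j k l : Fin m) : sbr K (mE i j : gl K m 1) (mE k l) =
    (if j = k then mE i l else 0) - (if l = i then mE k j else 0) := by
  simp [sbr_mu]

lemma sbr_EX (i j k : Fin m) : sbr K (mE i j : gl K m 1) (mX k) = if j = k then mX i else 0 := by
  simp [sbr_mu]

lemma sbr_EY (i j k : Fin m) : sbr K (mE i j : gl K m 1) (mY k) = -if i = k then mY j else 0 := by
  simp [sbr_mu, eq_comm]

lemma sbr_XX (i j : Fin m) : sbr K (mX i : gl K m 1) (mX j) = 0 := by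
  simp [sbr_mu]

lemma sbr_YY (i j : Fin m) : sbr K (mY i : gl K m 1) (mY j) = 0 := by
  simp [sbr_mu]

lemma sbr_XY (i j : Fin m) : sbr K (mX i : gl K m 1) (mY j) = mE i j + if i = j then mZ else 0 := by
  by_cases h : i = j
  · subst h; simp [sbr_mu]
  · simp [sbr_mu, h, Ne.symm h]

lemma sbr_ZE (i j : Fin m) : sbr K (mZ : gl K m 1) (mE i j) = 0 := by
  simp [sbr_mu]

lemma sbr_ZX (i : Fin m) : sbr K (mZ : gl K m 1) (mX i) = -mX i := by
  simp [sbr_mu]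

lemma sbr_ZY (i : Fin m) : sbr K (mZ : gl K m 1) (mY i) = mY i := by
  simp [sbr_mu]

lemma one_eq_sum_mE : (1 : gl K m 1) = ∑ i : Fin m, mE i i + mZ := by
  rw [one_eq_sum_mu, Fin.sum_univ_castSucc]

/-- The operators attached to a representation. -/
def ops {r : gl K m 1 →ₗ[K] Module.End K M} (hr : IsRep r) (h1 : r 1 = 0) : GlOps K m M where
  e i j := r (mE i j)
  x i := r (mX i)
  y i := r (mY i)
  z := r mZ
  Ω := casimir r
  ee i j k l v := by
    rw [hr.apply_comm (isHom_mE i j) (isHom_mE k l), sbr_EE]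
    simp only [map_sub, apply_ite r, map_zero, mul_zero, sg_zero, one_smul, LinearMap.sub_apply]
    split_ifs <;> (try simp only [LinearMap.zero_apply]) <;> abel
  ex i j k v := by
    rw [hr.apply_comm (isHom_mE i j) (isHom_mX k), sbr_EX]
    simp only [apply_ite r, map_zero, zero_mul, sg_zero, one_smul]
    split_ifs <;> simp [add_comm]
  ey i j k v := by
    rw [hr.apply_comm (isHom_mE i j) (isHom_mY k), sbr_EY]
    simp only [map_neg, apply_ite r, map_zero, zero_mul, sg_zero, one_smul]
    split_ifs <;> simp [sub_eq_neg_add]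
  ze i j v := by
    rw [hr.apply_comm isHom_mZ (isHom_mE i j), sbr_ZE]; simp
  zx k v := by
    rw [hr.apply_comm isHom_mZ (isHom_mX k), sbr_ZX]; simp [sub_eq_neg_add]
  zy k v := by
    rw [hr.apply_comm isHom_mZ (isHom_mY k), sbr_ZY]; simp [add_comm]
  xx i j v := by
    rw [hr.apply_comm (isHom_mX i) (isHom_mX j), sbr_XX]; simp
  yy i j v := by
    rw [hr.apply_comm (isHom_mY i) (isHom_mY j), sbr_YY]; simp
  xy i j v := by
    rw [hr.apply_comm (isHom_mX i) (isHom_mY j), sbr_XY]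
    simp only [map_add, apply_ite r, map_zero, one_mul, sg_one, LinearMap.add_apply]
    split_ifs <;> simp <;> abel
  tr v := by
    have := congrArg (fun T => T v) h1
    rw [one_eq_sum_mE, map_add, map_sum] at this
    simpa [LinearMap.sum_apply] using this
  Ω_eq v := by
    rw [casimir_apply, Fin.sum_univ_castSucc]
    simp only [Fin.sum_univ_castSucc, Finset.sum_add_distrib, Finset.sum_sub_distrib, si,
      par_castSucc, par_last, sg_zero, sg_one, one_smul, neg_smul, Finset.sum_neg_distrib]
    abel
  Ω_e i j := casimir_commute hr _
  Ω_x i := casimir_commute hr _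
  Ω_y i := casimir_commute hr _

namespace GlOps

/-- `v` is a weight vector in the null component of the Casimir operator. -/
def IsNull (R : GlOps K m M) (l : Fin m → ℤ) (d : ℤ) (v : M) : Prop :=
  R.IsWt l d v ∧ ∃ n, (R.Ω ^ n) v = 0

/-- A coordinate weight. -/
abbrev ep (i : Fin m) : Fin m → ℤ := fun k => if k = i then 1 else 0

variable {R : GlOps K m M}

lemma IsNull.congr {l l' : Fin m → ℤ} {d d' : ℤ} {v : M} (h : R.IsNull l d v) (hl : l = l')
    (hd : d = d') : R.IsNull l' d' v := by
  subst hl; subst hd; exact h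

lemma IsNull.e {l : Fin m → ℤ} {d : ℤ} {v : M} (h : R.IsNull l d v) (i j : Fin m) :
    R.IsNull (l + ep i - ep j) d (R.e i j v) :=
  ⟨h.1.e i j, nilpotent_of_commute (R.Ω_e i j) h.2⟩

lemma isWt_zero (l : Fin m → ℤ) (d : ℤ) : R.IsWt l d 0 := ⟨by simp, by simp⟩

lemma isNull_zero (l : Fin m → ℤ) (d : ℤ) : R.IsNull l d 0 := ⟨isWt_zero l d, 0, by simp⟩

lemma IsNull.add {l : Fin m → ℤ} {d : ℤ} {v w : M} (hv : R.IsNull l d v) (hw : R.IsNull l d w) :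
    R.IsNull l d (v + w) := by
  refine ⟨⟨fun i => ?_, ?_⟩, ?_⟩
  · rw [map_add, hv.1.1, hw.1.1, smul_add]
  · rw [map_add, hv.1.2, hw.1.2, smul_add]
  · obtain ⟨n, hn⟩ := hv.2
    obtain ⟨k, hk⟩ := hw.2
    refine ⟨n + k, ?_⟩
    rw [map_add, pow_add, Module.End.mul_apply, Module.End.mul_apply, hk, map_zero, add_zero,
      ← Module.End.mul_apply, ← pow_add, add_comm n k, pow_add, Module.End.mul_apply, hn, map_zero]

lemma IsNull.smul {l : Fin m → ℤ} {d : ℤ} {v : M} (hv : R.IsNull l d v) (c : K) :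
    R.IsNull l d (c • v) := by
  refine ⟨⟨fun i => ?_, ?_⟩, ?_⟩
  · rw [map_smul, hv.1.1, smul_comm]
  · rw [map_smul, hv.1.2, smul_comm]
  · obtain ⟨n, hn⟩ := hv.2
    exact ⟨n, by rw [map_smul, hn, smul_zero]⟩

lemma IsNull.neg {l : Fin m → ℤ} {d : ℤ} {v : M} (hv : R.IsNull l d v) : R.IsNull l d (-v) := by
  simpa using hv.smul (-1)

lemma IsNull.sub {l : Fin m → ℤ} {d : ℤ} {v w : M} (hv : R.IsNull l d v) (hw : R.IsNull l d w) :
    R.IsNull l d (v - w) := by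
  rw [sub_eq_add_neg]; exact hv.add hw.neg

variable [CharZero K] [FiniteDimensional K M]

lemma IsNull.eq_zero (hm : 2 ≤ m) {l : Fin m → ℤ} {d : ℤ} {v : M} (h : R.IsNull l d v)
    (hd : d = 0 ∨ d = 1) (i : Fin m) (hi : l i < 0) : v = 0 := by
  by_contra hv
  have h1 := h.1.sum_sq_le hm hd hv h.2
  rw [← h.1.sum_eq hv] at h1
  have h2 : ∑ i, (l i ^ 2 - l i) ≤ 0 := by rw [Finset.sum_sub_distrib]; linarith
  have h3 : ∀ i ∈ Finset.univ, 0 ≤ l i ^ 2 - l i := by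
    intro i _
    rcases le_or_gt (l i) 0 with h | h
    · nlinarith
    · nlinarith
  have h4 := (Finset.sum_eq_zero_iff_of_nonneg h3).1 (le_antisymm h2 (Finset.sum_nonneg h3)) i
    (Finset.mem_univ _)
  nlinarith

lemma IsNull.e_eq_zero (hm : 2 ≤ m) {v : M} (h : R.IsNull 0 0 v) (i j : Fin m) :
    R.e i j v = 0 := by
  by_cases hij : i = j
  · subst hij; simp [h.1.1]
  · exact (h.e i j).eq_zero hm (Or.inl rfl) j (by simp [ep, Ne.symm hij])

lemma IsNull.e_e (hm : 2 ≤ m) {o : Fin m} {w : M} (h : R.IsNull (ep o) 1 w) (i j k : Fin m) :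
    R.e i j (R.e k o w) = if j = k then R.e i o w else 0 := by
  have h0 : ∀ i j, j ≠ o → R.e i j w = 0 := by
    intro i j hj
    by_cases hij : i = j
    · subst hij; simp [h.1.1, hj]
    · exact (h.e i j).eq_zero hm (Or.inr rfl) j (by simp [ep, hj, Ne.symm hij])
  rw [R.ee]
  suffices H : R.e k o (R.e i j w) = if o = i then R.e k j w else 0 by rw [H]; abel
  by_cases hj : j = o
  · subst hj
    by_cases hi : j = i
    · subst hi; simp [h.1.1]
    · rw [if_neg hi]
      by_cases hk : k = j
      · subst hk
        rw [(h.e i k).1.1]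
        simp [hi]
      · exact ((h.e i j).e k j).eq_zero hm (Or.inr rfl) j (by simp [ep, hi, Ne.symm hk])
  · rw [h0 i j hj, h0 k j hj]; simp

end GlOps

/-- The part `gl(m) ⊕ X` of `gl(m|1)`, with coordinates along `X`, up to automorphism. -/
structure Frame (K : Type) [Field K] (m : ℕ) where
  E : Fin m → Fin m → gl K m 1
  X : Fin m → gl K m 1
  cX : Fin m → gl K m 1 →ₗ[K] K
  homE : ∀ i j, IsHom K 0 (E i j)
  homX : ∀ i, IsHom K 1 (X i)
  EE : ∀ i j k l, sbr K (E i j) (E k l) =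
    (if j = k then E i l else 0) - (if l = i then E k j else 0)
  EX : ∀ i j k, sbr K (E i j) (X k) = if j = k then X i else 0
  XX : ∀ i j, sbr K (X i) (X j) = 0
  cE : ∀ k i j, cX k (E i j) = 0
  cXX : ∀ k l, cX k (X l) = if l = k then 1 else 0

namespace Frame

/-- The linear map sending `X k` to `t k`, supported on `X`. -/
def lift (Fr : Frame K m) (t : Fin m → M) : gl K m 1 →ₗ[K] M := ∑ k, (Fr.cX k).smulRight (t k)

lemma lift_apply (Fr : Frame K m) (t : Fin m → M) (A : gl K m 1) :
    Fr.lift t A = ∑ k, Fr.cX k A • t k := by simp [lift, LinearMap.sum_apply]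

@[simp] lemma lift_E (Fr : Frame K m) (t : Fin m → M) (i j : Fin m) : Fr.lift t (Fr.E i j) = 0 := by
  simp [lift_apply, Fr.cE]

@[simp] lemma lift_X (Fr : Frame K m) (t : Fin m → M) (k : Fin m) : Fr.lift t (Fr.X k) = t k := by
  simp [lift_apply, Fr.cXX]

lemma lift_add (Fr : Frame K m) (t t' : Fin m → M) : Fr.lift (t + t') = Fr.lift t + Fr.lift t' := by
  ext A : 1
  simp [lift_apply, smul_add, Finset.sum_add_distrib]

variable (Fr : Frame K m) {r : gl K m 1 →ₗ[K] Module.End K M}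

lemma cobd_lift_EX (t : Fin m → M) (i j k : Fin m) :
    cobd r (Fr.lift t) (Fr.E i j) (Fr.X k) = r (Fr.E i j) (t k) - if j = k then t i else 0 := by
  rw [cobd_apply_of_isHom r _ (Fr.homE i j) (Fr.homX k), Fr.EX, apply_ite (Fr.lift t)]
  simp

lemma cobd_lift_EE (t : Fin m → M) (i j k l : Fin m) :
    cobd r (Fr.lift t) (Fr.E i j) (Fr.E k l) = 0 := by
  rw [cobd_apply_of_isHom r _ (Fr.homE i j) (Fr.homE k l), Fr.EE, map_sub, apply_ite (Fr.lift t),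
    apply_ite (Fr.lift t)]
  simp

lemma cobd_lift_XX (t : Fin m → M) (k l : Fin m) :
    cobd r (Fr.lift t) (Fr.X k) (Fr.X l) = r (Fr.X k) (t l) + r (Fr.X l) (t k) := by
  rw [cobd_apply_of_isHom r _ (Fr.homX k) (Fr.homX l), Fr.XX]
  simp

variable {F : Bil K m M}

lemma cocycle_EEX (hF : F ∈ cocycles r) (hEE : ∀ i j k l, F (Fr.E i j) (Fr.E k l) = 0)
    (i j k l n : Fin m) :
    r (Fr.E i j) (F (Fr.E k l) (Fr.X n)) - r (Fr.E k l) (F (Fr.E i j) (Fr.X n))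
      - (if j = k then F (Fr.E i l) (Fr.X n) else 0)
      + (if l = i then F (Fr.E k j) (Fr.X n) else 0)
      - (if j = n then F (Fr.E k l) (Fr.X i) else 0)
      + (if l = n then F (Fr.E i j) (Fr.X k) else 0) = 0 := by
  have h := hF.2 0 0 1 _ _ _ (Fr.homE i j) (Fr.homE k l) (Fr.homX n)
  have hs := hF.1 0 1 _ _ (Fr.homE k l) (Fr.homX i)
  simp only [zero_mul, sg_zero, one_smul] at hs
  rw [Fr.EE, Fr.EX, Fr.EX, hEE, map_sub, apply_ite F, apply_ite F, apply_ite F,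
    apply_ite (F (Fr.E i j)), LinearMap.sub_apply] at h
  refine Eq.trans ?_ h
  simp only [zero_mul, zero_add, sg_zero, one_smul, map_zero, smul_zero]
  split_ifs <;> simp [hs] <;> abel

variable [CharZero K] [FiniteDimensional K M] {R : GlOps K m M}

/-- Normalization of a cocycle along `gl(m) ⊗ X`. -/
lemma exists_normalize_EX (hm : 2 ≤ m) (hr : IsRep r) (hRe : ∀ i j, R.e i j = r (Fr.E i j))
    (hF : F ∈ cocycles r) (hEE : ∀ i j k l, F (Fr.E i j) (Fr.E k l) = 0)
    (hN : ∀ i j k, R.IsNull (GlOps.ep i - GlOps.ep j + GlOps.ep k) 1 (F (Fr.E i j) (Fr.X k))) :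
    ∃ t : Fin m → M, (∀ k, R.IsNull (GlOps.ep k) 1 (t k)) ∧
      (∀ i j k, i ≠ j → (F - cobd r (Fr.lift t)) (Fr.E i j) (Fr.X k) = 0) ∧
      ∀ i j k, (F - cobd r (Fr.lift t)) (Fr.E i i) (Fr.X k) =
        (F - cobd r (Fr.lift t)) (Fr.E j j) (Fr.X k) := by
  let o : Fin m := ⟨0, by omega⟩
  let t : Fin m → M := fun k => if k = o then 0 else -F (Fr.E k o) (Fr.X o)
  have ht : ∀ k, R.IsNull (GlOps.ep k) 1 (t k) := by
    intro k
    by_cases hk : k = o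
    · simpa [t, hk] using GlOps.isNull_zero _ _
    · simpa [t, hk] using ((hN k o o).congr (by abel) rfl).neg
  refine ⟨t, ht, ?_⟩
  set G := F - cobd r (Fr.lift t) with hG
  have hGc : G ∈ cocycles r := sub_mem hF (cobd_mem_cocycles hr _)
  have hGE : ∀ i j k l, G (Fr.E i j) (Fr.E k l) = 0 := by
    intro i j k l
    rw [hG, LinearMap.sub_apply, LinearMap.sub_apply, hEE, cobd_lift_EE, sub_zero]
  have hGN : ∀ i j k, R.IsNull (GlOps.ep i - GlOps.ep j + GlOps.ep k) 1 (G (Fr.E i j) (Fr.X k)) := by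
    intro i j k
    rw [hG, LinearMap.sub_apply, LinearMap.sub_apply, cobd_lift_EX]
    refine (hN i j k).sub (GlOps.IsNull.sub ?_ ?_)
    · rw [← hRe]
      exact ((ht k).e i j).congr (by abel) rfl
    · split_ifs with h
      · subst h
        exact (ht i).congr (by abel) rfl
      · exact GlOps.isNull_zero _ _
  have h0 : ∀ i j k, i ≠ j → k ≠ j → G (Fr.E i j) (Fr.X k) = 0 := fun i j k hi hk =>
    (hGN i j k).eq_zero hm (Or.inr rfl) j (by simp [GlOps.ep, hi.symm, hk.symm])
  have h1 : ∀ i, i ≠ o → G (Fr.E i o) (Fr.X o) = 0 := by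
    intro i hi
    rw [hG, LinearMap.sub_apply, LinearMap.sub_apply, cobd_lift_EX]
    simp [t, hi]
  have hb : ∀ g k l, k ≠ l →
      G (Fr.E g g) (Fr.X k) = r (Fr.E k l) (G (Fr.E g g) (Fr.X l)) := by
    intro g k l hkl
    have h := Fr.cocycle_EEX hGc hGE g g k l l
    have hw := (hGN k l l).1.1 g
    rw [hRe] at hw
    rw [hw] at h
    by_cases hgk : g = k
    · subst hgk
      simp [GlOps.ep, hkl, Ne.symm hkl] at h
      linear_combination (norm := module) h
    · by_cases hgl : g = l
      · subst hgl
        simp [GlOps.ep, Ne.symm hkl] at h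
        linear_combination (norm := module) h
      · simp [GlOps.ep, hgk, hgl, Ne.symm hgl] at h
        linear_combination (norm := module) h
  have ha : ∀ j, j ≠ o → G (Fr.E o j) (Fr.X j) = G (Fr.E o o) (Fr.X o) - G (Fr.E j j) (Fr.X o) := by
    intro j hj
    have h := Fr.cocycle_EEX hGc hGE j o o j o
    rw [h1 j hj, h0 o j o hj.symm hj.symm] at h
    simp [hj] at h
    linear_combination (norm := module) -h
  have ha0 : ∀ j, j ≠ o → G (Fr.E o j) (Fr.X j) = 0 := by
    intro j hj
    have h := Fr.cocycle_EEX hGc hGE o j j o j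
    rw [h1 j hj, h0 j o j hj hj] at h
    simp [hj.symm] at h
    have h2 := congrArg (r (Fr.E j o)) (ha j hj)
    rw [map_sub, ← hb o j o hj, ← hb j j o hj] at h2
    have h3 : r (Fr.E j o) (G (Fr.E o j) (Fr.X j)) = 0 := by
      linear_combination (norm := module) (-(1 / 2) : K) • h + (1 / 2 : K) • h2
    have h4 := ((hGN o j j).congr (show _ = GlOps.ep o by abel) rfl).e_e hm o j j
    rw [if_pos rfl, (hGN o j j).1.1 o, hRe, hRe, h3, map_zero] at h4
    simpa [GlOps.ep, hj.symm] using h4.symm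
  have hbo : ∀ j, G (Fr.E j j) (Fr.X o) = G (Fr.E o o) (Fr.X o) := by
    intro j
    by_cases hj : j = o
    · rw [hj]
    · have := ha j hj
      rw [ha0 j hj] at this
      exact (sub_eq_zero.1 this.symm).symm
  constructor
  · intro i j k hij
    by_cases hk : k = j
    · subst hk
      by_cases hi : i = o
      · subst hi; exact ha0 k hij.symm
      · by_cases hj : k = o
        · subst hj; exact h1 i hi
        · have h := Fr.cocycle_EEX hGc hGE i o o k k
          rw [ha0 k hj, h1 i hi, h0 i o k hi hj] at h
          simpa [hij.symm, Ne.symm hj] using h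
    · exact h0 i j k hij hk
  · have hbk : ∀ j k, G (Fr.E j j) (Fr.X k) = G (Fr.E o o) (Fr.X k) := by
      intro j k
      by_cases hk : k = o
      · rw [hk]; exact hbo j
      · rw [hb j k o hk, hb o k o hk, hbo]
    intro i j k
    rw [hbk i, hbk j]

end Frame

end Frames

section FrameNormalization

variable {m : ℕ} {M : Type} [AddCommGroup M] [Module K M]

namespace GlOps

variable {R : GlOps K m M}

lemma IsNull.x {l : Fin m → ℤ} {d : ℤ} {v : M} (h : R.IsNull l d v) (j : Fin m) :
    R.IsNull (l + ep j) (d + 1) (R.x j v) := by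
  refine ⟨⟨fun k => ?_, ?_⟩, nilpotent_of_commute (R.Ω_x j) h.2⟩
  · rw [R.ex, h.1.1, map_smul]
    simp only [Pi.add_apply, ep]
    push_cast
    split_ifs with h1
    · subst h1; module
    · module
  · rw [R.zx, h.1.2, map_smul]; push_cast; module

lemma IsNull.y {l : Fin m → ℤ} {d : ℤ} {v : M} (h : R.IsNull l d v) (j : Fin m) :
    R.IsNull (l - ep j) (d - 1) (R.y j v) :=
  ⟨h.1.y j, nilpotent_of_commute (R.Ω_y j) h.2⟩

end GlOps

namespace Frame

variable (Fr : Frame K m) {r : gl K m 1 →ₗ[K] Module.End K M} {F : Bil K m M}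
  [CharZero K] [FiniteDimensional K M] {R : GlOps K m M}

/-- Normalization of a cocycle along `gl(m) ⊗ X` and `X ⊗ X`. -/
lemma exists_normalize_X (hm : 2 ≤ m) (hr : IsRep r) (hRe : ∀ i j, R.e i j = r (Fr.E i j))
    (hRx : ∀ i, R.x i = r (Fr.X i))
    (hP : ∀ (o : Fin m) (l : Fin m → ℤ) (d : ℤ) (u : M), R.IsNull l d u → l o ≠ 0 → R.x o u = 0 →
      ∃ v, R.IsNull (l - GlOps.ep o) (d - 1) v ∧ R.x o v = u)
    (hF : F ∈ cocycles r) (hEE : ∀ i j k l, F (Fr.E i j) (Fr.E k l) = 0)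
    (hN : ∀ i j k, R.IsNull (GlOps.ep i - GlOps.ep j + GlOps.ep k) 1 (F (Fr.E i j) (Fr.X k)))
    (hNX : ∀ k l, R.IsNull (GlOps.ep k + GlOps.ep l) 2 (F (Fr.X k) (Fr.X l))) :
    ∃ t : Fin m → M, (∀ k, R.IsNull (GlOps.ep k) 1 (t k)) ∧
      (∀ i j k, i ≠ j → (F - cobd r (Fr.lift t)) (Fr.E i j) (Fr.X k) = 0) ∧
      (∀ i j k, (F - cobd r (Fr.lift t)) (Fr.E i i) (Fr.X k) =
        (F - cobd r (Fr.lift t)) (Fr.E j j) (Fr.X k)) ∧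
      ∀ k l, (F - cobd r (Fr.lift t)) (Fr.X k) (Fr.X l) = 0 := by
  let o : Fin m := ⟨0, by omega⟩
  obtain ⟨t, ht, h1, h2⟩ := Fr.exists_normalize_EX hm hr hRe hF hEE hN
  set G := F - cobd r (Fr.lift t) with hG
  have hGc : G ∈ cocycles r := sub_mem hF (cobd_mem_cocycles hr _)
  have hu : R.IsNull (GlOps.ep o + GlOps.ep o) 2 (G (Fr.X o) (Fr.X o)) := by
    rw [hG, LinearMap.sub_apply, LinearMap.sub_apply, cobd_lift_XX, ← hRx]
    exact (hNX o o).sub (((ht o).x o).add ((ht o).x o))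
  have hxu : R.x o (G (Fr.X o) (Fr.X o)) = 0 := by
    have h := hGc.2 1 1 1 _ _ _ (Fr.homX o) (Fr.homX o) (Fr.homX o)
    rw [Fr.XX, ← hRx] at h
    simp [show (1 : ZMod 2) + 1 = 0 from rfl] at h
    linear_combination (norm := module) (1 / 3 : K) • h
  obtain ⟨ν, hν, hνu⟩ := hP o _ _ _ hu (by simp [GlOps.ep]) hxu
  replace hν : R.IsNull (GlOps.ep o) 1 ν := hν.congr (by abel) (by norm_num)
  let s : Fin m → M := fun k => (1 / 2 : K) • R.e k o ν
  have hs : ∀ k, R.IsNull (GlOps.ep k) 1 (s k) := fun k =>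
    ((hν.e k o).smul _).congr (by abel) rfl
  have hsE : ∀ i j k, cobd r (Fr.lift s) (Fr.E i j) (Fr.X k) = 0 := by
    intro i j k
    rw [cobd_lift_EX, ← hRe]
    simp only [s, map_smul, hν.e_e hm]
    split_ifs <;> simp
  refine ⟨t + s, fun k => (ht k).add (hs k), ?_⟩
  have hG' : F - cobd r (Fr.lift (t + s)) = G - cobd r (Fr.lift s) := by
    rw [lift_add, map_add, hG]; abel
  rw [hG']
  set H := G - cobd r (Fr.lift s) with hH
  have hHc : H ∈ cocycles r := sub_mem hGc (cobd_mem_cocycles hr _)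
  have hHE : ∀ i j k, H (Fr.E i j) (Fr.X k) = G (Fr.E i j) (Fr.X k) := by
    intro i j k
    rw [hH, LinearMap.sub_apply, LinearMap.sub_apply, hsE, sub_zero]
  have hH1 : ∀ i j k, i ≠ j → H (Fr.E i j) (Fr.X k) = 0 := fun i j k hij => by
    rw [hHE, h1 i j k hij]
  refine ⟨hH1, fun i j k => by rw [hHE, hHE, h2 i j k], ?_⟩
  have hoo : H (Fr.X o) (Fr.X o) = 0 := by
    rw [hH, LinearMap.sub_apply, LinearMap.sub_apply, cobd_lift_XX, ← hRx, ← hνu]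
    simp only [s, hν.1.1 o, map_smul]
    simp [GlOps.ep]
    module
  have hsk : ∀ k l, H (Fr.X k) (Fr.X l) = H (Fr.X l) (Fr.X k) := by
    intro k l
    have := hHc.1 1 1 _ _ (Fr.homX k) (Fr.homX l)
    simpa using this.symm
  have hko : ∀ k, H (Fr.X k) (Fr.X o) = 0 := by
    intro k
    by_cases hk : k = o
    · rw [hk, hoo]
    · have h := hHc.2 0 1 1 _ _ _ (Fr.homE k o) (Fr.homX o) (Fr.homX o)
      rw [Fr.EX, Fr.XX, hoo, hH1 k o o hk] at h
      simp at h
      linear_combination (norm := module) (-(1 / 2) : K) • h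
  intro k l
  by_cases hl : l = o
  · rw [hl, hko]
  · by_cases hk : k = o
    · rw [hsk, hk, hko]
    · have h := hHc.2 0 1 1 _ _ _ (Fr.homE k o) (Fr.homX l) (Fr.homX o)
      rw [Fr.EX, Fr.EX, Fr.XX, hko, hH1 k o o hk, hH1 k o l hk] at h
      simpa [Ne.symm hl] using h

end Frame

end FrameNormalization

section Vanishing

variable {m : ℕ} {M : Type} [AddCommGroup M] [Module K M] {r : gl K m 1 →ₗ[K] Module.End K M}

/-- `v` is a weight vector in the null component of the Casimir operator. -/
def NullWt (r : gl K m 1 →ₗ[K] Module.End K M) (w : Fin (m + 1) → ℤ) (v : M) : Prop :=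
  v ∈ casNil r ∧ ∀ g, r (mu g g) v = (w g : K) • v

lemma NullWt.congr {w w' : Fin (m + 1) → ℤ} {v : M} (h : NullWt r w v) (hw : ∀ g, w g = w' g) :
    NullWt r w' v :=
  ⟨h.1, fun g => by rw [h.2, hw]⟩

lemma nullWt_zero (w : Fin (m + 1) → ℤ) : NullWt r w 0 := ⟨zero_mem _, by simp⟩

lemma NullWt.sub {w : Fin (m + 1) → ℤ} {u v : M} (hu : NullWt r w u) (hv : NullWt r w v) :
    NullWt r w (u - v) :=
  ⟨sub_mem hu.1 hv.1, fun g => by rw [map_sub, hu.2, hv.2, smul_sub]⟩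

lemma NullWt.smul {w : Fin (m + 1) → ℤ} {u : M} (hu : NullWt r w u) (c : K) :
    NullWt r w (c • u) :=
  ⟨Submodule.smul_mem _ _ hu.1, fun g => by rw [map_smul, hu.2, smul_comm]⟩

lemma NullWt.neg {w : Fin (m + 1) → ℤ} {u : M} (hu : NullWt r w u) : NullWt r w (-u) := by
  simpa using hu.smul (-1)

lemma NullWt.sum {ι : Type*} {s : Finset ι} {w : Fin (m + 1) → ℤ} {u : ι → M}
    (hu : ∀ i ∈ s, NullWt r w (u i)) : NullWt r w (∑ i ∈ s, u i) :=
  ⟨sum_mem fun i hi => (hu i hi).1, fun g => by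
    rw [map_sum, Finset.smul_sum]; exact Finset.sum_congr rfl fun i hi => (hu i hi).2 g⟩

lemma NullWt.apply (hr : IsRep r) {w : Fin (m + 1) → ℤ} {u : M} (hu : NullWt r w u)
    (a b : Fin (m + 1)) : NullWt r (w + wt a b) (r (mu a b) u) := by
  refine ⟨apply_mem_casNil hr _ hu.1, fun g => ?_⟩
  rw [hr.apply_comm (isHom_mu_diag g) (isHom_mu a b), sbr_mu_diag, hu.2]
  simp
  module

lemma nullWt_iff_isNull (hr : IsRep r) (h1 : r 1 = 0) {w : Fin (m + 1) → ℤ} {v : M} :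
    NullWt r w v ↔ (ops hr h1).IsNull (fun i => w i.castSucc) (-w (Fin.last m)) v := by
  simp only [NullWt, GlOps.IsNull, GlOps.IsWt, mem_casNil, Fin.forall_fin_succ', ops]
  simp
  tauto

lemma nullWt_iff_isNull_dual (hr : IsRep r) (h1 : r 1 = 0) {w : Fin (m + 1) → ℤ} {v : M} :
    NullWt r w v ↔ (ops hr h1).dual.IsNull (fun i => -w i.castSucc) (w (Fin.last m)) v := by
  simp only [NullWt, GlOps.IsNull, GlOps.IsWt, mem_casNil, Fin.forall_fin_succ', ops,
    GlOps.dual]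
  simp
  tauto

/-- Linear maps of weight zero into the null component, vanishing at the identity. -/
def Good (r : gl K m 1 →ₗ[K] Module.End K M) (φ : gl K m 1 →ₗ[K] M) : Prop :=
  φ 1 = 0 ∧ ∀ a b, NullWt r (wt a b) (φ (mu a b))

/-- Normalized cocycles of weight zero with values in the null component. -/
def Reduced (r : gl K m 1 →ₗ[K] Module.End K M) (F : Bil K m M) : Prop :=
  F ∈ normCocycles r ∧ ∀ a b c d, NullWt r (wt a b + wt c d) (F (mu a b) (mu c d))

lemma cobd_mem_normCocycles (hr : IsRep r) (h1 : r 1 = 0) {φ : gl K m 1 →ₗ[K] M} (hφ : φ 1 = 0) :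
    cobd r φ ∈ normCocycles r := by
  refine mem_normCocycles.2 ⟨cobd_mem_cocycles hr φ, ext_mu fun a b => ?_⟩
  rw [cobd_apply_of_isHom r φ isHom_one (isHom_mu a b), h1, hφ, sbr_one_left]
  simp

lemma Reduced.sub_cobd (hr : IsRep r) (h1 : r 1 = 0) {F : Bil K m M} (hF : Reduced r F)
    {φ : gl K m 1 →ₗ[K] M} (hφ : Good r φ) : Reduced r (F - cobd r φ) := by
  refine ⟨sub_mem hF.1 (cobd_mem_normCocycles hr h1 hφ.1), fun a b c d => ?_⟩
  rw [LinearMap.sub_apply, LinearMap.sub_apply,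
    cobd_apply_of_isHom r φ (isHom_mu a b) (isHom_mu c d), sbr_mu]
  refine (hF.2 a b c d).sub (((NullWt.sub ?_ (NullWt.smul ?_ _))).sub ?_)
  · exact ((hφ.2 c d).apply hr a b).congr fun g => add_comm _ _
  · exact (hφ.2 a b).apply hr c d
  · rw [map_sub, map_smul]
    refine NullWt.sub ?_ (NullWt.smul ?_ _)
    · split_ifs with h
      · exact (hφ.2 a d).congr fun g => by simp [wt, h]
      · rw [map_zero]; exact nullWt_zero _
    · split_ifs with h
      · exact (hφ.2 c b).congr fun g => by simp [wt, h]
      · rw [map_zero]; exact nullWt_zero _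

lemma Good.add {φ ψ : gl K m 1 →ₗ[K] M} (hφ : Good r φ) (hψ : Good r ψ) : Good r (φ + ψ) := by
  refine ⟨by rw [LinearMap.add_apply, hφ.1, hψ.1, add_zero], fun a b => ?_⟩
  rw [LinearMap.add_apply, ← sub_neg_eq_add]
  exact (hφ.2 a b).sub (hψ.2 a b).neg

/-- The frame of `gl(m)` and the upper odd block. -/
def stdFrame (K : Type) [Field K] (m : ℕ) : Frame K m where
  E := mE
  X := mX
  cX k := Matrix.entryLinearMap K K k.castSucc (Fin.last m)
  homE := isHom_mE
  homX := isHom_mX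
  EE := sbr_EE
  EX := sbr_EX
  XX := sbr_XX
  cE k i j := by simp [mu]
  cXX k l := by simp [mu, Matrix.single_apply]

lemma IsHom.neg {p : ZMod 2} {A : gl K m 1} (h : IsHom K p A) : IsHom K p (-A) := by
  simpa using h.smul (-1)

/-- The frame of `gl(m)` and the lower odd block. -/
def dualFrame (K : Type) [Field K] (m : ℕ) : Frame K m where
  E i j := -mE j i
  X := mY
  cX k := Matrix.entryLinearMap K K (Fin.last m) k.castSucc
  homE i j := (isHom_mE j i).neg
  homX := isHom_mY
  EE i j k l := by
    rw [← sbrL_apply]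
    simp only [map_neg, LinearMap.neg_apply, sbrL_apply, sbr_EE, neg_neg]
    simp only [eq_comm (a := i), eq_comm (a := k)]
    split_ifs <;> abel
  EX i j k := by
    rw [← sbrL_apply]
    simp only [map_neg, LinearMap.neg_apply, sbrL_apply, sbr_EY, neg_neg]
  XX := sbr_YY
  cE k i j := by simp [mu]
  cXX k l := by simp [mu, Matrix.single_apply]

lemma good_stdFrame_lift {t : Fin m → M} (ht : ∀ k, NullWt r (wt k.castSucc (Fin.last m)) (t k)) :
    Good r ((stdFrame K m).lift t) := by
  refine ⟨by simp [Frame.lift_apply, stdFrame], fun a b => ?_⟩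
  have h : (stdFrame K m).lift t (mu a b) =
      ∑ k : Fin m, (if a = k.castSucc ∧ b = Fin.last m then t k else 0) := by
    rw [Frame.lift_apply]
    refine Finset.sum_congr rfl fun k _ => ?_
    simp [stdFrame, mu, Matrix.single_apply]
  rw [h]
  refine NullWt.sum fun k _ => ?_
  split_ifs with h
  · rw [h.1, h.2]; exact ht k
  · exact nullWt_zero _

lemma good_dualFrame_lift {t : Fin m → M} (ht : ∀ k, NullWt r (wt (Fin.last m) k.castSucc) (t k)) :
    Good r ((dualFrame K m).lift t) := by
  refine ⟨by simp [Frame.lift_apply, dualFrame], fun a b => ?_⟩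
  have h : (dualFrame K m).lift t (mu a b) =
      ∑ k : Fin m, (if a = Fin.last m ∧ b = k.castSucc then t k else 0) := by
    rw [Frame.lift_apply]
    refine Finset.sum_congr rfl fun k _ => ?_
    simp [dualFrame, mu, Matrix.single_apply]
  rw [h]
  refine NullWt.sum fun k _ => ?_
  split_ifs with h
  · rw [h.1, h.2]; exact ht k
  · exact nullWt_zero _

/-- The linear map supported on the diagonal sending `E i i` to `t i` and killing `1`. -/
def diagLift (t : Fin m → M) : gl K m 1 →ₗ[K] M :=
  ∑ i : Fin m, (Matrix.entryLinearMap K K i.castSucc i.castSucc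
    - Matrix.entryLinearMap K K (Fin.last m) (Fin.last m) : gl K m 1 →ₗ[K] K).smulRight (t i)

lemma diagLift_apply (t : Fin m → M) (A : gl K m 1) :
    diagLift t A = ∑ i : Fin m, (A i.castSucc i.castSucc - A (Fin.last m) (Fin.last m)) • t i := by
  simp [diagLift, LinearMap.sum_apply]

@[simp] lemma diagLift_mE (t : Fin m → M) (i j : Fin m) :
    diagLift t (mE i j : gl K m 1) = if i = j then t i else 0 := by
  rw [diagLift_apply]
  by_cases h : i = j
  · subst h; simp [mu, Matrix.single_apply]
  · have : ∀ k, ¬ (i = k ∧ j = k) := fun k hk => h (hk.1.trans hk.2.symm)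
    simp [mu, h, this]

@[simp] lemma diagLift_mX (t : Fin m → M) (i : Fin m) : diagLift t (mX i : gl K m 1) = 0 := by
  simp [diagLift_apply, mu]

@[simp] lemma diagLift_mY (t : Fin m → M) (i : Fin m) : diagLift t (mY i : gl K m 1) = 0 := by
  simp [diagLift_apply, mu]

@[simp] lemma diagLift_mZ (t : Fin m → M) : diagLift t (mZ : gl K m 1) = -∑ i, t i := by
  simp [diagLift_apply, mu]

lemma good_diagLift {t : Fin m → M} (ht : ∀ k, NullWt r 0 (t k)) : Good r (diagLift t) := by
  refine ⟨by simp [diagLift_apply], fun a b => ?_⟩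
  rw [diagLift_apply]
  by_cases h : a = b
  · subst h
    refine NullWt.sum fun k _ => NullWt.smul ((ht k).congr fun g => by simp [wt]) _
  · refine NullWt.sum fun k _ => ?_
    have : ∀ c, ¬ (a = c ∧ b = c) := fun c hc => h (hc.1.trans hc.2.symm)
    simp only [mu, Matrix.single_apply, this, if_false, sub_zero, zero_smul]
    exact nullWt_zero _

end Vanishing

section Stages

variable {m : ℕ} {M : Type} [AddCommGroup M] [Module K M] {r : gl K m 1 →ₗ[K] Module.End K M}

lemma cobd_diagLift_EX (t : Fin m → M) (i j k : Fin m) : cobd r (diagLift t) (mE i j) (mX k) =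
    if i = j then -r (mX k) (t i) else 0 := by
  rw [cobd_apply_of_isHom r _ (isHom_mE i j) (isHom_mX k), sbr_EX, apply_ite (diagLift t)]
  simp only [diagLift_mE, diagLift_mX, map_zero, zero_mul, sg_zero, one_smul]
  split_ifs <;> simp

lemma cobd_diagLift_EY (t : Fin m → M) (i j k : Fin m) : cobd r (diagLift t) (mE i j) (mY k) =
    if i = j then -r (mY k) (t i) else 0 := by
  rw [cobd_apply_of_isHom r _ (isHom_mE i j) (isHom_mY k), sbr_EY, map_neg,
    apply_ite (diagLift t)]
  simp only [diagLift_mE, diagLift_mY, map_zero, zero_mul, sg_zero, one_smul]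
  split_ifs <;> simp

lemma cobd_diagLift_XX (t : Fin m → M) (i j : Fin m) :
    cobd r (diagLift t) (mX i) (mX j) = 0 := by
  rw [cobd_apply_of_isHom r _ (isHom_mX i) (isHom_mX j), sbr_XX]; simp

lemma cobd_diagLift_YY (t : Fin m → M) (i j : Fin m) :
    cobd r (diagLift t) (mY i) (mY j) = 0 := by
  rw [cobd_apply_of_isHom r _ (isHom_mY i) (isHom_mY j), sbr_YY]; simp

lemma cobd_diagLift_XY (t : Fin m → M) (i j : Fin m) :
    cobd r (diagLift t) (mX i) (mY j) = if i = j then ∑ k, t k - t i else 0 := by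
  rw [cobd_apply_of_isHom r _ (isHom_mX i) (isHom_mY j), sbr_XY, map_add,
    apply_ite (diagLift t), diagLift_mZ]
  by_cases h : i = j
  · subst h; simp [sub_eq_add_neg]
  · simp [h]

variable {F : Bil K m M}

lemma Reduced.skew (hF : Reduced r F) {pA pB : ZMod 2} {A B : gl K m 1} (hA : IsHom K pA A)
    (hB : IsHom K pB B) : F B A = -(sg K (pA * pB) • F A B) :=
  (mem_normCocycles.1 hF.1).1.1 pA pB A B hA hB

lemma Reduced.cocycle (hF : Reduced r F) : F ∈ cocycles r := (mem_normCocycles.1 hF.1).1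

variable [CharZero K] [FiniteDimensional K M]

lemma NullWt.eq_zero (hm : 2 ≤ m) (hr : IsRep r) (h1 : r 1 = 0) {w : Fin (m + 1) → ℤ} {v : M}
    (h : NullWt r w v) (hw : w (Fin.last m) = 0) (i : Fin m) (hi : w i.castSucc < 0) : v = 0 :=
  ((nullWt_iff_isNull hr h1).1 h).eq_zero hm (by simp [hw]) i hi

lemma NullWt.apply_mE_eq_zero (hm : 2 ≤ m) (hr : IsRep r) (h1 : r 1 = 0) {v : M}
    (h : NullWt r 0 v) (i j : Fin m) : r (mE i j) v = 0 :=
  (((nullWt_iff_isNull hr h1).1 h).congr (l' := 0) (d' := 0) rfl (by simp)).e_eq_zero hm i j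

lemma cobd_diagLift_EE (hm : 2 ≤ m) (hr : IsRep r) (h1 : r 1 = 0) {t : Fin m → M}
    (ht : ∀ k, NullWt r 0 (t k)) (i j k l : Fin m) :
    cobd r (diagLift t) (mE i j) (mE k l) =
    if j = k ∧ i = l then t j - t i else 0 := by
  rw [cobd_apply_of_isHom r _ (isHom_mE i j) (isHom_mE k l), sbr_EE, map_sub,
    apply_ite (diagLift t), apply_ite (diagLift t)]
  simp only [diagLift_mE, apply_ite (r _), (ht _).apply_mE_eq_zero hm hr h1, map_zero]
  by_cases hjk : j = k
  · subst hjk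
    by_cases hil : i = l
    · subst hil; simp
    · simp [hil, Ne.symm hil]
  · by_cases hil : i = l
    · subst hil; simp [hjk, Ne.symm hjk]
    · simp [hil, hjk, Ne.symm hil]

/-- Normalization of a cocycle along `gl(m) ⊗ gl(m)`. -/
lemma exists_normalize_EE (hm : 2 ≤ m) (hr : IsRep r) (h1 : r 1 = 0) (hF : Reduced r F) :
    ∃ φ, Good r φ ∧ ∀ i j k l, (F - cobd r φ) (mE i j) (mE k l) = 0 := by
  let o : Fin m := ⟨0, by omega⟩
  let t : Fin m → M := fun i => if i = o then 0 else -F (mE i o) (mE o i)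
  have ht : ∀ k, NullWt r 0 (t k) := by
    intro k
    by_cases hk : k = o
    · simpa [t, hk] using nullWt_zero _
    · simpa [t, hk] using ((hF.2 _ _ _ _).congr fun g => by simp [wt]).neg
  refine ⟨diagLift t, good_diagLift ht, ?_⟩
  have hG := hF.sub_cobd hr h1 (good_diagLift ht)
  have hio : ∀ i, i ≠ o → (F - cobd r (diagLift t)) (mE i o) (mE o i) = 0 := by
    intro i hi
    rw [LinearMap.sub_apply, LinearMap.sub_apply, cobd_diagLift_EE hm hr h1 ht]
    simp [t, hi]
  revert hG hio
  generalize F - cobd r (diagLift t) = G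
  intro hG hio
  have hsk : ∀ i j k l, G (mE k l) (mE i j) = -G (mE i j) (mE k l) := by
    intro i j k l
    simpa using hG.skew (isHom_mE i j) (isHom_mE k l)
  have hneg : ∀ i j k l (g : Fin m), wt i.castSucc j.castSucc g.castSucc + wt k.castSucc l.castSucc g.castSucc
      < 0 → G (mE i j) (mE k l) = 0 := fun i j k l g hg =>
    (hG.2 _ _ _ _).eq_zero hm hr h1 (by simp [wt]) g hg
  have hij : ∀ i j, i ≠ j → G (mE i j) (mE j i) = 0 := by
    intro i j hij
    by_cases hj : j = o
    · subst hj; exact hio i hij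
    · by_cases hi : i = o
      · subst hi; rw [hsk, hio j hj, neg_zero]
      · have h := hG.cocycle.2 0 0 0 _ _ _ (isHom_mE i o) (isHom_mE o j) (isHom_mE j i)
        rw [sbr_EE, sbr_EE, sbr_EE, hneg o j j i i (by simp [wt, hi, hij]),
          hneg i o j i o (by simp [wt, Ne.symm hi, Ne.symm hj]),
          hneg i o o j j (by simp [wt, Ne.symm hij, hj])] at h
        simp [Ne.symm hij, hi, Ne.symm hj] at h
        rw [hio i hi, hsk o j j o, hsk j o o j] at h
        simpa [hio j hj] using h
  have hgi : ∀ g i j, i ≠ j → G (mE g g) (mE i i) = G (mE g g) (mE j j) := by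
    intro g i j hne
    have h := hG.cocycle.2 0 0 0 _ _ _ (isHom_mE g g) (isHom_mE i j) (isHom_mE j i)
    have hs : ∀ a b, sbr K (mE g g : gl K m 1) (mE a b) =
      (wt a.castSucc b.castSucc g.castSucc : K) • mE a b := fun a b => sbr_mu_diag _ _ _
    rw [hs, hs, sbr_EE, hij i j hne, hneg g g j i i (by simp [wt, hne]),
      hneg g g i j j (by simp [wt, Ne.symm hne])] at h
    simp [hij i j hne] at h
    rw [hsk i j j i, hij i j hne] at h
    simpa [sub_eq_zero] using h
  have hgg : ∀ g i, G (mE g g) (mE i i) = 0 := by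
    intro g i
    have h0 : G (mE g g) (mE g g) = 0 := by
      have h := hsk g g g g
      linear_combination (norm := module) (1 / 2 : K) • h
    by_cases hi : i = g
    · rw [hi, h0]
    · rw [hgi g i g hi, h0]
  intro i j k l
  by_cases h₁ : i = j
  · subst h₁
    by_cases h₂ : k = l
    · subst h₂; exact hgg i k
    · exact hneg _ _ _ _ l (by simp [wt, Ne.symm h₂])
  · by_cases h₂ : k = j
    · subst h₂
      by_cases h₃ : l = i
      · subst h₃; exact hij _ _ h₁
      · exact hneg _ _ _ _ l (by simp [wt, h₃])
    · exact hneg _ _ _ _ j (by simp [wt, Ne.symm h₁, Ne.symm h₂]; split_ifs <;> simp)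

end Stages

section OddStages

variable {m : ℕ} {M : Type} [AddCommGroup M] [Module K M] {r : gl K m 1 →ₗ[K] Module.End K M}

/-- Exactness of an odd matrix unit `E p q` on vectors of nonzero `E p p`-weight. -/
def OddExact (r : gl K m 1 →ₗ[K] Module.End K M) : Prop :=
  ∀ (p q : Fin (m + 1)) (k : ℤ) (u : M), pu p q = 1 → k ≠ 0 → r (mu p p) u = (k : K) • u →
    r (mu p q) u = 0 → ∃ v, r (mu p q) v = u

/-- Vanishing of a bilinear map along all pairs except those of type `gl(m) ⊗ odd` in the
diagonal directions and `X ⊗ Y`. -/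
structure OddNormal (F : Bil K m M) : Prop where
  ee : ∀ i j k l, F (mE i j) (mE k l) = 0
  ex : ∀ i j k, i ≠ j → F (mE i j) (mX k) = 0
  exd : ∀ i j k, F (mE i i) (mX k) = F (mE j j) (mX k)
  xx : ∀ i j, F (mX i) (mX j) = 0
  ey : ∀ i j k, i ≠ j → F (mE i j) (mY k) = 0
  eyd : ∀ i j k, F (mE i i) (mY k) = F (mE j j) (mY k)
  yy : ∀ i j, F (mY i) (mY j) = 0

variable [FiniteDimensional K M]

lemma OddExact.exists_nullWt [CharZero K] (hP : OddExact r) (hr : IsRep r) (hss : DiagSemisimple r)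
    {p q : Fin (m + 1)} (hpq : pu p q = 1) {w : Fin (m + 1) → ℤ} {u : M} (hu : NullWt r w u)
    (hw : w p ≠ 0 ∨ w q ≠ 0) (hku : r (mu p q) u = 0) :
    ∃ v, NullWt r (w - wt p q) v ∧ r (mu p q) v = u := by
  have hv : ∃ v, r (mu p q) v = u := by
    by_cases hp : w p = 0
    · have hq := hw.resolve_left (not_not.2 hp)
      have hqp : pu q p = 1 := by rw [← hpq, pu, pu, add_comm]
      have h := hr.apply_comm (isHom_mu p q) (isHom_mu q p) u
      rw [hku, map_zero, smul_zero, add_zero, sbr_mu, if_pos rfl, if_pos rfl, hpq, hqp, mul_one,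
        sg_one, map_sub, map_smul, LinearMap.sub_apply, LinearMap.smul_apply, hu.2, hu.2, hp] at h
      have hq' : (w q : K) ≠ 0 := by exact_mod_cast hq
      refine ⟨(w q : K)⁻¹ • r (mu q p) u, ?_⟩
      rw [map_smul, h]
      simp [smul_smul, hq']
    · exact hP p q _ u hpq hp (hu.2 p) hku
  obtain ⟨v, hv⟩ := hv
  obtain ⟨v₀, h₁, h₂, h₃⟩ := exists_weight_preimage hr hss hu.1 hu.2 hv
  exact ⟨v₀, ⟨h₁, h₂⟩, h₃⟩

variable [CharZero K] {F : Bil K m M}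

/-- Normalization of a cocycle along the odd directions. -/
lemma exists_oddNormal (hm : 2 ≤ m) (hr : IsRep r) (h1 : r 1 = 0) (hss : DiagSemisimple r)
    (hP : OddExact r) (hF : Reduced r F) (hEE : ∀ i j k l, F (mE i j) (mE k l) = 0) :
    ∃ φ, Good r φ ∧ OddNormal (F - cobd r φ) := by
  obtain ⟨t, ht, a1, a2, a3⟩ := (stdFrame K m).exists_normalize_X (r := r) (R := ops hr h1) hm hr
    (fun i j => rfl) (fun i => rfl)
    (fun o l d u hu hl hxu => by
      have hu' : NullWt r (Fin.snoc l (-d)) u :=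
        (nullWt_iff_isNull hr h1).2 (hu.congr (by ext; simp) (by simp))
      obtain ⟨v, hv, hvu⟩ := hP.exists_nullWt hr hss (pu_EX o) hu' (Or.inl (by simpa using hl)) hxu
      refine ⟨v, ((nullWt_iff_isNull hr h1).1 hv).congr ?_ ?_, hvu⟩
      · ext i; simp [wt, GlOps.ep]
      · simp [wt]; ring)
    hF.cocycle hEE
    (fun i j k => ((nullWt_iff_isNull hr h1).1 (hF.2 _ _ _ _)).congr
      (by ext g; simp [wt, GlOps.ep]) (by simp [wt]))
    (fun k l => ((nullWt_iff_isNull hr h1).1 (hF.2 _ _ _ _)).congr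
      (by ext g; simp [wt, GlOps.ep]) (by simp [wt]))
  have hg : Good r ((stdFrame K m).lift t) := good_stdFrame_lift fun k =>
    ((nullWt_iff_isNull hr h1).2 ((ht k).congr (by ext g; simp [wt, GlOps.ep]) (by simp [wt])))
  have hG := hF.sub_cobd hr h1 hg
  have hGE : ∀ i j k l, (F - cobd r ((stdFrame K m).lift t)) (mE i j) (mE k l) = 0 := by
    intro i j k l
    rw [LinearMap.sub_apply, LinearMap.sub_apply, hEE, zero_sub, neg_eq_zero]
    exact (stdFrame K m).cobd_lift_EE t i j k l
  suffices H : ∃ φ, Good r φ ∧ OddNormal (F - cobd r ((stdFrame K m).lift t) - cobd r φ) by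
    obtain ⟨φ, hφ, hn⟩ := H
    exact ⟨(stdFrame K m).lift t + φ, hg.add hφ, by rwa [map_add, ← sub_sub]⟩
  revert hG hGE a1 a2 a3
  generalize F - cobd r ((stdFrame K m).lift t) = G
  intro a1 a2 a3 hG hGE
  obtain ⟨s, hs, b1, b2, b3⟩ := (dualFrame K m).exists_normalize_X (r := r) (R := (ops hr h1).dual)
    hm hr (fun i j => (map_neg r _).symm) (fun i => rfl)
    (fun o l d u hu hl hxu => by
      have hu' : NullWt r (Fin.snoc (-l) d) u :=
        (nullWt_iff_isNull_dual hr h1).2 (hu.congr (by ext; simp) (by simp))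
      obtain ⟨v, hv, hvu⟩ := hP.exists_nullWt hr hss (pu_EY o) hu' (Or.inr (by simpa using hl)) hxu
      refine ⟨v, ((nullWt_iff_isNull_dual hr h1).1 hv).congr ?_ ?_, hvu⟩
      · ext i; simp [wt, GlOps.ep]; ring
      · simp [wt])
    hG.cocycle
    (fun i j k l => by simp [dualFrame, hGE])
    (fun i j k => by
      have h := ((nullWt_iff_isNull_dual hr h1).1 (hG.2 j.castSucc i.castSucc
        (Fin.last m) k.castSucc)).neg
      rw [← LinearMap.neg_apply, ← map_neg] at h
      exact h.congr (by ext g; simp [wt, GlOps.ep]; ring) (by simp [wt]))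
    (fun k l => ((nullWt_iff_isNull_dual hr h1).1 (hG.2 _ _ _ _)).congr
      (by ext g; simp [wt, GlOps.ep]; ring) (by simp [wt]))
  have hg' : Good r ((dualFrame K m).lift s) := good_dualFrame_lift fun k =>
    ((nullWt_iff_isNull_dual hr h1).2 ((hs k).congr (by ext g; simp [wt, GlOps.ep]) (by simp [wt])))
  have hsX : ∀ k, (dualFrame K m).lift s (mX k) = 0 := by
    intro k; simp [Frame.lift_apply, dualFrame, mu]
  have hsE : ∀ i j, (dualFrame K m).lift s (mE i j) = 0 := by
    intro k; simp [Frame.lift_apply, dualFrame, mu]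
  have hEX : ∀ i j k, cobd r ((dualFrame K m).lift s) (mE i j) (mX k) = 0 := by
    intro i j k
    rw [cobd_apply_of_isHom r _ (isHom_mE i j) (isHom_mX k), sbr_EX,
      apply_ite ((dualFrame K m).lift s), hsE, hsX, hsX]
    simp
  refine ⟨_, hg', ⟨fun i j k l => ?_, fun i j k hij => ?_, fun i j k => ?_, fun i j => ?_,
    fun i j k hij => ?_, fun i j k => ?_, b3⟩⟩
  · rw [LinearMap.sub_apply, LinearMap.sub_apply, hGE, zero_sub, neg_eq_zero]
    have := (dualFrame K m).cobd_lift_EE (r := r) s j i l k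
    simpa [dualFrame] using this
  · rw [LinearMap.sub_apply, LinearMap.sub_apply, hEX, sub_zero]
    exact a1 i j k hij
  · rw [LinearMap.sub_apply, LinearMap.sub_apply, LinearMap.sub_apply, LinearMap.sub_apply, hEX,
      hEX, sub_zero, sub_zero]
    exact a2 i j k
  · rw [LinearMap.sub_apply, LinearMap.sub_apply,
      cobd_apply_of_isHom r _ (isHom_mX i) (isHom_mX j), sbr_XX, hsX, hsX]
    simpa using show G (mX i) (mX j) = 0 from a3 i j
  · have h : (G - cobd r ((dualFrame K m).lift s)) (-mE i j) (mY k) = 0 := b1 j i k hij.symm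
    rwa [map_neg, LinearMap.neg_apply, neg_eq_zero] at h
  · have h : (G - cobd r ((dualFrame K m).lift s)) (-mE i i) (mY k) =
      (G - cobd r ((dualFrame K m).lift s)) (-mE j j) (mY k) := b2 i j k
    rwa [map_neg, LinearMap.neg_apply, map_neg, LinearMap.neg_apply, neg_inj] at h

end OddStages

section Conclusion

variable {m : ℕ} {M : Type} [AddCommGroup M] [Module K M] {r : gl K m 1 →ₗ[K] Module.End K M}
  [CharZero K] {F : Bil K m M}

/-- A fully normalized cocycle vanishes. -/
lemma Reduced.eq_zero (hm : 2 ≤ m) (hF : Reduced r F)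
    (hN : OddNormal F) (hEX : ∀ i j k, F (mE i j) (mX k) = 0)
    (hXY : ∀ i j, F (mX i) (mY j) = 0) : F = 0 := by
  have hF1 : F 1 = 0 := (mem_normCocycles.1 hF.1).2
  have hZ : ∀ B, F mZ B = -∑ i, F (mE i i) B := by
    intro B
    have h := LinearMap.congr_fun hF1 B
    rw [one_eq_sum_mE, map_add, map_sum, LinearMap.add_apply, LinearMap.sum_apply] at h
    exact (neg_eq_of_add_eq_zero_right h).symm
  have hsw : ∀ a b c d, F (mu a b) (mu c d) = 0 → F (mu c d) (mu a b) = 0 := by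
    intro a b c d h
    rw [hF.skew (isHom_mu a b) (isHom_mu c d), h]; simp
  have hXX := hN.xx
  have hm1 : ((m : K) - 1) ≠ 0 := by
    rw [sub_ne_zero]
    exact_mod_cast (by omega : m ≠ 1)
  have hEYd : ∀ k, F (mE k k) (mY k) = 0 := by
    intro k
    have h := hF.cocycle.2 1 1 1 _ _ _ (isHom_mX k) (isHom_mY k) (isHom_mY k)
    rw [sbr_XY, sbr_YY, hN.yy, hXY, if_pos rfl, map_add, LinearMap.add_apply, hZ,
      Finset.sum_congr rfl fun i _ => hN.eyd i k k, Finset.sum_const, Finset.card_univ,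
      Fintype.card_fin, ← Nat.cast_smul_eq_nsmul K] at h
    simp at h
    have h2 : ((m : K) - 1) • F (mE k k) (mY k) = 0 := by
      linear_combination (norm := module) (1 / 2 : K) • h
    exact (smul_eq_zero.1 h2).resolve_left hm1
  have hEY : ∀ i j k, F (mE i j) (mY k) = 0 := by
    intro i j k
    by_cases hij : i = j
    · subst hij; rw [hN.eyd i k k, hEYd]
    · exact hN.ey i j k hij
  have hE : ∀ (i j : Fin m), F (mE i j) = 0 := by
    intro i j
    refine ext_mu fun c d => ?_
    induction c using Fin.lastCases with
    | last =>
      induction d using Fin.lastCases with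
      | last => exact hsw _ _ _ _ (by rw [hZ]; simp [hN.ee])
      | cast l => exact hEY _ _ _
    | cast k =>
      induction d using Fin.lastCases with
      | last => exact hEX _ _ _
      | cast l => exact hN.ee _ _ _ _
  have hZ' : F mZ = 0 := by
    ext B : 1
    rw [hZ]; simp [hE]
  refine bil_ext fun a b c d => ?_
  induction a using Fin.lastCases with
  | last =>
    induction b using Fin.lastCases with
    | last => rw [hZ']; rfl
    | cast j =>
      induction c using Fin.lastCases with
      | last =>
        induction d using Fin.lastCases with
        | last => exact hsw _ _ _ _ (by rw [hZ']; rfl)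
        | cast l => exact hN.yy _ _
      | cast k =>
        induction d using Fin.lastCases with
        | last => exact hsw _ _ _ _ (hXY _ _)
        | cast l => exact hsw _ _ _ _ (hEY _ _ _)
  | cast i =>
    induction b using Fin.lastCases with
    | cast j => rw [hE]; rfl
    | last =>
      induction c using Fin.lastCases with
      | last =>
        induction d using Fin.lastCases with
        | last => exact hsw _ _ _ _ (by rw [hZ']; rfl)
        | cast l => exact hXY _ _
      | cast k =>
        induction d using Fin.lastCases with
        | last => exact hN.xx _ _
        | cast l => exact hsw _ _ _ _ (hEX _ _ _)

variable [FiniteDimensional K M]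

lemma OddNormal.sub_diag (hm : 2 ≤ m) (hr : IsRep r) (h1 : r 1 = 0) (hF : OddNormal F) {τ : M}
    (hτ : NullWt r 0 τ) : OddNormal (F - cobd r (diagLift fun _ => τ)) where
  ee i j k l := by
    rw [LinearMap.sub_apply, LinearMap.sub_apply, hF.ee, cobd_diagLift_EE hm hr h1 fun _ => hτ]
    simp
  ex i j k hij := by
    rw [LinearMap.sub_apply, LinearMap.sub_apply, hF.ex i j k hij, cobd_diagLift_EX, if_neg hij,
      sub_zero]
  exd i j k := by
    simp only [LinearMap.sub_apply, hF.exd i j k, cobd_diagLift_EX, if_true]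
  xx i j := by
    rw [LinearMap.sub_apply, LinearMap.sub_apply, hF.xx, cobd_diagLift_XX, sub_zero]
  ey i j k hij := by
    rw [LinearMap.sub_apply, LinearMap.sub_apply, hF.ey i j k hij, cobd_diagLift_EY, if_neg hij,
      sub_zero]
  eyd i j k := by
    simp only [LinearMap.sub_apply, hF.eyd i j k, cobd_diagLift_EY, if_true]
  yy i j := by
    rw [LinearMap.sub_apply, LinearMap.sub_apply, hF.yy, cobd_diagLift_YY, sub_zero]

/-- Normalization of a cocycle along `gl(m) ⊗ X` in the diagonal directions. -/
lemma exists_normalize_diag (hm : 2 ≤ m) (hr : IsRep r) (h1 : r 1 = 0) (hss : DiagSemisimple r)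
    (hP : OddExact r) (hF : Reduced r F) (hN : OddNormal F) :
    ∃ φ, Good r φ ∧ OddNormal (F - cobd r φ) ∧
      ∀ i j k, (F - cobd r φ) (mE i j) (mX k) = 0 := by
  let o : Fin m := ⟨0, by omega⟩
  have hx : r (mX o) (F (mE o o) (mX o)) = 0 := by
    have h := hF.cocycle.2 0 1 1 _ _ _ (isHom_mE o o) (isHom_mX o) (isHom_mX o)
    rw [sbr_EX, sbr_XX, hN.xx, if_pos rfl, hN.xx] at h
    simp at h
    linear_combination (norm := module) (-(1 / 2) : K) • h
  obtain ⟨μ, hμ, hμb⟩ := hP.exists_nullWt hr hss (pu_EX o) (hF.2 _ _ _ _)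
    (Or.inl (by simp [wt])) hx
  replace hμ : NullWt r 0 μ := hμ.congr fun g => by simp [wt]
  have hbk : ∀ g k, F (mE g g) (mX k) = r (mX k) μ := by
    intro g k
    rw [hN.exd g o k]
    by_cases hk : k = o
    · rw [hk, hμb]
    · have h := (stdFrame K m).cocycle_EEX hF.cocycle hN.ee o o k o o
      simp only [stdFrame, if_true, hN.ex k o _ hk, Ne.symm hk, if_false] at h
      have h2 := hr.apply_comm (isHom_mE k o) (isHom_mX o) μ
      rw [sbr_EX, if_pos rfl, hμ.apply_mE_eq_zero hm hr h1, hμb] at h2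
      rw [h2] at h
      simp at h
      linear_combination (norm := module) h
  refine ⟨diagLift fun _ => -μ, good_diagLift fun _ => hμ.neg, hN.sub_diag hm hr h1 hμ.neg,
    fun i j k => ?_⟩
  by_cases hij : i = j
  · subst hij
    rw [LinearMap.sub_apply, LinearMap.sub_apply, cobd_diagLift_EX, if_pos rfl, hbk]
    simp
  · exact (hN.sub_diag hm hr h1 hμ.neg).ex i j k hij

/-- Normalization of a cocycle along `X ⊗ Y`. -/
lemma exists_normalize_XY (hm : 2 ≤ m) (hr : IsRep r) (h1 : r 1 = 0) (hF : Reduced r F)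
    (hN : OddNormal F) (hEX : ∀ i j k, F (mE i j) (mX k) = 0) :
    ∃ φ, Good r φ ∧ OddNormal (F - cobd r φ) ∧
      (∀ i j k, (F - cobd r φ) (mE i j) (mX k) = 0) ∧
      ∀ i j, (F - cobd r φ) (mX i) (mY j) = 0 := by
  let o : Fin m := ⟨0, by omega⟩
  have hXY0 : ∀ i j, i ≠ j → F (mX i) (mY j) = 0 := fun i j hij =>
    (hF.2 _ _ _ _).eq_zero hm hr h1 (by simp [wt]) j (by simp [wt, Ne.symm hij])
  have hYX : ∀ i j, F (mY j) (mX i) = F (mX i) (mY j) := by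
    intro i j
    simpa using hF.skew (isHom_mX i) (isHom_mY j)
  have hXE : ∀ i j k, F (mX k) (mE i j) = 0 := by
    intro i j k
    rw [hF.skew (isHom_mE i j) (isHom_mX k), hEX]; simp
  have hF1 : F 1 = 0 := (mem_normCocycles.1 hF.1).2
  have hXZ : ∀ k, F (mX k) mZ = 0 := by
    intro k
    rw [hF.skew isHom_mZ (isHom_mX k)]
    have h := LinearMap.congr_fun hF1 (mX k)
    rw [one_eq_sum_mE, map_add, map_sum, LinearMap.add_apply, LinearMap.sum_apply] at h
    simpa [hEX] using h
  have hc : ∀ i, F (mX i) (mY i) = F (mX o) (mY o) := by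
    intro i
    by_cases hi : i = o
    · rw [hi]
    · have h := hF.cocycle.2 0 1 1 _ _ _ (isHom_mE i o) (isHom_mX o) (isHom_mY i)
      rw [sbr_EX, sbr_EY, sbr_XY, if_pos rfl, if_pos rfl, if_neg (Ne.symm hi), hN.ey i o i hi, hEX,
        hXY0 o i (Ne.symm hi), add_zero, hN.ee, map_neg, LinearMap.neg_apply, hYX] at h
      simp at h
      linear_combination (norm := module) -h
  set c := F (mX o) (mY o) with hcdef
  have hcN : NullWt r 0 c := (hF.2 _ _ _ _).congr fun g => by simp [wt]
  have hxc : ∀ k, r (mX k) c = 0 := by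
    intro k
    obtain ⟨i, hi⟩ : ∃ i : Fin m, i ≠ k := by
      have : Nontrivial (Fin m) := Fin.nontrivial_iff_two_le.2 hm
      exact exists_ne k
    have h := hF.cocycle.2 1 1 1 _ _ _ (isHom_mX k) (isHom_mX i) (isHom_mY i)
    rw [sbr_XX, sbr_XY, sbr_XY, hc, hXY0 k i (Ne.symm hi), hN.xx, if_pos rfl,
      if_neg (Ne.symm hi), add_zero, hEX, map_add, hXE, hXZ] at h
    simpa using h
  have hm1 : ((m : K) - 1) ≠ 0 := by
    rw [sub_ne_zero]
    exact_mod_cast (by omega : m ≠ 1)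
  have hτ := hcN.smul ((m : K) - 1)⁻¹
  refine ⟨diagLift fun _ => ((m : K) - 1)⁻¹ • c, good_diagLift fun _ => hτ,
    hN.sub_diag hm hr h1 hτ, fun i j k => ?_, fun i j => ?_⟩
  · rw [LinearMap.sub_apply, LinearMap.sub_apply, cobd_diagLift_EX, hEX, map_smul, hxc]
    simp
  · rw [LinearMap.sub_apply, LinearMap.sub_apply, cobd_diagLift_XY]
    by_cases hij : i = j
    · subst hij
      rw [hc, if_pos rfl, Finset.sum_const, Finset.card_univ, Fintype.card_fin]
      rw [← Nat.cast_smul_eq_nsmul K, smul_smul, ← sub_smul]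
      rw [show (m : K) * ((m : K) - 1)⁻¹ - ((m : K) - 1)⁻¹ = 1 by field_simp, one_smul, sub_self]
    · rw [hXY0 i j hij, if_neg hij, sub_zero]

/-- Vanishing of the second cohomology with coefficients in a finite-dimensional representation
of `gl(m|1)` trivial on the center, with integral diagonalizable weights and exact odd matrix
units. -/
theorem exists_eq_cobd (hm : 2 ≤ m) (hr : IsRep r) (h1 : r 1 = 0) (hss : DiagSemisimple r)
    (hP : OddExact r) {f : Bil K m M} (hf : f ∈ normCocycles r) : ∃ φ, f = cobd r φ := by
  obtain ⟨f₀, hf₀, φ₀, rfl, hnil, hwt⟩ := exists_reduced hr hss hf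
  have h₀ : Reduced r f₀ := ⟨hf₀, fun a b c d => ⟨hnil _ _, fun g => hwt g a b c d⟩⟩
  obtain ⟨φ₁, g₁, hEE⟩ := exists_normalize_EE hm hr h1 h₀
  have h₁ := h₀.sub_cobd hr h1 g₁
  obtain ⟨φ₂, g₂, hN₂⟩ := exists_oddNormal hm hr h1 hss hP h₁ hEE
  have h₂ := h₁.sub_cobd hr h1 g₂
  obtain ⟨φ₃, g₃, hN₃, hEX₃⟩ := exists_normalize_diag hm hr h1 hss hP h₂ hN₂
  have h₃ := h₂.sub_cobd hr h1 g₃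
  obtain ⟨φ₄, g₄, hN₄, hEX₄, hXY₄⟩ := exists_normalize_XY hm hr h1 h₃ hN₃ hEX₃
  have := (h₃.sub_cobd hr h1 g₄).eq_zero hm hN₄ hEX₄ hXY₄
  refine ⟨φ₀ + φ₁ + φ₂ + φ₃ + φ₄, ?_⟩
  simp only [map_add]
  linear_combination (norm := abel) this

end Conclusion

section Enveloping

variable {m : ℕ}

/-- The supertrace as a linear map. -/
def strL (K : Type) [Field K] (m : ℕ) : gl K m 1 →ₗ[K] K where
  toFun := str K
  map_add' A B := by simp [str, mul_add, Finset.sum_add_distrib]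
  map_smul' c A := by simp [str, Finset.mul_sum, mul_left_comm]

@[simp] lemma strL_apply (A : gl K m 1) : strL K m A = str K A := rfl

lemma mem_sl {A : gl K m 1} : A ∈ sl K m 1 ↔ str K A = 0 := Iff.rfl

lemma str_mu (a b : Fin (m + 1)) :
    str K (mu a b : gl K m 1) = if a = b then sg K (par m 1 a) else 0 := by
  by_cases h : a = b
  · subst h; simp [str, mu, Matrix.single_apply]
  · have : ∀ c, ¬ (a = c ∧ b = c) := fun c hc => h (hc.1.trans hc.2.symm)
    simp [str, mu, h, this]

lemma str_one : str K (1 : gl K m 1) = (m : K) - 1 := by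
  rw [str, Fin.sum_univ_castSucc]
  simp [par_castSucc, par_last, sub_eq_add_neg]

lemma str_sbr (A B : gl K m 1) : str K (sbr K A B) = 0 := by
  suffices H : (sbrL (K := K) (m := m)).compr₂ (strL K m) = 0 by
    simpa using LinearMap.congr_fun (LinearMap.congr_fun H A) B
  refine ext_mu fun a b => ext_mu fun c d => ?_
  simp only [LinearMap.compr₂_apply, sbrL_apply, sbr_mu, map_sub, map_smul,
    apply_ite (strL K m), strL_apply, str_mu, map_zero, LinearMap.zero_apply]
  by_cases h : b = c
  · subst h
    by_cases h' : a = d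
    · subst h'
      simp only [if_true, pu]
      rcases zmod_two_cases (par m 1 a) with ha | ha <;>
        rcases zmod_two_cases (par m 1 b) with hb | hb <;> simp [ha, hb,
          show (1 : ZMod 2) + 1 = 0 from rfl]
    · simp [h', Ne.symm h']
  · simp [h, Ne.symm h]

lemma str_of_isHom_one {A : gl K m 1} (h : IsHom K 1 A) : str K A = 0 := by
  refine Finset.sum_eq_zero fun i _ => ?_
  by_cases hi : A i i = 0
  · rw [hi, mul_zero]
  · have := h i i hi
    rw [(add_eq_zero_zmod_two _ _).2 rfl] at this
    exact absurd this zero_ne_one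

/-- The canonical map as a linear map. -/
def piL (K : Type) [Field K] (m : ℕ) : sl K m 1 →ₗ[K] Uenv K m :=
  (RingQuot.mkAlgHom K (urel K m)).toLinearMap ∘ₗ TensorAlgebra.ι K

@[simp] lemma piL_apply (A : sl K m 1) : piL K m A = piU K m A := rfl

lemma piU_comm {pA pB : ZMod 2} {A B C : sl K m 1} (hA : IsHom K pA (A : gl K m 1))
    (hB : IsHom K pB (B : gl K m 1)) (hC : (C : gl K m 1) = sbr K ↑A ↑B) :
    piU K m A * piU K m B - sg K (pA * pB) • (piU K m B * piU K m A) = piU K m C := by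
  have h := RingQuot.mkAlgHom_rel K (s := urel K m) ⟨pA, pB, A, B, C, hA, hB, hC, rfl, rfl⟩
  rw [map_sub, map_smul, map_mul, map_mul] at h
  exact h

/-- The universal property of the enveloping algebra. -/
def liftU {S : Type} [Ring S] [Algebra K S] (g : sl K m 1 →ₗ[K] S)
    (hg : ∀ (pA pB : ZMod 2) (A B C : sl K m 1), IsHom K pA (A : gl K m 1) →
      IsHom K pB (B : gl K m 1) → (C : gl K m 1) = sbr K ↑A ↑B →
      g A * g B - sg K (pA * pB) • (g B * g A) = g C) : Uenv K m →ₐ[K] S :=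
  RingQuot.liftAlgHom K ⟨TensorAlgebra.lift K g, by
    rintro _ _ ⟨pA, pB, A, B, C, hA, hB, hC, rfl, rfl⟩
    simpa using hg pA pB A B C hA hB hC⟩

lemma liftU_piU {S : Type} [Ring S] [Algebra K S] (g : sl K m 1 →ₗ[K] S) (hg) (A : sl K m 1) :
    liftU g hg (piU K m A) = g A := by
  simp [liftU, piU]

variable [CharZero K] [hm : Fact (2 ≤ m)]

lemma natCast_sub_one_ne_zero : (m : K) - 1 ≠ 0 := by
  have := hm.out
  rw [sub_ne_zero]
  exact_mod_cast (by omega : m ≠ 1)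

/-- The projection of `gl(m|1)` onto `sl(m|1)` along the identity. -/
def pr : gl K m 1 →ₗ[K] sl K m 1 :=
  LinearMap.codRestrict (sl K m 1)
    (LinearMap.id - (((m : K) - 1)⁻¹ • strL K m).smulRight (1 : gl K m 1)) fun A => by
      have h := natCast_sub_one_ne_zero (K := K) (m := m)
      rw [mem_sl, ← strL_apply, LinearMap.sub_apply, map_sub]
      simp only [LinearMap.id_apply, LinearMap.smulRight_apply, LinearMap.smul_apply, map_smul,
        strL_apply, str_one, smul_eq_mul]
      field_simp
      ring

lemma coe_pr (A : gl K m 1) :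
    (pr A : gl K m 1) = A - (((m : K) - 1)⁻¹ * str K A) • (1 : gl K m 1) := by
  simp [pr]

lemma pr_coe (A : sl K m 1) : pr (A : gl K m 1) = A := by
  ext1
  rw [coe_pr, mem_sl.1 A.2]; simp

lemma pr_one : pr (1 : gl K m 1) = 0 := by
  ext1
  rw [coe_pr, str_one, inv_mul_cancel₀ natCast_sub_one_ne_zero]; simp

lemma isHom_pr {p : ZMod 2} {A : gl K m 1} (h : IsHom K p A) : IsHom K p (pr A : gl K m 1) := by
  rw [coe_pr]
  rcases zmod_two_cases p with rfl | rfl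
  · exact h.sub (isHom_one.smul _)
  · rw [str_of_isHom_one h]; simpa using h

lemma sbr_pr (A B : gl K m 1) : sbr K (pr A : gl K m 1) (pr B) = sbr K A B := by
  rw [coe_pr, coe_pr, ← sbrL_apply]
  simp only [map_sub, map_smul, LinearMap.sub_apply, LinearMap.smul_apply, sbrL_apply,
    sbr_one_left, sbr_one_right, smul_zero, sub_zero]

/-- The canonical map extended by zero on the identity. -/
def piE (K : Type) [Field K] (m : ℕ) [CharZero K] [Fact (2 ≤ m)] : gl K m 1 →ₗ[K] Uenv K m :=
  piL K m ∘ₗ pr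

lemma piE_apply (A : gl K m 1) : piE K m A = piU K m (pr A) := rfl

lemma piE_coe (A : sl K m 1) : piE K m A = piU K m A := by rw [piE_apply, pr_coe]

lemma piE_one : piE K m 1 = 0 := by
  rw [piE, LinearMap.comp_apply, pr_one, map_zero]

lemma piE_comm {pA pB : ZMod 2} {A B : gl K m 1} (hA : IsHom K pA A) (hB : IsHom K pB B) :
    piE K m A * piE K m B - sg K (pA * pB) • (piE K m B * piE K m A) = piE K m (sbr K A B) := by
  rw [piE_apply, piE_apply, piE_apply]
  refine piU_comm (isHom_pr hA) (isHom_pr hB) ?_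
  rw [coe_pr, str_sbr, sbr_pr]; simp

/-- The space spanned by the identity and the generators. -/
def gen (K : Type) [Field K] (m : ℕ) [CharZero K] [Fact (2 ≤ m)] : Submodule K (Uenv K m) :=
  1 ⊔ LinearMap.range (piE K m)

lemma one_mem_gen : (1 : Uenv K m) ∈ gen K m := Submodule.one_le.1 le_sup_left

lemma piE_mem_gen (A : gl K m 1) : piE K m A ∈ gen K m := Submodule.mem_sup_right ⟨A, rfl⟩

lemma gen_pow_mono : Monotone fun n => gen K m ^ n := by
  refine monotone_nat_of_le_succ fun n u hu => ?_
  rw [pow_succ, ← mul_one u]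
  exact Submodule.mul_mem_mul hu one_mem_gen

lemma exists_mem_gen_pow (u : Uenv K m) : ∃ n, u ∈ gen K m ^ n := by
  obtain ⟨t, rfl⟩ := RingQuot.mkAlgHom_surjective K (urel K m) u
  induction t using TensorAlgebra.induction with
  | algebraMap c =>
    refine ⟨0, ?_⟩
    rw [AlgHom.commutes, pow_zero]
    exact Submodule.algebraMap_mem c
  | ι A =>
    refine ⟨1, ?_⟩
    rw [pow_one]
    have := piE_mem_gen (K := K) (m := m) A
    rwa [piE_coe] at this
  | mul a b ha hb =>
    obtain ⟨k, hk⟩ := ha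
    obtain ⟨l, hl⟩ := hb
    refine ⟨k + l, ?_⟩
    rw [map_mul, pow_add]
    exact Submodule.mul_mem_mul hk hl
  | add a b ha hb =>
    obtain ⟨k, hk⟩ := ha
    obtain ⟨l, hl⟩ := hb
    refine ⟨k + l, ?_⟩
    rw [map_add]
    exact add_mem (gen_pow_mono (Nat.le_add_right k l) hk) (gen_pow_mono (Nat.le_add_left l k) hl)

/-- Induction along the filtration by the number of factors. -/
lemma gen_pow_succ_induction {n : ℕ} {N : Submodule K (Uenv K m)}
    (h1 : ∀ u ∈ gen K m ^ n, u ∈ N)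
    (hA : ∀ (p : ZMod 2) (A : gl K m 1), IsHom K p A → ∀ u ∈ gen K m ^ n, piE K m A * u ∈ N) :
    gen K m ^ (n + 1) ≤ N := by
  rw [pow_succ', Submodule.mul_le]
  intro v hv u hu
  obtain ⟨c, hc, w, ⟨A, rfl⟩, rfl⟩ := Submodule.mem_sup.1 hv
  obtain ⟨c, rfl⟩ := Submodule.mem_one.1 hc
  rw [add_mul, ← evenP_add_oddP A, map_add, add_mul, Algebra.algebraMap_eq_smul_one, smul_one_mul]
  exact add_mem (Submodule.smul_mem _ _ (h1 u hu))
    (add_mem (hA 0 _ (isHom_evenP A) u hu) (hA 1 _ (isHom_oddP A) u hu))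

lemma algHom_ext_piE {S : Type} [Ring S] [Algebra K S] {f g : Uenv K m →ₐ[K] S}
    (h : ∀ (p : ZMod 2) (A : gl K m 1), IsHom K p A → f (piE K m A) = g (piE K m A)) : f = g := by
  ext A
  have hA : ∀ A, f (piE K m A) = g (piE K m A) := by
    intro A
    rw [← evenP_add_oddP A, map_add, map_add, map_add, h 0 _ (isHom_evenP A),
      h 1 _ (isHom_oddP A)]
  have := hA A
  rw [piE_coe] at this
  exact this

end Enveloping

section Adjoint

variable {m : ℕ}

/-- The `p`-th power of the parity automorphism of `gl(m|1)`. -/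
def tau (K : Type) [Field K] (m : ℕ) (p : ZMod 2) : gl K m 1 →ₗ[K] gl K m 1 :=
  LinearMap.id + (sg K p - 1) • oddPL

lemma tau_of_isHom (p : ZMod 2) {q : ZMod 2} {A : gl K m 1} (hA : IsHom K q A) :
    tau K m p A = sg K (p * q) • A := by
  simp only [tau, LinearMap.add_apply, LinearMap.smul_apply, LinearMap.id_apply, oddPL_apply,
    oddP_of_isHom hA]
  rcases zmod_two_cases q with rfl | rfl
  · simp
  · rw [if_neg one_ne_zero, mul_one]; module

/-- Scalar matrices over the enveloping algebra. -/
def bar (K : Type) [Field K] (m : ℕ) :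
    gl K m 1 →ₐ[K] Matrix (Fin (m + 1)) (Fin (m + 1)) (Uenv K m) :=
  (Algebra.ofId K (Uenv K m)).mapMatrix

lemma bar_apply (A : gl K m 1) (k l) : bar K m A k l = algebraMap K (Uenv K m) (A k l) := rfl

variable [CharZero K] [hm : Fact (2 ≤ m)]

/-- The `p`-th power of the parity automorphism of the enveloping algebra. -/
def Pw (K : Type) [Field K] (m : ℕ) [CharZero K] [Fact (2 ≤ m)] (p : ZMod 2) :
    Uenv K m →ₐ[K] Uenv K m :=
  liftU (piE K m ∘ₗ tau K m p ∘ₗ (sl K m 1).subtype) fun pA pB A B C hA hB hC => by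
    have hC' : IsHom K (pA + pB) (C : gl K m 1) := hC ▸ hA.sbr hB
    simp only [LinearMap.comp_apply, Submodule.subtype_apply, tau_of_isHom p hA,
      tau_of_isHom p hB, tau_of_isHom p hC', map_smul, mul_add, sg_add]
    rw [hC, ← piE_comm hA hB]
    simp only [smul_mul_smul_comm, smul_sub]
    module

lemma Pw_piE (p : ZMod 2) {q : ZMod 2} {A : gl K m 1} (hA : IsHom K q A) :
    Pw K m p (piE K m A) = sg K (p * q) • piE K m A := by
  rw [piE_apply, Pw, liftU_piU]
  simp only [LinearMap.comp_apply, Submodule.subtype_apply, tau_of_isHom p (isHom_pr hA),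
    map_smul, piE_coe]

lemma Pw_Pw (p q : ZMod 2) (u : Uenv K m) : Pw K m p (Pw K m q u) = Pw K m (p + q) u := by
  have : (Pw K m p).comp (Pw K m q) = Pw K m (p + q) := algHom_ext_piE fun t A hA => by
    rw [AlgHom.comp_apply, Pw_piE q hA, map_smul, Pw_piE p hA, Pw_piE _ hA, add_mul, sg_add,
      smul_smul, mul_comm]
  exact DFunLike.congr_fun this u

lemma Pw_zero (u : Uenv K m) : Pw K m 0 u = u := by
  have : Pw K m 0 = AlgHom.id K _ := algHom_ext_piE fun t A hA => by
    rw [Pw_piE 0 hA]; simp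
  exact DFunLike.congr_fun this u

lemma gen_mul_mem {n : ℕ} (A : gl K m 1) {u : Uenv K m} (hu : u ∈ gen K m ^ n) :
    piE K m A * u ∈ gen K m ^ (n + 1) := by
  rw [pow_succ']; exact Submodule.mul_mem_mul (piE_mem_gen A) hu

lemma mul_gen_mem {n : ℕ} (A : gl K m 1) {u : Uenv K m} (hu : u ∈ gen K m ^ n) :
    u * piE K m A ∈ gen K m ^ (n + 1) := by
  rw [pow_succ]; exact Submodule.mul_mem_mul hu (piE_mem_gen A)

lemma Pw_mem_gen_pow (p : ZMod 2) {n : ℕ} {u : Uenv K m} (hu : u ∈ gen K m ^ n) :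
    Pw K m p u ∈ gen K m ^ n := by
  suffices H : gen K m ^ n ≤ (gen K m ^ n).comap (Pw K m p).toLinearMap from H hu
  induction n generalizing u with
  | zero =>
    intro v hv
    rw [pow_zero] at hv ⊢
    obtain ⟨c, rfl⟩ := Submodule.mem_one.1 hv
    exact Submodule.mem_one.2 ⟨c, by simp⟩
  | succ n ih =>
    refine gen_pow_succ_induction (fun v hv => gen_pow_mono (Nat.le_succ n) (ih hv hv))
      fun q A hA v hv => ?_
    rw [Submodule.mem_comap, AlgHom.toLinearMap_apply, map_mul, Pw_piE p hA, smul_mul_assoc]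
    exact Submodule.smul_mem _ _ (gen_mul_mem A (ih hv hv))

/-- The adjoint representation on the enveloping algebra. -/
def rho (K : Type) [Field K] (m : ℕ) [CharZero K] [Fact (2 ≤ m)] :
    gl K m 1 →ₗ[K] Module.End K (Uenv K m) :=
  LinearMap.mk₂ K (fun A u => piE K m A * u - u * piE K m (A - oddPL A)
      - Pw K m 1 u * piE K m (oddPL A))
    (fun A B u => by simp only [map_add, map_sub, add_mul, mul_add, mul_sub]; abel)
    (fun c A u => by
      simp only [map_smul, map_sub, smul_mul_assoc, mul_smul_comm, mul_sub, smul_sub])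
    (fun A u v => by simp only [map_add, add_mul, mul_add]; abel)
    (fun c A u => by
      simp only [map_smul, smul_mul_assoc, mul_smul_comm, smul_sub])

lemma rho_apply {p : ZMod 2} {A : gl K m 1} (hA : IsHom K p A) (u : Uenv K m) :
    rho K m A u = piE K m A * u - Pw K m p u * piE K m A := by
  simp only [rho, LinearMap.mk₂_apply, oddPL_apply, oddP_of_isHom hA]
  rcases zmod_two_cases p with rfl | rfl <;> simp [Pw_zero]

lemma rho_mul {p : ZMod 2} {A : gl K m 1} (hA : IsHom K p A) (u v : Uenv K m) :
    rho K m A (u * v) = rho K m A u * v + Pw K m p u * rho K m A v := by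
  rw [rho_apply hA, rho_apply hA, rho_apply hA, map_mul]
  simp only [sub_mul, mul_sub, mul_assoc]
  abel

lemma rho_Pw {p : ZMod 2} {A : gl K m 1} (hA : IsHom K p A) (q : ZMod 2) (u : Uenv K m) :
    rho K m A (Pw K m q u) = sg K (q * p) • Pw K m q (rho K m A u) := by
  rw [rho_apply hA, rho_apply hA, map_sub, map_mul, map_mul, Pw_Pw, Pw_Pw, Pw_piE q hA,
    smul_mul_assoc, mul_smul_comm, smul_sub, smul_smul, smul_smul, sg_mul_self, one_smul, one_smul,
    add_comm p q]

lemma Pw_rho {p : ZMod 2} {A : gl K m 1} (hA : IsHom K p A) (q : ZMod 2) (u : Uenv K m) :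
    Pw K m q (rho K m A u) = sg K (q * p) • rho K m A (Pw K m q u) := by
  rw [rho_Pw hA, smul_smul, sg_mul_self, one_smul]

lemma rho_piE {p q : ZMod 2} {A B : gl K m 1} (hA : IsHom K p A) (hB : IsHom K q B) :
    rho K m A (piE K m B) = piE K m (sbr K A B) := by
  rw [rho_apply hA, Pw_piE p hB, ← piE_comm hA hB, smul_mul_assoc]

lemma isRep_rho : IsRep (rho K m) := by
  intro a b A B hA hB
  ext1 u
  simp only [LinearMap.sub_apply, Module.End.mul_apply, LinearMap.smul_apply]
  rw [rho_apply (hA.sbr hB), ← piE_comm hA hB, rho_apply hA (rho K m B u),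
    rho_apply hB (rho K m A u), rho_apply hA u, rho_apply hB u]
  simp only [map_sub, map_mul, Pw_Pw, Pw_piE a hB, Pw_piE b hA, mul_comm b a, add_comm b a]
  have hs := sg_mul_self (K := K) (a * b)
  generalize sg K (a * b) = s at *
  simp only [mul_sub, sub_mul, smul_mul_assoc, mul_smul_comm, smul_sub, mul_assoc, smul_smul, hs,
    one_smul]
  abel

lemma rho_one : rho K m 1 = 0 := by
  ext1 u
  rw [rho_apply isHom_one, piE_one]; simp

lemma rho_apply_one {p : ZMod 2} {A : gl K m 1} (hA : IsHom K p A) : rho K m A 1 = 0 := by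
  rw [rho_apply hA]; simp

lemma rho_mem_gen_pow {p : ZMod 2} {A : gl K m 1} (hA : IsHom K p A) {n : ℕ} {u : Uenv K m}
    (hu : u ∈ gen K m ^ n) : rho K m A u ∈ gen K m ^ n := by
  suffices H : gen K m ^ n ≤ (gen K m ^ n).comap (rho K m A) from H hu
  induction n generalizing u with
  | zero =>
    intro v hv
    rw [pow_zero] at hv
    obtain ⟨c, rfl⟩ := Submodule.mem_one.1 hv
    rw [Submodule.mem_comap, Algebra.algebraMap_eq_smul_one, map_smul, rho_apply_one hA, smul_zero]
    exact zero_mem _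
  | succ n ih =>
    refine gen_pow_succ_induction (fun v hv => gen_pow_mono (Nat.le_succ n) (ih hv hv))
      fun q B hB v hv => ?_
    rw [Submodule.mem_comap, rho_mul hA, rho_piE hA hB, Pw_piE p hB, smul_mul_assoc]
    exact add_mem (gen_mul_mem _ hv) (Submodule.smul_mem _ _ (gen_mul_mem B (ih hv hv)))

/-- The diagonal embedding of the enveloping algebra, twisted by parities. -/
def del (K : Type) [Field K] (m : ℕ) [CharZero K] [Fact (2 ≤ m)] :
    Uenv K m →ₐ[K] Matrix (Fin (m + 1)) (Fin (m + 1)) (Uenv K m) :=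
  (Matrix.diagonalAlgHom K).comp (AlgHom.pi fun k => Pw K m (par m 1 k))

lemma del_apply (u : Uenv K m) : del K m u = Matrix.diagonal fun k => Pw K m (par m 1 k) u := rfl

lemma bar_mul_del {p : ZMod 2} {A : gl K m 1} (hA : IsHom K p A) (u : Uenv K m) :
    bar K m A * del K m u = del K m (Pw K m p u) * bar K m A := by
  ext k l
  rw [del_apply, del_apply, Matrix.mul_diagonal, Matrix.diagonal_mul, bar_apply]
  by_cases h : A k l = 0
  · simp [h]
  · rw [Pw_Pw, ← hA k l h, ← add_assoc, (add_eq_zero_zmod_two _ _).2 rfl, zero_add]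
    exact Algebra.commutes _ _

/-- The coproduct followed by the standard representation in the second factor. -/
def coact (K : Type) [Field K] (m : ℕ) [CharZero K] [Fact (2 ≤ m)] :
    Uenv K m →ₐ[K] Matrix (Fin (m + 1)) (Fin (m + 1)) (Uenv K m) :=
  liftU ((del K m).toLinearMap ∘ₗ piL K m + (bar K m).toLinearMap ∘ₗ (sl K m 1).subtype)
    fun pA pB A B C hA hB hC => by
      have h1 := bar_mul_del hA (piU K m B)
      have h2 := bar_mul_del hB (piU K m A)
      have h3 := congrArg (del K m) (piU_comm hA hB hC)
      rw [← piE_coe, ← piE_coe] at *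
      rw [Pw_piE pA hB, map_smul, smul_mul_assoc] at h1
      rw [Pw_piE pB hA, map_smul, smul_mul_assoc, mul_comm] at h2
      simp only [map_sub, map_mul, map_smul] at h3
      simp only [LinearMap.add_apply, LinearMap.comp_apply, AlgHom.toLinearMap_apply,
        Submodule.subtype_apply, piL_apply]
      rw [← h3, hC, sbr_of_isHom hA hB, ← piE_coe A, ← piE_coe B]
      simp only [map_sub, map_smul, map_mul, mul_add, add_mul, h1, h2, smul_add, smul_smul,
        sg_mul_self, one_smul]
      abel

lemma coact_piE (A : gl K m 1) :
    coact K m (piE K m A) = del K m (piE K m A) + bar K m (pr A : gl K m 1) := by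
  rw [piE_apply, coact, liftU_piU]; simp

end Adjoint

section Coaction

variable {m : ℕ} [CharZero K] [hm : Fact (2 ≤ m)]

lemma mem_of_one_mem_of_piE_mul_mem {N : Submodule K (Uenv K m)} (h1 : 1 ∈ N)
    (hA : ∀ (p : ZMod 2) (A : gl K m 1), IsHom K p A → ∀ u ∈ N, piE K m A * u ∈ N)
    (u : Uenv K m) : u ∈ N := by
  obtain ⟨n, hn⟩ := exists_mem_gen_pow u
  suffices H : gen K m ^ n ≤ N from H hn
  clear hn u
  induction n with
  | zero => rw [pow_zero]; exact Submodule.one_le.2 h1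
  | succ n ih => exact gen_pow_succ_induction (fun v hv => ih hv) fun p A h v hv => hA p A h v (ih hv)

/-- The matrix entries of the coaction, without the diagonal part. -/
def ent (k l : Fin (m + 1)) : Uenv K m →ₗ[K] Uenv K m :=
  (Pw K m (par m 1 k)).toLinearMap ∘ₗ Matrix.entryLinearMap K (Uenv K m) k l ∘ₗ
    ((coact K m).toLinearMap - (del K m).toLinearMap)

lemma ent_apply (k l : Fin (m + 1)) (u : Uenv K m) :
    ent k l u = Pw K m (par m 1 k) ((coact K m u - del K m u) k l) := rfl

lemma coact_sub_del (k l : Fin (m + 1)) (u : Uenv K m) :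
    (coact K m u - del K m u) k l = Pw K m (par m 1 k) (ent k l u) := by
  rw [ent_apply, Pw_Pw, (add_eq_zero_zmod_two _ _).2 rfl, Pw_zero]

lemma ent_one (k l : Fin (m + 1)) : ent k l (1 : Uenv K m) = 0 := by
  rw [ent_apply, map_one, map_one, sub_self, Matrix.zero_apply, map_zero]

lemma Pw_Pw_self (p : ZMod 2) (u : Uenv K m) : Pw K m p (Pw K m p u) = u := by
  rw [Pw_Pw, (add_eq_zero_zmod_two _ _).2 rfl, Pw_zero]

lemma ent_piE_mul (A : gl K m 1) (k l : Fin (m + 1)) (u : Uenv K m) :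
    ent k l (piE K m A * u) = piE K m A * ent k l u
      + (pr A : gl K m 1) k l • Pw K m (par m 1 k + par m 1 l) u
      + ∑ j, (pr A : gl K m 1) k j • Pw K m (par m 1 k + par m 1 j) (ent j l u) := by
  have h : coact K m (piE K m A * u) - del K m (piE K m A * u) =
      del K m (piE K m A) * (coact K m u - del K m u) + bar K m (pr A : gl K m 1) * del K m u
        + bar K m (pr A : gl K m 1) * (coact K m u - del K m u) := by
    rw [map_mul, map_mul, coact_piE]
    simp only [add_mul, mul_sub]
    abel
  rw [ent_apply, h, Matrix.add_apply, Matrix.add_apply, del_apply, del_apply,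
    Matrix.diagonal_mul, Matrix.mul_diagonal, Matrix.mul_apply, ← del_apply, coact_sub_del]
  simp only [coact_sub_del, bar_apply, map_add, map_sum, map_mul, map_smul, Pw_Pw,
    (add_eq_zero_zmod_two (par m 1 k) _).2 rfl, Pw_zero, ← Algebra.smul_def]

lemma ent_Pw (p : ZMod 2) (k l : Fin (m + 1)) (u : Uenv K m) :
    ent k l (Pw K m p u) = sg K ((par m 1 k + par m 1 l) * p) • Pw K m p (ent k l u) := by
  let N : Submodule K (Uenv K m) :=
    { carrier := {u | ∀ k l, ent k l (Pw K m p u) =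
        sg K ((par m 1 k + par m 1 l) * p) • Pw K m p (ent k l u)}
      add_mem' := fun {u v} hu hv k l => by simp only [map_add, hu k l, hv k l, smul_add]
      zero_mem' := fun k l => by simp
      smul_mem' := fun c u hu k l => by
        simp only [map_smul, hu k l]; rw [smul_comm] }
  have h₃ : ∀ a b c : ZMod 2, a + b + (b + c) = a + c := by decide
  refine mem_of_one_mem_of_piE_mul_mem (N := N) (fun k l => ?_) (fun q A hA u hu k l => ?_) u k l
  · rw [map_one, ent_one, map_zero, smul_zero]
  · have hs : ∀ k l (x : Uenv K m), sg K (p * q) • (pr A : gl K m 1) k l • x =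
        sg K ((par m 1 k + par m 1 l) * p) • (pr A : gl K m 1) k l • x := by
      intro k l x
      by_cases h : (pr A : gl K m 1) k l = 0
      · simp [h]
      · rw [isHom_pr hA k l h, mul_comm]
    have hu' : ∀ k l, ent k l (Pw K m p u) =
      sg K ((par m 1 k + par m 1 l) * p) • Pw K m p (ent k l u) := hu
    rw [map_mul, Pw_piE p hA, smul_mul_assoc, map_smul, ent_piE_mul, ent_piE_mul]
    simp only [map_add, map_mul, map_smul, map_sum, Pw_Pw, Pw_piE p hA, smul_add, hu',
      Finset.smul_sum, hs, smul_mul_assoc, mul_smul_comm]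
    refine congrArg₂ _ (congrArg₂ _ (smul_comm _ _ _) ?_) (Finset.sum_congr rfl fun j _ => ?_)
    · rw [add_comm p]
    · rw [smul_comm _ (sg K ((par m 1 j + par m 1 l) * p)), smul_smul, smul_comm, smul_smul, ← sg_add, ← add_mul,
        show par m 1 k + par m 1 j + (par m 1 j + par m 1 l) = par m 1 k + par m 1 l from
          h₃ _ _ _, mul_comm, mul_smul, add_comm p]

lemma ent_rho {p : ZMod 2} {A : gl K m 1} (hA : IsHom K p A) (k l : Fin (m + 1))
    (u : Uenv K m) :
    ent k l (rho K m A u) = rho K m A (ent k l u)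
      + ∑ j, A k j • Pw K m (par m 1 k + par m 1 j) (ent j l u)
      - ∑ j, (sg K ((par m 1 k + par m 1 j) * p) * A j l) • Pw K m p (ent k j u) := by
  have h : coact K m (rho K m A u) - del K m (rho K m A u) =
      del K m (piE K m A) * (coact K m u - del K m u)
        - (coact K m (Pw K m p u) - del K m (Pw K m p u)) * del K m (piE K m A)
        + bar K m (pr A : gl K m 1) * (coact K m u - del K m u)
        - (coact K m (Pw K m p u) - del K m (Pw K m p u)) * bar K m (pr A : gl K m 1) := by
    have hb := bar_mul_del (isHom_pr hA) u
    rw [rho_apply hA, map_sub, map_sub, map_mul, map_mul, map_mul, map_mul, coact_piE]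
    simp only [add_mul, mul_add, mul_sub, sub_mul, hb]
    abel
  have h' : bar K m (pr A : gl K m 1) * (coact K m u - del K m u)
        - (coact K m (Pw K m p u) - del K m (Pw K m p u)) * bar K m (pr A : gl K m 1) =
      bar K m A * (coact K m u - del K m u)
        - (coact K m (Pw K m p u) - del K m (Pw K m p u)) * bar K m A := by
    rcases zmod_two_cases p with rfl | rfl
    · rw [coe_pr]
      simp only [map_sub, map_smul, map_one, mul_sub, sub_mul, smul_mul_assoc, mul_smul_comm,
        one_mul, mul_one, Pw_zero, smul_sub]
      abel
    · rw [coe_pr, str_of_isHom_one hA, mul_zero, zero_smul, sub_zero]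
  have e₁ : ∀ a b : ZMod 2, a + (a + b) = b := by decide
  have hs : sg K (par m 1 l * p) * sg K ((par m 1 k + par m 1 l) * p) * sg K (par m 1 k * p) = 1 := by
    have e₃ : ∀ a b c : ZMod 2, b * c + (a + b) * c + a * c = 0 := by decide
    rw [← sg_add, ← sg_add, e₃, sg_zero]
  rw [ent_apply, h, add_sub_assoc, h', Matrix.add_apply, Matrix.sub_apply, Matrix.sub_apply,
    del_apply (piE K m A), Matrix.diagonal_mul, Matrix.mul_diagonal, Matrix.mul_apply,
    Matrix.mul_apply, rho_apply hA]
  simp only [coact_sub_del, bar_apply, map_add, map_sub, map_sum, map_mul, Pw_Pw,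
    ent_Pw, map_smul, smul_mul_assoc, e₁, hs, (add_eq_zero_zmod_two (par m 1 k) _).2 rfl, Pw_zero, ← Algebra.smul_def, ← Algebra.commutes,
    Pw_piE _ hA, mul_smul_comm, smul_smul, sg_mul_self, one_smul]
  abel

/-- The operator counting the number of factors to leading order. -/
def euler (K : Type) [Field K] (m : ℕ) [CharZero K] [Fact (2 ≤ m)] :
    Uenv K m →ₗ[K] Uenv K m :=
  ∑ k, ∑ l, (LinearMap.mulRight K (piE K m (mu k l))) ∘ₗ ent k l

lemma euler_apply (u : Uenv K m) :
    euler K m u = ∑ k, ∑ l, ent k l u * piE K m (mu k l) := by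
  simp [euler, LinearMap.sum_apply]

/-- The filtration by the number of factors, shifted by one. -/
def fil (K : Type) [Field K] (m : ℕ) [CharZero K] [Fact (2 ≤ m)] (n : ℕ) :
    Submodule K (Uenv K m) :=
  match n with
  | 0 => ⊥
  | n + 1 => gen K m ^ n

lemma fil_succ (n : ℕ) : fil K m (n + 1) = gen K m ^ n := rfl

lemma fil_le_succ (n : ℕ) : fil K m n ≤ fil K m (n + 1) := by
  cases n with
  | zero => exact bot_le
  | succ n => exact gen_pow_mono n.le_succ

lemma piE_mul_mem_fil {n : ℕ} (A : gl K m 1) {u : Uenv K m} (hu : u ∈ fil K m n) :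
    piE K m A * u ∈ fil K m (n + 1) := by
  cases n with
  | zero => rw [(Submodule.mem_bot K).1 hu, mul_zero]; exact zero_mem _
  | succ n => exact gen_mul_mem A hu

lemma mul_piE_mem_fil {n : ℕ} (A : gl K m 1) {u : Uenv K m} (hu : u ∈ fil K m n) :
    u * piE K m A ∈ fil K m (n + 1) := by
  cases n with
  | zero => rw [(Submodule.mem_bot K).1 hu, zero_mul]; exact zero_mem _
  | succ n => exact mul_gen_mem A hu

lemma Pw_mem_fil (p : ZMod 2) {n : ℕ} {u : Uenv K m} (hu : u ∈ fil K m n) :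
    Pw K m p u ∈ fil K m n := by
  cases n with
  | zero => rw [(Submodule.mem_bot K).1 hu, map_zero]; exact zero_mem _
  | succ n => exact Pw_mem_gen_pow p hu

lemma rho_mem_fil {p : ZMod 2} {A : gl K m 1} (hA : IsHom K p A) {n : ℕ} {u : Uenv K m}
    (hu : u ∈ fil K m n) : rho K m A u ∈ fil K m n := by
  cases n with
  | zero => rw [(Submodule.mem_bot K).1 hu, map_zero]; exact zero_mem _
  | succ n => exact rho_mem_gen_pow hA hu

lemma ent_mem_fil {n : ℕ} (k l : Fin (m + 1)) {u : Uenv K m} (hu : u ∈ fil K m (n + 1)) :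
    ent k l u ∈ fil K m n := by
  suffices H : gen K m ^ n ≤ (fil K m n).comap (ent k l) from H hu
  clear hu u
  induction n generalizing k l with
  | zero =>
    rw [pow_zero, Submodule.one_le, Submodule.mem_comap, ent_one]
    exact zero_mem _
  | succ n ih =>
    refine gen_pow_succ_induction (fun v hv => fil_le_succ n (ih k l hv)) fun q A hA v hv => ?_
    rw [Submodule.mem_comap, ent_piE_mul]
    refine add_mem (add_mem (piE_mul_mem_fil A (ih k l hv)) (Submodule.smul_mem _ _ ?_))
      (sum_mem fun j _ => Submodule.smul_mem _ _ (Pw_mem_fil _ (fil_le_succ n (ih j l hv))))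
    exact Pw_mem_gen_pow _ hv

lemma euler_piE_mul {p : ZMod 2} {A : gl K m 1} (hA : IsHom K p A) (u : Uenv K m) :
    euler K m (piE K m A * u) = piE K m A * euler K m u + piE K m A * u - rho K m A u
      + ∑ k, ∑ l, (∑ j, (pr A : gl K m 1) k j • Pw K m (par m 1 k + par m 1 j) (ent j l u))
        * piE K m (mu k l) := by
  have h : ∑ k, ∑ l, ((pr A : gl K m 1) k l • Pw K m (par m 1 k + par m 1 l) u)
      * piE K m (mu k l) = Pw K m p u * piE K m A := by
    have hp : piE K m A = piE K m (pr A : gl K m 1) := by rw [piE_coe, piE_apply]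
    rw [hp]
    conv_rhs => rw [eq_sum_mu (pr A : gl K m 1)]
    simp only [map_sum, map_smul, Finset.mul_sum]
    refine Finset.sum_congr rfl fun k _ => Finset.sum_congr rfl fun l _ => ?_
    by_cases h : (pr A : gl K m 1) k l = 0
    · simp [h]
    · rw [isHom_pr hA k l h, smul_mul_assoc, mul_smul_comm]
  rw [rho_apply hA, ← h, euler_apply, euler_apply]
  simp only [ent_piE_mul, add_mul, Finset.sum_add_distrib, Finset.mul_sum, mul_assoc]
  abel

lemma euler_sub_mem_fil {n : ℕ} {u : Uenv K m} (hu : u ∈ fil K m (n + 1)) :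
    euler K m u - (n : K) • u ∈ fil K m n := by
  suffices H : gen K m ^ n ≤ (fil K m n).comap (euler K m - (n : K) • LinearMap.id) from H hu
  clear hu u
  induction n with
  | zero =>
    rw [pow_zero, Submodule.one_le, Submodule.mem_comap]
    simp [euler_apply, ent_one]
  | succ n ih =>
    have ih' : ∀ v ∈ gen K m ^ n, euler K m v - (n : K) • v ∈ fil K m n := fun v hv => ih hv
    refine gen_pow_succ_induction (fun v hv => ?_) fun q A hA v hv => ?_ <;>
      simp only [Submodule.mem_comap, LinearMap.sub_apply, LinearMap.smul_apply,
        LinearMap.id_apply, Nat.cast_add, Nat.cast_one]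
    · have : euler K m v - ((n : K) + 1) • v = (euler K m v - (n : K) • v) - v := by module
      rw [this]
      exact sub_mem (fil_le_succ n (ih' v hv)) hv
    · rw [euler_piE_mul hA]
      have := piE_mul_mem_fil A (ih' v hv)
      rw [mul_sub, mul_smul_comm] at this
      have h2 : ∑ k, ∑ l, (∑ j, (pr A : gl K m 1) k j •
          Pw K m (par m 1 k + par m 1 j) (ent j l v)) * piE K m (mu k l) ∈ fil K m (n + 1) :=
        sum_mem fun k _ => sum_mem fun l _ => mul_piE_mem_fil _ <| sum_mem fun j _ =>
          Submodule.smul_mem _ _ (Pw_mem_fil _ (ent_mem_fil j l hv))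
      have h3 : rho K m A v ∈ fil K m (n + 1) := rho_mem_fil hA hv
      convert add_mem (sub_mem this h3) h2 using 1
      module

end Coaction

section Exactness

variable {m : ℕ}

lemma mu_apply (p q k j : Fin (m + 1)) :
    (mu p q : gl K m 1) k j = if k = p then if j = q then 1 else 0 else 0 := by
  simp only [mu, Matrix.single_apply, ← ite_and, eq_comm]

lemma sum_mem_of_pair {V ι : Type*} [AddCommGroup V] [Module K V] [Fintype ι] [DecidableEq ι]
    {N : Submodule K V} {f : ι → V} {p q : ι} (hpq : p ≠ q) (h : f p + f q ∈ N)
    (h' : ∀ k, k ≠ p → k ≠ q → f k ∈ N) : ∑ k, f k ∈ N := by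
  rw [← Finset.add_sum_erase _ _ (Finset.mem_univ p),
    ← Finset.add_sum_erase _ _ (Finset.mem_erase.2 ⟨hpq.symm, Finset.mem_univ q⟩), ← add_assoc]
  refine add_mem h (sum_mem fun k hk => ?_)
  simp only [Finset.mem_erase, Finset.mem_univ, and_true] at hk
  exact h' k hk.2 hk.1

lemma apply_eq_smul_of_sq {V : Type*} [AddCommGroup V] [Module K V] {T : Module.End K V}
    (hT : ⨆ c, T.eigenspace c = ⊤) {c : K} {x : V}
    (hx : (T - c • 1) ((T - c • 1) x) = 0) : T x = c • x := by
  have hle : ∀ i, T.eigenspace i ≤ T.maxGenEigenspace i := fun i y hy =>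
    (Module.End.mem_maxGenEigenspace T i y).2 ⟨1, by
      rw [pow_one, LinearMap.sub_apply, Module.End.mem_eigenspace_iff.1 hy]; simp⟩
  have hx' : x ∈ T.maxGenEigenspace c :=
    (Module.End.mem_maxGenEigenspace T c x).2 ⟨2, by rw [pow_two]; exact hx⟩
  have htop : x ∈ T.eigenspace c ⊔ ⨆ (i) (_ : i ≠ c), T.eigenspace i := by
    have : x ∈ ⨆ c, T.eigenspace c := hT ▸ Submodule.mem_top
    refine (iSup_le fun i => ?_ : (⨆ c, T.eigenspace c) ≤ _) this
    rcases eq_or_ne i c with rfl | hi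
    · exact le_sup_left
    · exact le_sup_of_le_right (le_iSup₂_of_le i hi le_rfl)
  obtain ⟨y, hy, z, hz, rfl⟩ := Submodule.mem_sup.1 htop
  have hz' : z ∈ ⨆ (i) (_ : i ≠ c), T.maxGenEigenspace i :=
    (iSup₂_mono fun i _ => hle i : (⨆ (i) (_ : i ≠ c), T.eigenspace i) ≤ _) hz
  have hzc : z ∈ T.maxGenEigenspace c := by
    have := sub_mem hx' (hle c hy)
    rwa [add_sub_cancel_left] at this
  have : z = 0 := Submodule.disjoint_def.1 (T.independent_maxGenEigenspace c) z hzc hz'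
  rw [this, add_zero, Module.End.mem_eigenspace_iff.1 hy]

lemma Uenv.sub_mul (u v w : Uenv K m) : (u - v) * w = u * w - v * w := _root_.sub_mul u v w

lemma Uenv.mul_neg (u v : Uenv K m) : u * -v = -(u * v) := _root_.mul_neg u v

lemma Uenv.neg_smul (c : K) (u : Uenv K m) : (-c) • u = -(c • u) := _root_.neg_smul c u

lemma Uenv.sub_smul (c d : K) (u : Uenv K m) : (c - d) • u = c • u - d • u :=
  _root_.sub_smul c d u

variable [CharZero K] [hm : Fact (2 ≤ m)]

lemma ent_rho_mu (p q k l : Fin (m + 1)) (u : Uenv K m) :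
    ent k l (rho K m (mu p q) u) = rho K m (mu p q) (ent k l u)
      + (if k = p then Pw K m (pu p q) (ent q l u) else 0)
      - (if l = q then sg K (pu k p * pu p q) • Pw K m (pu p q) (ent k p u) else 0) := by
  rw [ent_rho (isHom_mu p q)]
  congr 1
  · congr 1
    split_ifs with h
    · subst h; simp [mu_apply, pu]
    · simp [mu_apply, h]
  · split_ifs with h
    · subst h; simp [mu_apply, pu]
    · simp [mu_apply, h]

lemma rho_mu_ent_of_odd {p q : Fin (m + 1)} (hpq : pu p q = 1) {u : Uenv K m}
    (hu : rho K m (mu p q) u = 0) (k l : Fin (m + 1)) :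
    rho K m (mu p q) (ent k l u) = (if l = q then sg K (pu k p) • Pw K m 1 (ent k p u) else 0)
      - (if k = p then Pw K m 1 (ent q l u) else 0) := by
  have h := ent_rho_mu p q k l u
  rw [hu, map_zero, hpq, mul_one] at h
  generalize (if l = q then sg K (pu k p) • Pw K m 1 (ent k p u) else 0) = x at h ⊢
  generalize (if k = p then Pw K m 1 (ent q l u) else 0) = y at h ⊢
  rw [← sub_eq_zero, h]
  abel

lemma rho_mu_diag_ent {p : Fin (m + 1)} {c : K} {u : Uenv K m}
    (hu : rho K m (mu p p) u = c • u) (k l : Fin (m + 1)) :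
    rho K m (mu p p) (ent k l u) = (c - (wt k l p : K)) • ent k l u := by
  have h := ent_rho_mu p p k l u
  have hp : pu p p = 0 := (add_eq_zero_zmod_two _ _).2 rfl
  rw [hu, map_smul, hp, mul_zero, sg_zero, one_smul, Pw_zero, Pw_zero] at h
  have hwt : (wt k l p : K) • ent k l u =
      (if k = p then ent p l u else 0) - if l = p then ent k p u else 0 := by
    by_cases h1 : k = p
    · subst h1
      by_cases h2 : l = k
      · subst h2; simp [wt]
      · simp [wt, h2, Ne.symm h2]
    · by_cases h2 : l = p
      · subst h2; simp [wt, h1, Ne.symm h1, Uenv.neg_smul]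
      · simp [wt, h1, h2, Ne.symm h1, Ne.symm h2]
  rw [Uenv.sub_smul, h, hwt]
  abel

lemma rho_mu_piE (p q k l : Fin (m + 1)) :
    rho K m (mu p q) (piE K m (mu k l)) = (if q = k then piE K m (mu p l) else 0)
      - sg K (pu p q * pu k l) • (if l = p then piE K m (mu k q) else 0) := by
  rw [rho_piE (isHom_mu p q) (isHom_mu k l), sbr_mu, map_sub, map_smul, apply_ite (piE K m),
    apply_ite (piE K m), map_zero]

lemma rho_mu_diag_piE (p k l : Fin (m + 1)) :
    rho K m (mu p p) (piE K m (mu k l)) = (wt k l p : K) • piE K m (mu k l) := by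
  rw [rho_piE (isHom_mu_diag p) (isHom_mu k l), sbr_mu_diag, map_smul]

lemma rho_mu_diag_euler {p : Fin (m + 1)} {c : K} {u : Uenv K m}
    (hu : rho K m (mu p p) u = c • u) :
    rho K m (mu p p) (euler K m u) = c • euler K m u := by
  simp only [euler_apply, map_sum, Finset.smul_sum]
  refine Finset.sum_congr rfl fun k _ => Finset.sum_congr rfl fun l _ => ?_
  rw [rho_mul (isHom_mu_diag p), rho_mu_diag_ent hu, Pw_zero, rho_mu_diag_piE, smul_mul_assoc,
    mul_smul_comm]
  module

lemma rho_mu_odd_sq {p q : Fin (m + 1)} (hpq : pu p q = 1) (u : Uenv K m) :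
    rho K m (mu p q) (rho K m (mu p q) u) = 0 := by
  have hne : q ≠ p := by
    rintro rfl
    rw [pu, (add_eq_zero_zmod_two _ _).2 rfl] at hpq
    exact zero_ne_one hpq
  have h := isRep_rho.apply_comm (isHom_mu (K := K) p q) (isHom_mu p q) u
  rw [sbr_mu, if_neg hne, smul_zero, sub_zero, map_zero, hpq] at h
  simp only [mul_one, sg_one, LinearMap.zero_apply, zero_add, Uenv.neg_smul, one_smul] at h
  rw [eq_neg_iff_add_eq_zero, ← two_smul K] at h
  exact (smul_eq_zero.1 h).resolve_left two_ne_zero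

lemma exists_rho_eq_euler {n : ℕ} {p q : Fin (m + 1)} {c : K} (hpq : pu p q = 1)
    (ih : ∀ w ∈ fil K m n, rho K m (mu p p) w = c • w → rho K m (mu p q) w = 0 →
      ∃ v ∈ fil K m n, rho K m (mu p q) v = w)
    {u : Uenv K m} (hu : u ∈ fil K m (n + 1)) (huc : rho K m (mu p p) u = c • u)
    (hu0 : rho K m (mu p q) u = 0) :
    ∃ v ∈ fil K m (n + 1), rho K m (mu p q) v = euler K m u := by
  have hne : p ≠ q := by
    rintro rfl
    rw [pu, (add_eq_zero_zmod_two _ _).2 rfl] at hpq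
    exact zero_ne_one hpq
  have ha : IsHom K 1 (mu p q : gl K m 1) := hpq ▸ isHom_mu p q
  have hw := rho_mu_ent_of_odd hpq hu0
  suffices H : euler K m u ∈ (fil K m (n + 1)).map (rho K m (mu p q)) from H
  rw [euler_apply]
  refine sum_mem_of_pair hne ?_ fun k hkp hkq => sum_mem_of_pair hne ?_ fun l hlp hlq => ?_
  · refine ⟨∑ l, Pw K m 1 (ent p l u) * piE K m (mu q l), sum_mem fun l _ =>
      mul_piE_mem_fil _ (Pw_mem_fil _ (ent_mem_fil p l hu)), ?_⟩
    have : ∀ l, rho K m (mu p q) (Pw K m 1 (ent p l u) * piE K m (mu q l)) =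
        ent p l u * piE K m (mu p l) + ent q l u * piE K m (mu q l)
          + ((if l = p then ent p p u * piE K m (mu q q) else 0)
            - if l = q then ent p p u * piE K m (mu q q) else 0) := by
      intro l
      rw [rho_mul ha, rho_Pw ha, Pw_Pw_self, hw, rho_mu_piE, hpq, if_pos rfl, if_pos rfl]
      have hqp : pu q p = 1 := by rw [← hpq, pu, pu, add_comm]
      have hpp : pu p p = 0 := (add_eq_zero_zmod_two _ _).2 rfl
      by_cases h1 : l = p
      · subst h1
        simp [hne, hqp, Pw_Pw_self, mul_add, Uenv.neg_smul]
        abel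
      · by_cases h2 : l = q
        · subst h2
          simp [h1, hpp, Pw_Pw_self, Uenv.neg_smul, Uenv.sub_mul]
          abel
        · simp [h1, h2, Pw_Pw_self]
          abel
    rw [map_sum, Finset.sum_congr rfl fun l _ => this l]
    simp [Finset.sum_add_distrib, Finset.sum_sub_distrib]
  · refine ⟨-(sg K (pu k p) • (Pw K m 1 (ent k q u) * piE K m (mu k p))), neg_mem
      (Submodule.smul_mem _ _ (mul_piE_mem_fil _ (Pw_mem_fil _ (ent_mem_fil k q hu)))), ?_⟩
    rw [map_neg, map_smul, rho_mul ha, rho_Pw ha, Pw_Pw_self, hw, rho_mu_piE, hpq, if_pos rfl,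
      if_neg hkp, if_neg (Ne.symm hkq), if_pos rfl, sub_zero, zero_sub, map_smul, Pw_Pw_self]
    have hs := sg_mul_self (K := K) (pu k p)
    rw [mul_one, sg_one, one_mul, smul_mul_assoc, smul_mul_assoc]
    generalize ent k p u * piE K m (mu k p) = y
    rw [Uenv.mul_neg, mul_smul_comm]
    generalize ent k q u * piE K m (mu k q) = z
    have : ∀ s : K, s * s = 1 → -(s • ((-1 : K) • s • y + -(s • z))) = y + z := by
      intro s hs
      linear_combination (norm := module) hs • (y + z)
    exact this _ hs
  · obtain ⟨v, hv, hvw⟩ := ih (ent k l u) (ent_mem_fil k l hu)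
      (by rw [rho_mu_diag_ent huc, wt, if_neg (Ne.symm hkp), if_neg (Ne.symm hlp)]; simp)
      (by rw [hw, if_neg hlq, if_neg hkp, sub_zero])
    refine ⟨v * piE K m (mu k l), mul_piE_mem_fil _ hv, ?_⟩
    rw [rho_mul ha, hvw, rho_mu_piE, if_neg (Ne.symm hkq), if_neg hlp]
    simp

/-- An odd matrix unit is exact on the eigenspaces of nonzero weight. -/
lemma rho_odd_exact {p q : Fin (m + 1)} {c : K} (hpq : pu p q = 1) (hc : c ≠ 0) (n : ℕ) :
    ∀ u ∈ fil K m n, rho K m (mu p p) u = c • u → rho K m (mu p q) u = 0 →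
      ∃ v ∈ fil K m n, rho K m (mu p q) v = u := by
  induction n with
  | zero =>
    intro u hu _ _
    exact ⟨0, zero_mem _, by rw [(Submodule.mem_bot K).1 hu, map_zero]⟩
  | succ n ih =>
    intro u hu huc hu0
    obtain ⟨v, hv, hvu⟩ := exists_rho_eq_euler hpq ih hu huc hu0
    have hn := euler_sub_mem_fil hu
    rcases eq_or_ne n 0 with rfl | hn0
    · rw [fil_succ, pow_zero] at hu
      obtain ⟨t, rfl⟩ := Submodule.mem_one.1 hu
      rw [Algebra.algebraMap_eq_smul_one, map_smul, rho_apply_one (isHom_mu_diag p), smul_zero]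
        at huc
      have := (smul_eq_zero.1 huc.symm).resolve_left hc
      exact ⟨0, zero_mem _, by rw [Algebra.algebraMap_eq_smul_one, this, map_zero]⟩
    · obtain ⟨v', hv', hvu'⟩ := ih _ hn
        (by rw [map_sub, map_smul, rho_mu_diag_euler huc, huc]; module)
        (by rw [map_sub, map_smul, hu0, ← hvu, rho_mu_odd_sq hpq, smul_zero, sub_zero])
      refine ⟨(n : K)⁻¹ • (v - v'), Submodule.smul_mem _ _ (sub_mem hv (fil_le_succ n hv')), ?_⟩
      rw [map_smul, map_sub, hvu, hvu', sub_sub_cancel, smul_smul,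
        inv_mul_cancel₀ (Nat.cast_ne_zero.2 hn0), one_smul]

lemma iSup_eigenspace_rho (a : Fin (m + 1)) :
    ⨆ c : K, (rho K m (mu a a)).eigenspace c = ⊤ := by
  have hN : ∀ c u, rho K m (mu a a) u = c • u →
      u ∈ ⨆ c : K, (rho K m (mu a a)).eigenspace c := fun c u hu =>
    Submodule.mem_iSup_of_mem c (Module.End.mem_eigenspace_iff.2 hu)
  refine eq_top_iff.2 fun u _ => mem_of_one_mem_of_piE_mul_mem
    (hN 0 1 (by rw [rho_apply_one (isHom_mu_diag a), zero_smul])) (fun _ A _ u hu => ?_) u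
  induction hu using Submodule.iSup_induction' with
  | zero => rw [mul_zero]; exact zero_mem _
  | add x y _ _ hx hy => rw [mul_add]; exact add_mem hx hy
  | mem c x hx =>
    rw [Module.End.mem_eigenspace_iff] at hx
    rw [eq_sum_mu A]
    simp only [map_sum, map_smul, Finset.sum_mul, smul_mul_assoc]
    refine sum_mem fun k _ => sum_mem fun l _ => Submodule.smul_mem _ _
      (hN ((wt k l a : K) + c) _ ?_)
    rw [rho_mul (isHom_mu_diag a), rho_mu_diag_piE, Pw_zero, hx, smul_mul_assoc, mul_smul_comm,
      add_smul]

end Exactness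

section Parity

variable {m : ℕ}

lemma piU_mul_mem_Upart {p q : ZMod 2} {A : sl K m 1} (hA : IsHom K p (A : gl K m 1))
    {u : Uenv K m} (hu : u ∈ Upart K m q) : piU K m A * u ∈ Upart K m (p + q) := by
  suffices H : Upart K m q ≤ (Upart K m (p + q)).comap (LinearMap.mulLeft K (piU K m A)) from H hu
  refine Submodule.span_le.2 ?_
  rintro _ ⟨l, hl, rfl, rfl⟩
  exact Submodule.subset_span ⟨(p, A) :: l, by simpa using ⟨hA, by simpa using hl⟩, by simp, by simp⟩

lemma one_mem_Upart : (1 : Uenv K m) ∈ Upart K m 0 :=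
  Submodule.subset_span ⟨[], by simp, by simp, by simp⟩

variable [CharZero K] [hm : Fact (2 ≤ m)]

lemma Pw_of_mem_Upart (q : ZMod 2) {p : ZMod 2} {u : Uenv K m} (hu : u ∈ Upart K m p) :
    Pw K m q u = sg K (q * p) • u := by
  induction hu using Submodule.span_induction with
  | mem u hu =>
    obtain ⟨l, hl, rfl, rfl⟩ := hu
    induction l with
    | nil => simp
    | cons x l ih =>
      rw [List.map_cons, List.prod_cons, map_mul, List.map_cons, List.sum_cons,
        ih fun y hy => hl y (List.mem_cons_of_mem _ hy), ← piE_coe,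
        Pw_piE q (hl x List.mem_cons_self), smul_mul_smul_comm, mul_add, sg_add]
  | zero => simp
  | add u v _ _ hu hv => rw [map_add, hu, hv, smul_add]
  | smul c u _ hu => rw [map_smul, hu, smul_comm]

lemma add_smul_Pw_mem_Upart (p : ZMod 2) (u : Uenv K m) : u + sg K p • Pw K m 1 u ∈ Upart K m p := by
  let N : Submodule K (Uenv K m) :=
    { carrier := {u | ∀ p, u + sg K p • Pw K m 1 u ∈ Upart K m p}
      add_mem' := fun {u v} hu hv p => by
        rw [map_add, smul_add, add_add_add_comm]
        exact add_mem (hu p) (hv p)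
      zero_mem' := fun p => by simp
      smul_mem' := fun c u hu p => by
        rw [map_smul, smul_comm, ← smul_add]
        exact Submodule.smul_mem _ _ (hu p) }
  refine mem_of_one_mem_of_piE_mul_mem (N := N) (fun p => ?_) (fun q A hA u hu p => ?_) u p
  · rw [map_one]
    rcases zmod_two_cases p with rfl | rfl
    · exact add_mem one_mem_Upart (Submodule.smul_mem _ _ one_mem_Upart)
    · rw [sg_one, Uenv.neg_smul, one_smul, ← sub_eq_add_neg, sub_self]
      exact zero_mem _
  · have e : ∀ p q : ZMod 2, q + (p + q) = p := by decide
    have h := piU_mul_mem_Upart (isHom_pr hA) (hu (p + q))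
    rw [e] at h
    rw [map_mul, Pw_piE 1 hA, one_mul, smul_mul_assoc, smul_smul, ← sg_add]
    rwa [mul_add, mul_smul_comm, ← piE_apply] at h

lemma adAct_eq_rho {p q : ZMod 2} {A : sl K m 1} (hA : IsHom K p (A : gl K m 1)) {u : Uenv K m}
    (hu : u ∈ Upart K m q) : adAct K m p A q u = rho K m A u := by
  rw [rho_apply hA, Pw_of_mem_Upart p hu, smul_mul_assoc, piE_coe, adAct]

end Parity

section Twist

variable {m : ℕ} [CharZero K] [hm : Fact (2 ≤ m)]

instance finite_gen_pow (n : ℕ) : Module.Finite K ↥(gen K m ^ n) := by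
  rw [Module.Finite.iff_fg]
  refine Submodule.FG.pow (Submodule.FG.sup ?_ ?_) n
  · rw [Submodule.one_eq_span]
    exact Submodule.fg_span_singleton _
  · rw [LinearMap.range_eq_map]
    exact Module.Finite.fg_top.map _

lemma rho_tau_mem (p : ZMod 2) {n : ℕ} (A : gl K m 1) {u : Uenv K m} (hu : u ∈ gen K m ^ n) :
    rho K m (tau K m p A) u ∈ gen K m ^ n := by
  rw [← evenP_add_oddP A, map_add, tau_of_isHom p (isHom_evenP A), tau_of_isHom p (isHom_oddP A),
    map_add, map_smul, map_smul]
  exact add_mem (Submodule.smul_mem _ _ (rho_mem_gen_pow (isHom_evenP A) hu))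
    (Submodule.smul_mem _ _ (rho_mem_gen_pow (isHom_oddP A) hu))

/-- The adjoint representation on a filtration piece of the enveloping algebra, twisted by a
power of the parity automorphism. -/
def twr (K : Type) [Field K] (m : ℕ) [CharZero K] [Fact (2 ≤ m)] (p : ZMod 2) (n : ℕ) :
    gl K m 1 →ₗ[K] Module.End K ↥(gen K m ^ n) where
  toFun A := (rho K m (tau K m p A)).restrict fun _ hu => rho_tau_mem p A hu
  map_add' A B := by ext u; simp
  map_smul' c A := by ext u; simp

lemma coe_twr (p : ZMod 2) {n : ℕ} {q : ZMod 2} {A : gl K m 1} (hA : IsHom K q A)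
    (u : ↥(gen K m ^ n)) : (twr K m p n A u : Uenv K m) = sg K (p * q) • rho K m A u := by
  change rho K m (tau K m p A) u = _
  rw [tau_of_isHom p hA, map_smul, LinearMap.smul_apply]

lemma isRep_twr (p : ZMod 2) (n : ℕ) : IsRep (M := ↥(gen K m ^ n)) (twr K m p n) := by
  intro a b A B hA hB
  refine LinearMap.ext fun u => Subtype.ext ?_
  change (twr K m p n (sbr K A B) u : Uenv K m) = (twr K m p n A (twr K m p n B u) : Uenv K m)
    - sg K (a * b) • (twr K m p n B (twr K m p n A u) : Uenv K m)
  rw [coe_twr p hA, coe_twr p hB, coe_twr p hB, coe_twr p hA, coe_twr p (hA.sbr hB),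
    isRep_rho a b A B hA hB, mul_add, sg_add]
  simp only [map_smul, LinearMap.sub_apply, LinearMap.smul_apply, Module.End.mul_apply]
  module

lemma twr_one (p : ZMod 2) (n : ℕ) : twr K m p n 1 = 0 := by
  ext u
  rw [coe_twr p isHom_one, rho_one]; simp

lemma coe_twr_mu_diag (p : ZMod 2) {n : ℕ} (a : Fin (m + 1)) (u : ↥(gen K m ^ n)) :
    (twr K m p n (mu a a) u : Uenv K m) = rho K m (mu a a) u := by
  rw [coe_twr p (isHom_mu_diag a), mul_zero, sg_zero, one_smul]

lemma diagSemisimple_twr (p : ZMod 2) (n : ℕ) : DiagSemisimple (M := ↥(gen K m ^ n)) (twr K m p n) := by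
  intro a c x hx
  ext
  rw [coe_twr_mu_diag, Submodule.coe_smul]
  refine apply_eq_smul_of_sq (iSup_eigenspace_rho a) ?_
  have h := congrArg Subtype.val hx
  change (twr K m p n (mu a a) (twr K m p n (mu a a) x - (c : K) • x) : Uenv K m)
    - (c : K) • ((twr K m p n (mu a a) x : Uenv K m) - (c : K) • (x : Uenv K m)) = 0 at h
  rw [coe_twr_mu_diag] at h
  change rho K m (mu a a) ((twr K m p n (mu a a) x : Uenv K m) - (c : K) • (x : Uenv K m))
    - (c : K) • ((twr K m p n (mu a a) x : Uenv K m) - (c : K) • (x : Uenv K m)) = 0 at h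
  rw [coe_twr_mu_diag] at h
  exact h

lemma oddExact_twr (p : ZMod 2) (n : ℕ) : OddExact (M := ↥(gen K m ^ n)) (twr K m p n) := by
  intro a b k u hab hk hu hu0
  have hs := sg_mul_self (K := K) (p * pu a b)
  have h := congrArg Subtype.val hu
  have h0 := congrArg Subtype.val hu0
  rw [coe_twr_mu_diag] at h
  rw [coe_twr p (isHom_mu a b)] at h0
  have hne : sg K (p * pu a b) ≠ 0 := left_ne_zero_of_mul_eq_one hs
  obtain ⟨v, hv, hvu⟩ := rho_odd_exact hab (Int.cast_ne_zero.2 hk : (k : K) ≠ 0) (n + 1)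
    (u : Uenv K m) u.2 h ((smul_eq_zero.1 h0).resolve_left hne)
  refine ⟨sg K (p * pu a b) • ⟨v, hv⟩, ?_⟩
  ext
  rw [map_smul, Submodule.coe_smul, coe_twr p (isHom_mu a b), smul_smul, hs, one_smul]
  exact hvu

end Twist

section Primitive

variable {m : ℕ} [CharZero K] [hm : Fact (2 ≤ m)]

lemma exists_forall_mem_gen_pow (f : Bil K m (Uenv K m)) : ∃ n, ∀ A B, f A B ∈ gen K m ^ n := by
  choose N hN using fun x : (Fin (m + 1) × Fin (m + 1)) × Fin (m + 1) × Fin (m + 1) =>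
    exists_mem_gen_pow (f (mu x.1.1 x.1.2) (mu x.2.1 x.2.2))
  refine ⟨Finset.univ.sup N, fun A B => ?_⟩
  rw [eq_sum_mu A, eq_sum_mu B]
  simp only [map_sum, map_smul, LinearMap.sum_apply, LinearMap.smul_apply]
  refine sum_mem fun a _ => sum_mem fun b _ => Submodule.smul_mem _ _ <| sum_mem fun c _ =>
    sum_mem fun d _ => Submodule.smul_mem _ _ ?_
  exact gen_pow_mono (Finset.le_sup (Finset.mem_univ ((c, d), a, b))) (hN ((c, d), a, b))

lemma exists_eq_cobd_twr (p : ZMod 2) {n : ℕ} {g : Bil K m ↥(gen K m ^ n)}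
    (hg : g ∈ normCocycles (M := ↥(gen K m ^ n)) (twr K m p n)) :
    ∃ φ : gl K m 1 →ₗ[K] ↥(gen K m ^ n), ∀ (pA pB : ZMod 2) (A B : gl K m 1),
      IsHom K pA A → IsHom K pB B →
      (g A B : Uenv K m) = sg K (p * pA) • rho K m A (φ B)
        - sg K (pA * pB + p * pB) • rho K m B (φ A) - φ (sbr K A B) := by
  obtain ⟨φ, hφ⟩ := exists_eq_cobd (M := ↥(gen K m ^ n)) hm.out (isRep_twr p n) (twr_one p n)
    (diagSemisimple_twr p n) (oddExact_twr p n) hg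
  refine ⟨φ, fun pA pB A B hA hB => ?_⟩
  have h : g A B = cobd (M := ↥(gen K m ^ n)) (twr K m p n) φ A B := by rw [← hφ]
  have h2 := cobd_apply_of_isHom (M := ↥(gen K m ^ n)) (twr K m p n) φ hA hB
  have h3 := h.trans h2
  have h4 : (g A B : Uenv K m) = (twr K m p n A (φ B) : Uenv K m)
    - sg K (pA * pB) • (twr K m p n B (φ A) : Uenv K m) - (φ (sbr K A B) : Uenv K m) := by
    rw [h3]; rfl
  rw [h4, coe_twr p hA, coe_twr p hB, smul_smul, ← sg_add]

/-- Cocycles of parity `p` with values in the enveloping algebra have a primitive. -/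
lemma exists_primitive (p : ZMod 2) {f : Bil K m (Uenv K m)}
    (hskew : ∀ (pA pB : ZMod 2) (A B : gl K m 1), IsHom K pA A → IsHom K pB B →
      f B A = -(sg K (pA * pB) • f A B))
    (hcocycle : ∀ (pA pB pC : ZMod 2) (A B C : gl K m 1),
      IsHom K pA A → IsHom K pB B → IsHom K pC C →
      sg K (p * pA) • rho K m A (f B C) - sg K (pA * pB + p * pB) • rho K m B (f A C)
        + sg K ((pA + pB) * pC + p * pC) • rho K m C (f A B)
        - f (sbr K A B) C + sg K (pB * pC) • f (sbr K A C) B + f A (sbr K B C) = 0)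
    (h1 : f 1 = 0) :
    ∃ φ : gl K m 1 →ₗ[K] Uenv K m, ∀ (pA pB : ZMod 2) (A B : gl K m 1),
      IsHom K pA A → IsHom K pB B →
      f A B = sg K (p * pA) • rho K m A (φ B) - sg K (pA * pB + p * pB) • rho K m B (φ A)
        - φ (sbr K A B) := by
  obtain ⟨n, hn⟩ := exists_forall_mem_gen_pow f
  let g : Bil K m ↥(gen K m ^ n) := LinearMap.mk₂ K (fun A B => ⟨f A B, hn A B⟩)
    (fun A B C => Subtype.ext (by simp)) (fun c A B => Subtype.ext (by simp))
    (fun A B C => Subtype.ext (by simp)) (fun c A B => Subtype.ext (by simp))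
  have hg : ∀ A B, (g A B : Uenv K m) = f A B := fun A B => rfl
  have hgc : g ∈ normCocycles (M := ↥(gen K m ^ n)) (twr K m p n) := by
    refine mem_normCocycles.2 ⟨⟨fun pA pB A B hA hB => Subtype.ext (hskew pA pB A B hA hB),
      fun pA pB pC A B C hA hB hC => Subtype.ext ?_⟩,
      LinearMap.ext fun B => Subtype.ext (by rw [hg, h1]; rfl)⟩
    change (twr K m p n A (g B C) : Uenv K m)
      - sg K (pA * pB) • (twr K m p n B (g A C) : Uenv K m)
      + sg K ((pA + pB) * pC) • (twr K m p n C (g A B) : Uenv K m)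
      - f (sbr K A B) C + sg K (pB * pC) • f (sbr K A C) B + f A (sbr K B C) = 0
    rw [coe_twr p hA, coe_twr p hB, coe_twr p hC, hg, hg, hg, smul_smul, smul_smul, ← sg_add,
      ← sg_add]
    exact hcocycle pA pB pC A B C hA hB hC
  obtain ⟨φ, hφ⟩ := exists_eq_cobd_twr p hgc
  exact ⟨(gen K m ^ n).subtype ∘ₗ φ, hφ⟩

/-- The homogeneous component of parity `p` of a linear map. -/
def parityPart (p : ZMod 2) (φ : gl K m 1 →ₗ[K] Uenv K m) : gl K m 1 →ₗ[K] Uenv K m :=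
  (2⁻¹ : K) • (φ + sg K p • ((Pw K m 1).toLinearMap ∘ₗ φ ∘ₗ tau K m 1))

lemma parityPart_of_isHom (p : ZMod 2) (φ : gl K m 1 →ₗ[K] Uenv K m) {q : ZMod 2}
    {A : gl K m 1} (hA : IsHom K q A) :
    parityPart p φ A = (2⁻¹ : K) • (φ A + sg K (q + p) • Pw K m 1 (φ A)) := by
  simp only [parityPart, LinearMap.smul_apply, LinearMap.add_apply, LinearMap.comp_apply,
    AlgHom.toLinearMap_apply, tau_of_isHom 1 hA, one_mul, map_smul, smul_smul, ← sg_add,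
    add_comm p]

lemma parityPart_mem (p : ZMod 2) (φ : gl K m 1 →ₗ[K] Uenv K m) {q : ZMod 2}
    {A : gl K m 1} (hA : IsHom K q A) : parityPart p φ A ∈ Upart K m (q + p) := by
  rw [parityPart_of_isHom p φ hA]
  exact Submodule.smul_mem _ _ (add_smul_Pw_mem_Upart _ _)

lemma eq_cobd_parityPart {p pA pB : ZMod 2} {φ : gl K m 1 →ₗ[K] Uenv K m} {A B : gl K m 1}
    (hA : IsHom K pA A) (hB : IsHom K pB B) {u : Uenv K m} (hu : u ∈ Upart K m (pA + pB + p))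
    (h : u = sg K (p * pA) • rho K m A (φ B) - sg K (pA * pB + p * pB) • rho K m B (φ A)
      - φ (sbr K A B)) :
    u = sg K (p * pA) • rho K m A (parityPart p φ B)
      - sg K (pA * pB + p * pB) • rho K m B (parityPart p φ A)
      - parityPart p φ (sbr K A B) := by
  have h' := congrArg (fun x => sg K (pA + pB + p) • Pw K m 1 x) h
  simp only [Pw_of_mem_Upart 1 hu, one_mul, smul_smul, sg_mul_self, one_smul] at h'
  rw [map_sub, map_sub, map_smul, map_smul, Pw_rho hA, Pw_rho hB, one_mul, one_mul] at h'
  rw [parityPart_of_isHom p φ hA, parityPart_of_isHom p φ hB,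
    parityPart_of_isHom p φ (hA.sbr hB)]
  have hsA := sg_mul_self (K := K) pA
  have hsB := sg_mul_self (K := K) pB
  simp only [map_smul, map_add]
  simp only [sg_add] at *
  generalize sg K pA = a at *
  generalize sg K pB = b at *
  generalize sg K p = c at *
  generalize sg K (p * pA) = d at *
  generalize sg K (pA * pB) = e at *
  generalize sg K (p * pB) = t at *
  generalize rho K m A (Pw K m 1 (φ B)) = x at *
  generalize rho K m B (Pw K m 1 (φ A)) = y at *
  have h2 : u = (2⁻¹ : K) • (u + u) := by rw [← two_smul K u, smul_smul]; simp
  rw [h2]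
  nth_rw 1 [h]
  rw [h']
  linear_combination (norm := module) hsA • (((2⁻¹ : K) * b * c * d) • x) - hsB • (((2⁻¹ : K) * a * c * e * t) • y)

end Primitive

/-- Let `m ≥ 2` and `L = sl(m|1)`.  Then `H²(L, U(L)) = 0`: every
2-cocycle of `L` with coefficients in its enveloping algebra `U(L)` (with the adjoint
action) is a 2-coboundary. -/
theorem second_cohomology_enveloping_algebra_sl_m_1
    (K : Type) [Field K] [IsAlgClosed K] [CharZero K] (m : ℕ) (hm : 2 ≤ m)
    (p : ZMod 2) (f : ↥(sl K m 1) →ₗ[K] ↥(sl K m 1) →ₗ[K] Uenv K m)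
    -- `f` is a 2-cochain of parity `p` ...
    (hgrade : ∀ (pA pB : ZMod 2) (A B : ↥(sl K m 1)),
      IsHom K pA (A : gl K m 1) → IsHom K pB (B : gl K m 1) →
      f A B ∈ Upart K m (pA + pB + p))
    (hskew : ∀ (pA pB : ZMod 2) (A B : ↥(sl K m 1)),
      IsHom K pA (A : gl K m 1) → IsHom K pB (B : gl K m 1) →
      f B A = -(sg K (pA * pB) • f A B))
    -- ... satisfying the 2-cocycle identity:
    (hcocycle : ∀ (pA pB pC : ZMod 2) (A B C AB AC BC : ↥(sl K m 1)),
      IsHom K pA (A : gl K m 1) → IsHom K pB (B : gl K m 1) → IsHom K pC (C : gl K m 1) →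
      (AB : gl K m 1) = sbr K ↑A ↑B → (AC : gl K m 1) = sbr K ↑A ↑C →
      (BC : gl K m 1) = sbr K ↑B ↑C →
      sg K (p * pA) • adAct K m pA A (pB + pC + p) (f B C)
        - sg K (pA * pB + p * pB) • adAct K m pB B (pA + pC + p) (f A C)
        + sg K ((pA + pB) * pC + p * pC) • adAct K m pC C (pA + pB + p) (f A B)
        - f AB C + sg K (pB * pC) • f AC B + f A BC = 0) :
    -- then `f` is a 2-coboundary:
    ∃ φ : ↥(sl K m 1) →ₗ[K] Uenv K m,
      (∀ (q : ZMod 2) (A : ↥(sl K m 1)), IsHom K q (A : gl K m 1) → φ A ∈ Upart K m (q + p)) ∧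
      ∀ (pA pB : ZMod 2) (A B AB : ↥(sl K m 1)),
        IsHom K pA (A : gl K m 1) → IsHom K pB (B : gl K m 1) →
        (AB : gl K m 1) = sbr K ↑A ↑B →
        f A B = sg K (p * pA) • adAct K m pA A (pB + p) (φ B)
          - sg K (pA * pB + p * pB) • adAct K m pB B (pA + p) (φ A) - φ AB := by
  have : Fact (2 ≤ m) := ⟨hm⟩
  have hbr : ∀ A B : gl K m 1, (pr (sbr K A B) : gl K m 1) = sbr K (pr A : gl K m 1) (pr B) :=
    fun A B => by rw [sbr_pr, coe_pr, str_sbr]; simp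
  have hmem : ∀ {pA pB : ZMod 2} {A B : gl K m 1}, IsHom K pA A → IsHom K pB B →
      f (pr A) (pr B) ∈ Upart K m (pA + pB + p) := fun hA hB =>
    hgrade _ _ _ _ (isHom_pr hA) (isHom_pr hB)
  have hpr : ∀ A : gl K m 1, rho K m (pr A : gl K m 1) = rho K m A := fun A => by
    rw [coe_pr, map_sub, map_smul, rho_one, smul_zero]
    exact LinearMap.ext fun u => sub_zero (rho K m A u)
  obtain ⟨φ, hφ⟩ := exists_primitive (f := f.compl₁₂ pr pr) p
    (fun pA pB A B hA hB => hskew pA pB _ _ (isHom_pr hA) (isHom_pr hB))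
    (fun pA pB pC A B C hA hB hC => by
      have h := hcocycle pA pB pC _ _ _ _ _ _ (isHom_pr hA) (isHom_pr hB) (isHom_pr hC)
        (hbr A B) (hbr A C) (hbr B C)
      rw [adAct_eq_rho (isHom_pr hA) (hmem hB hC), adAct_eq_rho (isHom_pr hB) (hmem hA hC),
        adAct_eq_rho (isHom_pr hC) (hmem hA hB), hpr, hpr, hpr] at h
      exact h)
    (by ext B; simp [pr_one])
  refine ⟨parityPart p φ ∘ₗ (sl K m 1).subtype, fun q A hA => parityPart_mem p φ hA,
    fun pA pB A B AB hA hB hAB => ?_⟩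
  have h := eq_cobd_parityPart hA hB (hmem hA hB) (hφ pA pB A B hA hB)
  rw [pr_coe, pr_coe, ← hAB] at h
  rw [LinearMap.comp_apply, LinearMap.comp_apply, LinearMap.comp_apply, Submodule.subtype_apply,
    Submodule.subtype_apply, Submodule.subtype_apply,
    adAct_eq_rho hA (parityPart_mem p φ hB), adAct_eq_rho hB (parityPart_mem p φ hA)]
  exact h
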